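/- (Wu–Zhang, Stafford–Zhang) Let k be a field and let H be an affine noetherian Hopf algebra over k satisfying a polynomial identity, and suppose H has finite global dimension. Then H is a finite direct sum of prime rings, and H is a finitely generated module over its centre. -/

import Mathlib

open CategoryTheory

universe w v u u' u2

/-!
STATEMENT 13 (Wu–Zhang, Stafford–Zhang):
An affine noetherian Hopf algebra over a field satisfying a polynomial identity and
having finite global dimension is a finite direct sum of prime rings and a finitely
generated module over its centre.
-/

/-! ### Ext groups over an arbitrary ring -/

instance hasExtModuleCat (R : Type u) [Ring R] :
    HasExt.{max u (v + 1)} (ModuleCat.{v} R) :=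
  letI := HasDerivedCategory.standard (ModuleCat.{v} R)
  hasExt_of_hasDerivedCategory _

/-- The canonical map `(X ⟶ Y) → Ext X Y 0` is additive. -/
lemma Ext_mk₀_add {C : Type*} [Category C] [Abelian C] [HasExt.{w} C] {X Y : C}
    (f g : X ⟶ Y) :
    Abelian.Ext.mk₀ (f + g) = Abelian.Ext.mk₀ f + Abelian.Ext.mk₀ g := by
  letI := HasDerivedCategory.standard C
  ext
  rw [Abelian.Ext.add_hom, Abelian.Ext.mk₀_hom, Abelian.Ext.mk₀_hom, Abelian.Ext.mk₀_hom,
    Functor.map_add]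
  dsimp [ShiftedHom.mk₀]
  rw [Preadditive.add_comp]

/-- The Ext-group `Ext_A^i (M, N)` for two left `A`-modules `M` and `N`. -/
noncomputable abbrev ExtGroup (A : Type u) [Ring A]
    (M : Type v) [AddCommGroup M] [Module A M]
    (N : Type w) [AddCommGroup N] [Module A N] (i : ℕ) :=
  Abelian.Ext (C := ModuleCat.{max v w u} A)
    (ModuleCat.of A (ULift.{max w u} M)) (ModuleCat.of A (ULift.{max v u} N)) i


/-- A ring has finite global dimension if there is a uniform bound above which all
Ext-groups vanish. -/
def HasFiniteGlobalDimension (A : Type u) [Ring A] : Prop :=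
  ∃ n : ℕ, ∀ (M N : Type u) [AddCommGroup M] [Module A M] [AddCommGroup N] [Module A N],
    ∀ i : ℕ, n < i → Subsingleton (ExtGroup A M N i)

/-- An algebra `A` over `k` satisfies a polynomial identity if there is a nonzero
polynomial `f` in finitely many noncommuting variables, with coefficients in `k`,
which vanishes identically on `A`. -/
def SatisfiesPolynomialIdentity (k : Type u') (A : Type u) [CommSemiring k] [Ring A]
    [Algebra k A] : Prop :=
  ∃ (n : ℕ) (f : FreeAlgebra k (Fin n)), f ≠ 0 ∧
    ∀ v : Fin n → A, FreeAlgebra.lift k v f = 0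

/-- A decomposition of a ring `H` as a finite direct sum (= direct product) of prime
rings; a ring `R` is prime when `a R b = 0` implies `a = 0` or `b = 0`. -/
structure FiniteDirectSumOfPrimeRings (H : Type u) [Ring H] where
  n : ℕ
  factor : Fin n → Type u
  [ringFactor : ∀ i, Ring (factor i)]
  isPrime : ∀ (i : Fin n) (a b : factor i), (∀ x : factor i, a * x * b = 0) → a = 0 ∨ b = 0
  equiv : H ≃+* ∀ i, factor i

/-- Every PI algebra satisfies a multilinear identity in which the identity word has
coefficient one. -/
def MultilinearIdentity (k : Type*) (A : Type*) [CommRing k] [Ring A] [Algebra k A] {D : ℕ}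
    (α : Equiv.Perm (Fin D) → k) : Prop :=
  ∀ z : Fin D → A, ∑ σ : Equiv.Perm (Fin D), α σ • (List.ofFn fun i => z (σ i)).prod = 0

lemma sum_neg_one_pow_card_of_subset {ι : Type*} [Fintype ι] [DecidableEq ι] {A : Type*}
    [AddCommGroup A] (P : Finset ι → Prop) [DecidablePred P] (j : ι)
    (hP : ∀ S, P (insert j S) ↔ P (S.erase j)) (a : A) :
    ∑ S : Finset ι, (if P S then (-1 : ℤ) ^ S.card • a else 0) = 0 := by
  refine Finset.sum_involution (fun S _ => if j ∈ S then S.erase j else insert j S) ?_ ?_ ?_ ?_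
  · intro S _
    by_cases hj : j ∈ S
    · have h1 := hP S
      rw [Finset.insert_eq_of_mem hj] at h1
      simp only [hj, if_true]
      by_cases h : P S
      · rw [if_pos h, if_pos (h1.1 h)]
        rw [← Finset.card_erase_add_one hj, pow_succ]
        simp
      · rw [if_neg h, if_neg (fun h' => h (h1.2 h'))]; simp
    · have h1 := hP S
      rw [Finset.erase_eq_of_notMem hj] at h1
      simp only [hj, if_false]
      by_cases h : P S
      · rw [if_pos h, if_pos (h1.2 h), Finset.card_insert_of_notMem hj, pow_succ]
        simp
      · rw [if_neg h, if_neg (fun h' => h (h1.1 h'))]; simp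
  · intro S _ _ h
    by_cases hj : j ∈ S
    · simp only [hj, if_true] at h
      exact Finset.notMem_erase j S (h.symm ▸ hj)
    · simp only [hj, if_false] at h
      exact hj (h ▸ Finset.mem_insert_self j S)
  · intros; simp
  · intro S _
    by_cases hj : j ∈ S
    · simp [hj, Finset.insert_erase hj]
    · simp [hj, Finset.erase_insert hj]

/-- The alternating sum over subsets of a product of partial sums. -/
lemma alternating_sum_prod {A : Type*} [Ring A] {D l : ℕ} {n : ℕ} (w0 : Fin D → Fin n)
    (z : Fin D → A) (w : Fin l → Fin n) :
    ∑ S : Finset (Fin D), (-1 : ℤ) ^ S.card •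
      (List.ofFn fun p => ∑ j : Fin D, if j ∈ S ∧ w0 j = w p then z j else 0).prod =
    ∑ τ : Fin l → Fin D, if Function.Surjective τ ∧ w0 ∘ τ = w then
      (-1 : ℤ) ^ D • (List.ofFn fun p => z (τ p)).prod else 0 := by
  have key : ∀ S : Finset (Fin D),
      (List.ofFn fun p => ∑ j : Fin D, if j ∈ S ∧ w0 j = w p then z j else 0).prod =
      ∑ τ : Fin l → Fin D, if (∀ p, τ p ∈ S) ∧ w0 ∘ τ = w then
        (List.ofFn fun p => z (τ p)).prod else 0 := by
    intro S
    have := (MultilinearMap.mkPiAlgebraFin ℤ l A).map_sum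
      (fun (p : Fin l) (j : Fin D) => if j ∈ S ∧ w0 j = w p then z j else 0)
    simp only [MultilinearMap.mkPiAlgebraFin_apply] at this
    rw [this]
    refine Finset.sum_congr rfl fun τ _ => ?_
    split_ifs with h
    · congr 2
      funext p
      rw [if_pos ⟨h.1 p, congrFun h.2 p⟩]
    · have : ∃ p, ¬ (τ p ∈ S ∧ w0 (τ p) = w p) := by
        by_contra hh
        push Not at hh
        exact h ⟨fun p => (hh p).1, funext fun p => (hh p).2⟩
      obtain ⟨p, hp⟩ := this
      have := (MultilinearMap.mkPiAlgebraFin ℤ l A).map_coord_zero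
        (m := fun p => if τ p ∈ S ∧ w0 (τ p) = w p then z (τ p) else 0) p (if_neg hp)
      simpa only [MultilinearMap.mkPiAlgebraFin_apply] using this
  simp only [key, Finset.smul_sum]
  rw [Finset.sum_comm]
  refine Finset.sum_congr rfl fun τ _ => ?_
  by_cases hw : w0 ∘ τ = w
  · simp only [hw, and_true]
    by_cases hτ : Function.Surjective τ
    · rw [if_pos hτ, Finset.sum_eq_single Finset.univ]
      · simp
      · intro S _ hS
        rw [if_neg, smul_zero]
        intro h
        apply hS
        ext j
        obtain ⟨p, rfl⟩ := hτ j
        simp [h p]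
      · simp
    · rw [if_neg hτ]
      have : ∃ j, ∀ p, τ p ≠ j := by
        by_contra hh
        push Not at hh
        exact hτ hh
      obtain ⟨j, hj⟩ := this
      have := sum_neg_one_pow_card_of_subset (fun S : Finset (Fin D) => ∀ p, τ p ∈ S) j
        (fun S => by simp [hj]) (List.ofFn fun p => z (τ p)).prod
      simpa only [smul_ite, smul_zero] using this
  · simp [hw]

lemma alternating_sum_word {A : Type*} [Ring A] {D : ℕ} {n : ℕ} (w0 : Fin D → Fin n)
    (z : Fin D → A) (w : List (Fin n)) (hl : w.length ≤ D) :
    ∑ S : Finset (Fin D), (-1 : ℤ) ^ S.card •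
      (w.map fun i => ∑ j : Fin D, if j ∈ S ∧ w0 j = i then z j else 0).prod =
    ∑ σ : Equiv.Perm (Fin D), if List.ofFn (w0 ∘ σ) = w then
      (-1 : ℤ) ^ D • (List.ofFn fun p => z (σ p)).prod else 0 := by
  classical
  obtain ⟨l, u, rfl⟩ : ∃ (l : ℕ) (u : Fin l → Fin n), w = List.ofFn u :=
    ⟨w.length, w.get, (List.ofFn_get w).symm⟩
  simp only [List.length_ofFn] at hl
  simp only [List.map_ofFn]
  have h1 := alternating_sum_prod w0 z u
  simp only [Function.comp_def] at h1 ⊢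
  rw [h1]
  rcases hl.lt_or_eq with hl | rfl
  · rw [Finset.sum_eq_zero, Finset.sum_eq_zero]
    · intro σ _
      rw [if_neg]
      intro h
      have := congrArg List.length h
      simp at this
      omega
    · intro τ _
      rw [if_neg]
      rintro ⟨h, -⟩
      have := Fintype.card_le_of_surjective τ h
      simp at this
      omega
  · symm
    refine Finset.sum_of_injOn (fun σ : Equiv.Perm (Fin l) => (σ : Fin l → Fin l)) ?_ ?_ ?_ ?_
    · intro σ _ τ _ h
      exact DFunLike.coe_injective h
    · intro σ _
      simp
    · intro τ _ h
      rw [if_neg]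
      rintro ⟨h', -⟩
      apply h
      exact ⟨Equiv.ofBijective τ ⟨Finite.injective_iff_surjective.2 h', h'⟩, by simp, rfl⟩
    · intro σ _
      have : Function.Surjective σ := σ.surjective
      simp only [this, true_and, List.ofFn_inj]

lemma FreeAlgebra.lift_eq_sum {k A : Type*} [Field k] [Ring A] [Algebra k A] {n : ℕ} (v : Fin n → A)
    (f : FreeAlgebra k (Fin n)) :
    FreeAlgebra.lift k v f = (FreeAlgebra.equivMonoidAlgebraFreeMonoid f).coeff.sum
      (fun w a => a • (List.map v (FreeMonoid.toList w)).prod) := by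
  have : FreeAlgebra.lift k v =
      (MonoidAlgebra.lift k A (FreeMonoid (Fin n)) (FreeMonoid.lift v)).comp
      FreeAlgebra.equivMonoidAlgebraFreeMonoid.toAlgHom := by
    apply FreeAlgebra.hom_ext
    funext i
    simp [FreeAlgebra.equivMonoidAlgebraFreeMonoid]
  rw [this]
  simp [MonoidAlgebra.lift_apply, FreeMonoid.lift_apply]

lemma exists_multilinearIdentity {k : Type u'} {A : Type u} [Field k] [Ring A] [Algebra k A]
    (h : SatisfiesPolynomialIdentity k A) :
    ∃ (D : ℕ) (α : Equiv.Perm (Fin D) → k), α 1 = 1 ∧ MultilinearIdentity k A α := by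
  classical
  obtain ⟨n, f, hf, hv⟩ := h
  let c : FreeMonoid (Fin n) →₀ k := (FreeAlgebra.equivMonoidAlgebraFreeMonoid f).coeff
  have hc : c ≠ 0 := by
    intro h0
    apply hf
    apply FreeAlgebra.equivMonoidAlgebraFreeMonoid.injective
    rw [map_zero]
    ext x
    exact DFunLike.congr_fun h0 x
  obtain ⟨w0, hw0, hmax⟩ := Finset.exists_max_image c.support
    (fun w => (FreeMonoid.toList w).length) (Finsupp.support_nonempty_iff.2 hc)
  let D := (FreeMonoid.toList w0).length
  let u : Fin D → Fin n := (FreeMonoid.toList w0).get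
  have hu : List.ofFn u = FreeMonoid.toList w0 := List.ofFn_get _
  have hcu : c (FreeMonoid.ofList (List.ofFn u)) ≠ 0 := by
    rw [hu]; exact Finsupp.mem_support_iff.1 hw0
  refine ⟨D, fun σ => (c (FreeMonoid.ofList (List.ofFn u)))⁻¹ *
    c (FreeMonoid.ofList (List.ofFn (u ∘ σ))), ?_, ?_⟩
  · simp only [Equiv.Perm.coe_one, Function.comp_id]
    exact inv_mul_cancel₀ hcu
  · intro z
    have h1 : ∑ S : Finset (Fin D), (-1 : ℤ) ^ S.card • FreeAlgebra.lift k
        (fun i => ∑ j : Fin D, if j ∈ S ∧ u j = i then z j else 0) f = 0 :=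
      Finset.sum_eq_zero fun S _ => by rw [hv, smul_zero]
    simp only [FreeAlgebra.lift_eq_sum] at h1
    change ∑ S : Finset (Fin D), (-1 : ℤ) ^ S.card • c.sum _ = 0 at h1
    simp only [Finsupp.sum, Finset.smul_sum] at h1
    rw [Finset.sum_comm] at h1
    simp only [smul_comm ((-1 : ℤ) ^ _) (_ : k)] at h1
    simp only [← Finset.smul_sum] at h1
    rw [Finset.sum_congr rfl (fun w hw => by
      rw [alternating_sum_word u z (FreeMonoid.toList w) (hmax w hw)])] at h1
    simp only [Finset.smul_sum] at h1
    rw [Finset.sum_comm] at h1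
    have h2 : ∀ σ : Equiv.Perm (Fin D), ∑ w ∈ c.support, c w •
        (if List.ofFn (u ∘ σ) = FreeMonoid.toList w then
          (-1 : ℤ) ^ D • (List.ofFn fun p => z (σ p)).prod else 0) =
        (-1 : ℤ) ^ D • c (FreeMonoid.ofList (List.ofFn (u ∘ σ))) •
          (List.ofFn fun p => z (σ p)).prod := by
      intro σ
      rw [Finset.sum_eq_single (FreeMonoid.ofList (List.ofFn (u ∘ σ)))]
      · simp [smul_comm]
      · intro w _ hw
        rw [if_neg, smul_zero]
        intro h
        exact hw (by rw [h]; simp)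
      · intro h
        rw [Finsupp.notMem_support_iff.1 h, zero_smul]
    simp only [h2, ← Finset.smul_sum] at h1
    have h3 : ∑ σ : Equiv.Perm (Fin D), c (FreeMonoid.ofList (List.ofFn (u ∘ σ))) •
          (List.ofFn fun p => z (σ p)).prod = 0 := by
      rcases neg_one_pow_eq_or ℤ D with h | h <;> rw [h] at h1 <;> simpa using h1
    simp only [mul_smul, ← Finset.smul_sum]
    rw [h3, smul_zero]

/-- A multilinear identity extends to the span of the image. -/
lemma MultilinearIdentity.extend {k A L B : Type*} [CommRing k] [Ring A] [Algebra k A]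
    [CommRing L] [Ring B] [Algebra L B] {D : ℕ} {α : Equiv.Perm (Fin D) → k}
    (h : MultilinearIdentity k A α) (ρ : A →+* B) (hρ : Submodule.span L (Set.range ρ) = ⊤)
    (z : Fin D → B) :
    ∑ σ : Equiv.Perm (Fin D), ρ (algebraMap k A (α σ)) * (List.ofFn fun i => z (σ i)).prod = 0 := by
  let φ : MultilinearMap L (fun _ : Fin D => B) B :=
    ∑ σ : Equiv.Perm (Fin D), (LinearMap.mulLeft L (ρ (algebraMap k A (α σ)))).compMultilinearMap
      ((MultilinearMap.mkPiAlgebraFin L D B).domDomCongr σ)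
  have key : φ = 0 := by
    refine MultilinearMap.ext_of_span_eq_top (g := fun _ => ρ) (fun _ => hρ) fun j => ?_
    have h1 := congrArg ρ (h j)
    rw [map_sum, map_zero] at h1
    simp only [φ, sum_apply, LinearMap.compMultilinearMap_apply,
      MultilinearMap.domDomCongr_apply, MultilinearMap.mkPiAlgebraFin_apply,
      LinearMap.mulLeft_apply, zero_apply]
    rw [← h1]
    refine Finset.sum_congr rfl fun σ _ => ?_
    rw [Algebra.smul_def, map_mul, map_list_prod, List.map_ofFn]
    rfl
  have := DFunLike.congr_fun key z
  simpa [φ] using this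

/-- In a simple module, there is a maximal commuting set of endomorphisms. -/
lemma exists_maximal_commuting {Δ : Type*} [Ring Δ] :
    ∃ L : Subring Δ, (∀ x ∈ L, ∀ y ∈ L, x * y = y * x) ∧
      ∀ x : Δ, (∀ y ∈ L, x * y = y * x) → x ∈ L := by
  obtain ⟨s, hs⟩ := zorn_subset {s : Set Δ | ∀ x ∈ s, ∀ y ∈ s, x * y = y * x} (by
    intro c hc hch
    refine ⟨⋃₀ c, ?_, fun s hs => Set.subset_sUnion_of_mem hs⟩
    rintro x ⟨s, hs, hx⟩ y ⟨t, ht, hy⟩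
    rcases hch.total hs ht with h | h
    · exact hc ht x (h hx) y hy
    · exact hc hs x hx y (h hy))
  have hmem : ∀ x : Δ, (∀ y ∈ s, x * y = y * x) → x ∈ s := by
    intro x hx
    have : insert x s ⊆ s := hs.2 (y := insert x s) (by
      rintro a (rfl | ha) b (rfl | hb)
      · rfl
      · exact hx b hb
      · exact (hx a ha).symm
      · exact hs.1 a ha b hb) (Set.subset_insert x s)
    exact this (Set.mem_insert x s)
  have hcent : (Subring.centralizer s : Set Δ) = s := by
    ext x
    rw [SetLike.mem_coe, Subring.mem_centralizer_iff]
    exact ⟨fun h => hmem x fun y hy => (h y hy).symm, fun hx y hy => hs.1 y hy x hx⟩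
  have hm : ∀ x, x ∈ Subring.centralizer s ↔ x ∈ s := fun x => by
    rw [← SetLike.mem_coe, hcent]
  refine ⟨Subring.centralizer s, ?_, ?_⟩
  · intro x hx y hy
    exact hs.1 x ((hm x).1 hx) y ((hm y).1 hy)
  · intro x hx
    exact (hm x).2 (hmem x fun y hy => hx y ((hm y).2 hy))

/-- An endomorphism algebra with a proper multilinear identity has bounded degree (staircase). -/
lemma finrank_le_of_multilinear_identity {L V B : Type*} [Field L] [AddCommGroup V] [Module L V]
    [Ring B] [Algebra L B] [Module B V] [IsScalarTower L B V] {D : ℕ}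
    (β : Equiv.Perm (Fin D) → B) (hβ : β 1 = 1)
    (h : ∀ z : Fin D → B, ∑ σ : Equiv.Perm (Fin D), β σ * (List.ofFn fun i => z (σ i)).prod = 0)
    (hd : ∀ (f : V →ₗ[L] V) (s : Finset V), ∃ b : B, ∀ v ∈ s, b • v = f v) :
    Module.rank L V ≤ D := by
  classical
  refine rank_le fun s hs => ?_
  by_contra hlt
  push Not at hlt
  obtain ⟨e⟩ : Nonempty (Fin (D + 1) ↪ s) := by
    apply Function.Embedding.nonempty_of_card_le
    simpa using hlt
  let v : Fin (D + 1) → V := fun i => (e i : V)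
  have hv : LinearIndependent L v := hs.comp _ e.injective
  have hf : ∀ i : Fin D, ∃ b : B, ∀ j, b • v j = if j = i.succ then v i.castSucc else 0 := by
    intro i
    obtain ⟨f, hf⟩ := LinearMap.exists_extend
      ((Module.Basis.span hv).constr L (fun j => if j = i.succ then v i.castSucc else 0))
    obtain ⟨b, hb⟩ := hd f (Finset.univ.image v)
    refine ⟨b, fun j => ?_⟩
    rw [hb _ (Finset.mem_image_of_mem _ (Finset.mem_univ _))]
    have := LinearMap.congr_fun hf (Module.Basis.span hv j)
    rw [Module.Basis.constr_basis] at this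
    rw [← this]
    simp [Module.Basis.span_apply]
  choose b hb using hf
  have prodlem : ∀ (l : ℕ) (hl : l ≤ D) (y : Fin l → Fin D),
      (List.ofFn fun p => b (y p)).prod • v ⟨l, by omega⟩ =
        if (∀ p : Fin l, (y p : ℕ) = p) then v 0 else 0 := by
    intro l
    induction l with
    | zero => intro hl y; simp
    | succ l ih =>
      intro hl y
      rw [List.ofFn_succ', List.concat_eq_append, List.prod_append, List.prod_singleton, mul_smul,
        hb]
      by_cases hy : (y (Fin.last l) : ℕ) = l
      · have h1 : (⟨l + 1, by omega⟩ : Fin (D + 1)) = (y (Fin.last l)).succ := by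
          ext; simp [hy]
        rw [if_pos h1]
        have h2 : (y (Fin.last l)).castSucc = (⟨l, by omega⟩ : Fin (D + 1)) := by
          ext; simp [hy]
        rw [h2, ih (by omega) (fun p => y p.castSucc)]
        congr 1
        rw [Fin.forall_fin_succ']
        simp [hy]
      · rw [if_neg, smul_zero, if_neg]
        · intro h; exact hy (by simpa using h (Fin.last l))
        · intro h; apply hy
          have := congrArg Fin.val h
          simp at this
          omega
  have h0 : v 0 = 0 := by
    have h1 := congrArg (fun x : B => x • v ⟨D, by omega⟩) (h b)
    simp only [Finset.sum_smul, zero_smul, mul_smul] at h1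
    rw [Finset.sum_eq_single 1] at h1
    · rw [hβ, one_smul, prodlem D le_rfl, if_pos] at h1
      · exact h1
      · intro p; simp
    · intro σ _ hσ
      rw [prodlem D le_rfl, if_neg, smul_zero]
      intro h
      apply hσ
      ext p
      simp [h p]
    · simp
  exact hv.ne_zero 0 h0

theorem exists_matrix_rep_of_isSimpleModule {k : Type*} {A V : Type u} [Field k] [Ring A]
    [Algebra k A]
    {D : ℕ} {α : Equiv.Perm (Fin D) → k} (hα : MultilinearIdentity k A α) (h1 : α 1 = 1)
    [AddCommGroup V] [Module A V] [IsSimpleModule A V] :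
    ∃ (L : Type u) (_ : Field L) (n : ℕ) (ψ : A →+* Matrix (Fin n) (Fin n) L),
      0 < n ∧ n ≤ D ∧ Submodule.span L (Set.range ψ) = ⊤ ∧ ∀ a, ψ a = 0 ↔ ∀ v : V, a • v = 0 := by
  classical
  obtain ⟨L, hcomm, hmax⟩ := exists_maximal_commuting (Δ := Module.End A V)
  have hF : IsField L :=
    { exists_pair_ne := ⟨0, 1, fun h => zero_ne_one (congrArg Subtype.val h)⟩
      mul_comm := fun x y => Subtype.ext (hcomm x x.2 y y.2)
      mul_inv_cancel := by
        intro x hx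
        have hx' : (x : Module.End A V) ≠ 0 := fun h => hx (Subtype.ext h)
        refine ⟨⟨(x : Module.End A V)⁻¹, hmax _ fun y hy => ?_⟩, Subtype.ext (mul_inv_cancel₀ hx')⟩
        have : Commute (x : Module.End A V) y := hcomm x x.2 y hy
        exact this.inv_left₀ }
  let _ : Field L := hF.toField
  have : Nontrivial V := IsSimpleModule.nontrivial A V
  have : SMulCommClass A L V := ⟨fun a l v => by
    change a • (l : Module.End A V) v = (l : Module.End A V) (a • v)
    rw [map_smul]⟩
  have : SMulCommClass L A V := SMulCommClass.symm _ _ _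
  let ρ : A →+* Module.End L V := Module.toModuleEnd L V
  let B : Subalgebra L (Module.End L V) := Algebra.adjoin L (Set.range ρ)
  let ρ' : A →+* B := ρ.codRestrict B (fun a => Algebra.subset_adjoin ⟨a, rfl⟩)
  have hBspan : ∀ b ∈ B, b ∈ Submodule.span L (Set.range ρ) := by
    intro b hb
    have hcl : Submonoid.closure (Set.range ρ) ≤ MonoidHom.mrange ρ :=
      Submonoid.closure_le.2 (by rintro _ ⟨a, rfl⟩; exact ⟨a, rfl⟩)
    rw [← Algebra.adjoin_eq_span_of_subset]
    · exact hb
    · intro x hx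
      obtain ⟨a, rfl⟩ := hcl hx
      exact Submodule.subset_span ⟨a, rfl⟩
  have hρ' : Submodule.span L (Set.range ρ') = ⊤ := by
    apply Submodule.map_injective_of_injective (f := B.val.toLinearMap) Subtype.val_injective
    rw [Submodule.map_span, ← Set.range_comp]
    ext x
    constructor
    · rintro hx
      refine ⟨⟨x, ?_⟩, trivial, rfl⟩
      exact (Submodule.span_le (p := Subalgebra.toSubmodule B)).2 Algebra.subset_adjoin hx
    · rintro ⟨b, -, rfl⟩
      exact hBspan b b.2
  have : IsSimpleModule B V := by
    refine isSimpleModule_iff B V |>.2 { toNontrivial := ?_, eq_bot_or_eq_top := ?_ }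
    · infer_instance
    · intro N
      let N' : Submodule A V :=
        { N.toAddSubmonoid with smul_mem' := fun a v hv => N.smul_mem (ρ' a) hv }
      rcases eq_bot_or_eq_top N' with h | h
      · left
        ext x
        exact Submodule.ext_iff.1 h x
      · right
        ext x
        exact Submodule.ext_iff.1 h x
  have hd : ∀ (f : V →ₗ[L] V) (s : Finset V), ∃ b : B, ∀ v ∈ s, b • v = f v := by
    intro f s
    have hlin : ∀ g : Module.End B V, ∃ l : L, ∀ v, g v = l • v := by
      intro g
      let g' : Module.End A V :=
        { g with map_smul' := fun a v => g.map_smul (ρ' a) v }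
      refine ⟨⟨g', hmax g' fun y hy => ?_⟩, fun v => rfl⟩
      ext v
      exact g.map_smul (algebraMap L B ⟨y, hy⟩) v
    let f' : Module.End (Module.End B V) V :=
      { f with
        map_smul' := fun g v => by
          obtain ⟨l, hl⟩ := hlin g
          change f (g v) = g (f v)
          rw [hl, hl, map_smul] }
    obtain ⟨r, hr⟩ := jacobson_density (R := B) f' s
    exact ⟨r, fun m hm => (hr m hm).symm⟩
  have hrank := finrank_le_of_multilinear_identity (fun σ => ρ' (algebraMap k A (α σ)))
      (by simp [h1])
    (hα.extend ρ' hρ') hd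
  have : Module.Finite L V := by
    rw [← Module.rank_lt_aleph0_iff]
    exact lt_of_le_of_lt hrank (Cardinal.natCast_lt_aleph0)
  let n := Module.finrank L V
  let e := LinearMap.toMatrixAlgEquiv (Module.finBasis L V)
  refine ⟨L, inferInstance, n, (e : Module.End L V →+* _).comp ρ, Module.finrank_pos, ?_, ?_, ?_⟩
  · have := Module.finrank_eq_rank L V
    rw [← this] at hrank
    exact_mod_cast hrank
  · have hρs : Submodule.span L (Set.range ρ) = ⊤ := by
      rw [eq_top_iff]
      intro f _
      obtain ⟨b, hb⟩ := hd f (Finset.univ.image (Module.finBasis L V))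
      have : (b : Module.End L V) = f := (Module.finBasis L V).ext fun i =>
        hb _ (Finset.mem_image_of_mem _ (Finset.mem_univ _))
      rw [← this]
      exact hBspan b b.2
    have := congrArg (Submodule.map e.toLinearMap) hρs
    rw [Submodule.map_span, ← Set.range_comp, Submodule.map_top] at this
    exact this.trans (LinearMap.range_eq_top.2 e.surjective)
  · intro a
    simp [ρ, LinearMap.ext_iff]

/-- The elementwise form of primeness for rings. -/
def IsPrimeRing (R : Type*) [Ring R] : Prop :=
  ∀ a b : R, (∀ x : R, a * x * b = 0) → a = 0 ∨ b = 0

lemma IsPrimeRing.exists_mul_ne_zero {R : Type*} [Ring R] (h : IsPrimeRing R) {a b : R}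
    (ha : a ≠ 0) (hb : b ≠ 0) : ∃ x, a * x * b ≠ 0 := by
  by_contra! hx
  exact (h a b hx).elim ha hb

/-- A prime left noetherian ring has no nonzero nil ideals. -/
lemma IsPrimeRing.eq_zero_of_nil {R : Type*} [Ring R] [IsNoetherianRing R] (h : IsPrimeRing R)
    (P : R → Prop) (hP : ∀ a b c, P b → P (a * b * c)) (hnil : ∀ a, P a → IsNilpotent a)
    (a : R) (ha : P a) : a = 0 := by
  by_contra ha0
  let lann : R → Submodule R R := fun b => LinearMap.ker (LinearMap.toSpanSingleton R R b)
  have hl : ∀ b x, x ∈ lann b ↔ x * b = 0 := fun b x => by simp [lann]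
  obtain ⟨M, ⟨b, ⟨hb, hb0⟩, rfl⟩, hM⟩ := set_has_maximal_iff_noetherian.2 ‹IsNoetherianRing R›
    (lann '' {b | P b ∧ b ≠ 0}) ⟨_, a, ⟨ha, ha0⟩, rfl⟩
  obtain ⟨x, hx⟩ := h.exists_mul_ne_zero hb0 hb0
  have hex : ∃ m, (b * x) ^ m * b = 0 := by
    obtain ⟨m, hm⟩ := hnil (b * x) (by simpa using hP 1 b x hb)
    exact ⟨m, by rw [hm, zero_mul]⟩
  classical
  have hspec := Nat.find_spec hex
  have hmin := fun m => Nat.find_min hex (m := m)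
  rcases hf : Nat.find hex with _ | m
  · rw [hf] at hspec
    simp at hspec
    exact hb0 hspec
  · rw [hf] at hspec
    have hc0 := hmin m (by omega)
    have hform : ∀ m, ∃ d, (b * x) ^ m * b = b * d := fun m => by
      rcases m with _ | m
      · exact ⟨1, by simp⟩
      · exact ⟨x * (b * x) ^ m * b, by rw [pow_succ']; simp [mul_assoc]⟩
    obtain ⟨d, hd⟩ := hform m
    have hPc : P ((b * x) ^ m * b) := by simpa using hP ((b * x) ^ m) b 1 hb
    have hle : lann b ≤ lann ((b * x) ^ m * b) := by
      intro y hy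
      rw [hl] at hy ⊢
      rw [hd, ← mul_assoc, hy, zero_mul]
    have heq : lann b = lann ((b * x) ^ m * b) :=
      hle.eq_of_not_lt (hM _ ⟨_, ⟨hPc, hc0⟩, rfl⟩)
    apply hx
    have : b * x ∈ lann ((b * x) ^ m * b) := by
      rw [hl, ← mul_assoc, ← pow_succ', hspec]
    rw [← heq, hl] at this
    exact this

lemma IsPrimeRing.exists_common {R ι : Type*} [Ring R] [Nontrivial R] (h : IsPrimeRing R)
    (P : ι → R → Prop) (hP : ∀ i a b c, P i b → P i (a * b * c)) (s : Finset ι)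
    (hs : ∀ i ∈ s, ∃ a, P i a ∧ a ≠ 0) : ∃ b, b ≠ 0 ∧ ∀ i ∈ s, P i b := by
  classical
  induction s using Finset.induction_on with
  | empty => exact ⟨1, one_ne_zero, by simp⟩
  | insert i s hi ih =>
    obtain ⟨b, hb, hb'⟩ := ih fun j hj => hs j (Finset.mem_insert_of_mem hj)
    obtain ⟨a, ha, ha0⟩ := hs i (Finset.mem_insert_self i s)
    obtain ⟨x, hx⟩ := h.exists_mul_ne_zero hb ha0
    refine ⟨b * x * a, hx, ?_⟩
    intro j hj
    rcases Finset.mem_insert.1 hj with rfl | hj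
    · simpa using hP j (b * x) a 1 ha
    · simpa [mul_assoc] using hP j 1 b (x * a) (hb' j hj)

/-- Prime rings embedding in matrices over a commutative ring embed in matrices over a field. -/
lemma IsPrimeRing.exists_matrix_field {R A : Type u} [Ring R] [Nontrivial R] [CommRing A]
    (h : IsPrimeRing R) {n : ℕ} (Ψ : R →+* Matrix (Fin n) (Fin n) A) (hΨ : Function.Injective Ψ) :
    ∃ (F : Type u) (_ : Field F) (Φ : R →+* Matrix (Fin n) (Fin n) F), Function.Injective Φ := by
  let S : Set (Ideal A) := {p | ∀ x, (∀ i j, Ψ x i j ∈ p) → x = 0}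
  obtain ⟨p, hpS⟩ : ∃ p, Maximal (· ∈ S) p := by
    obtain ⟨p, -, hp⟩ := zorn_le_nonempty₀ S (by
      intro c hc hch y hy
      refine ⟨sSup c, ?_, fun z hz => le_sSup hz⟩
      intro x hx
      have : ∀ T : Finset (Fin n × Fin n), ∃ q ∈ c, ∀ t ∈ T, Ψ x t.1 t.2 ∈ q := by
        intro T
        classical
        induction T using Finset.induction_on with
        | empty => exact ⟨y, hy, by simp⟩
        | insert t T ht ih =>
          obtain ⟨q, hq, hqT⟩ := ih
          obtain ⟨q', hq', hqt⟩ := (Submodule.mem_sSup_of_directed ⟨y, hy⟩ hch.directedOn).1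
            (hx t.1 t.2)
          rcases hch.total hq hq' with hle | hle
          · refine ⟨q', hq', fun s hs => ?_⟩
            rcases Finset.mem_insert.1 hs with rfl | hs
            · exact hqt
            · exact hle (hqT s hs)
          · refine ⟨q, hq, fun s hs => ?_⟩
            rcases Finset.mem_insert.1 hs with rfl | hs
            · exact hle hqt
            · exact hqT s hs
      obtain ⟨q, hq, hqx⟩ := this Finset.univ
      exact hc hq x fun i j => hqx (i, j) (Finset.mem_univ _)) ⊥ (by
        intro x hx
        apply hΨ
        rw [map_zero]
        ext i j
        exact hx i j)
    exact ⟨p, hp⟩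
  have hpp : p.IsPrime := by
    refine ⟨?_, ?_⟩
    · intro hp
      exact one_ne_zero (hpS.1 1 (by simp [hp]))
    · intro a b hab
      by_contra! hn
      have key : ∀ a, a ∉ p → ∃ x, x ≠ 0 ∧ ∀ i j, Ψ x i j ∈ p ⊔ Ideal.span {a} := by
        intro a ha
        by_contra! hx
        have hS : p ⊔ Ideal.span {a} ∈ S := by
          intro x hx'
          by_contra hx0
          obtain ⟨i, j, hij⟩ := hx x hx0
          exact hij (hx' i j)
        have := hpS.2 hS le_sup_left
        exact ha (this ((le_sup_right : Ideal.span {a} ≤ _) (Ideal.mem_span_singleton_self a)))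
      obtain ⟨x, hx0, hx⟩ := key a hn.1
      obtain ⟨y, hy0, hy⟩ := key b hn.2
      obtain ⟨z, hz⟩ := h.exists_mul_ne_zero hx0 hy0
      apply hz
      apply hpS.1
      have hmul : (p ⊔ Ideal.span {a}) * (p ⊔ Ideal.span {b}) ≤ p := by
        rw [Ideal.mul_le]
        intro r hr s hs
        rw [Submodule.mem_sup] at hr hs
        obtain ⟨r1, hr1, r2, hr2, rfl⟩ := hr
        obtain ⟨s1, hs1, s2, hs2, rfl⟩ := hs
        obtain ⟨r2, rfl⟩ := Ideal.mem_span_singleton'.1 hr2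
        obtain ⟨s2, rfl⟩ := Ideal.mem_span_singleton'.1 hs2
        have : (r1 + r2 * a) * (s1 + s2 * b) =
            r1 * (s1 + s2 * b) + (r2 * a * s1) + r2 * s2 * (a * b) := by
          ring
        rw [this]
        exact p.add_mem (p.add_mem (p.mul_mem_right _ hr1) (p.mul_mem_left _ hs1))
          (p.mul_mem_left _ hab)
      intro i j
      rw [map_mul, map_mul, Matrix.mul_apply]
      refine p.sum_mem fun l _ => hmul (Ideal.mul_mem_mul ?_ (hy l j))
      rw [Matrix.mul_apply]
      exact Ideal.sum_mem _ fun l _ => Ideal.mul_mem_right _ _ (hx i l)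
  refine ⟨FractionRing (A ⧸ p), inferInstance,
    (((algebraMap (A ⧸ p) (FractionRing (A ⧸ p))).comp (Ideal.Quotient.mk p)).mapMatrix).comp Ψ, ?_⟩
  rw [injective_iff_map_eq_zero]
  intro x hx
  apply hpS.1
  intro i j
  have := congrFun (congrFun hx i) j
  simp only [RingHom.coe_comp, Function.comp_apply, RingHom.mapMatrix_apply, Matrix.map_apply,
    Matrix.zero_apply] at this
  rw [map_eq_zero_iff _ (IsFractionRing.injective _ _)] at this
  exact Ideal.Quotient.eq_zero_iff_mem.1 this

section

open Polynomial

lemma MultilinearIdentity.polynomial {k : Type*} {A : Type*} [Field k] [Ring A] [Algebra k A]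
    {D : ℕ}
    {α : Equiv.Perm (Fin D) → k} (h : MultilinearIdentity k A α) :
    MultilinearIdentity k A[X] α := by
  let _ : Algebra k[X] A[X] := RingHom.toAlgebra' (mapRingHom (algebraMap k A)) (by
    intro c x
    induction c using Polynomial.induction_on' with
    | add p q hp hq => rw [map_add, add_mul, mul_add, hp, hq]
    | monomial n a =>
      ext m
      simp only [coe_mapRingHom, map_monomial]
      rw [← C_mul_X_pow_eq_monomial, mul_assoc, X_pow_mul, ← mul_assoc, ← mul_assoc]
      congr 2
      ext i
      simp [Algebra.commutes])
  intro z
  have := h.extend (L := k[X]) (C : A →+* A[X]) (by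
    rw [eq_top_iff]
    intro p _
    induction p using Polynomial.induction_on' with
    | add p q hp hq => exact Submodule.add_mem _ (hp trivial) (hq trivial)
    | monomial n a =>
      have : (monomial n a : A[X]) = (X ^ n : k[X]) • (C a) := by
        rw [Algebra.smul_def]
        change _ = (mapRingHom (algebraMap k A)) (X ^ n) * C a
        simp [X_pow_mul, C_mul_X_pow_eq_monomial]
      rw [this]
      exact Submodule.smul_mem _ _ (Submodule.subset_span ⟨a, rfl⟩)) z
  rw [← this]
  refine Finset.sum_congr rfl fun σ _ => ?_
  rw [Algebra.smul_def]
  rfl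

/-- Non-nilpotent elements of PI algebras are detected by matrix representations. -/
theorem exists_matrix_rep_of_not_isNilpotent {k : Type*} {A : Type u} [Field k] [Ring A]
    [Algebra k A]
    {D : ℕ} {α : Equiv.Perm (Fin D) → k} (hα : MultilinearIdentity k A α) (h1 : α 1 = 1)
    (a : A) (ha : ¬ IsNilpotent a) :
    ∃ (L : Type u) (_ : Field L) (n : ℕ) (ψ : A →+* Matrix (Fin n) (Fin n) L),
      0 < n ∧ n ≤ D ∧ Submodule.span L (Set.range ψ) = ⊤ ∧ ψ a ≠ 0 := by
  have hne : Ideal.span {1 - C a * X} ≠ (⊤ : Ideal A[X]) := by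
    intro htop
    obtain ⟨b, hb⟩ := Ideal.mem_span_singleton'.1 ((Ideal.eq_top_iff_one _).1 htop)
    apply ha
    have hb0 : b.coeff 0 = 1 := by
      have := congrArg (fun p => coeff p 0) hb
      simpa [mul_sub, ← mul_assoc] using this
    have hbs : ∀ i, b.coeff (i + 1) = b.coeff i * a := by
      intro i
      have := congrArg (fun p => coeff p (i + 1)) hb
      simp only [mul_sub, ← mul_assoc, coeff_sub, coeff_mul_X, coeff_mul_C, mul_one,
        coeff_one] at this
      simpa [sub_eq_zero] using this
    have hbi : ∀ i, b.coeff i = a ^ i := by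
      intro i
      induction i with
      | zero => simpa using hb0
      | succ i ih => rw [hbs, ih, pow_succ]
    exact ⟨b.natDegree + 1, by rw [← hbi]; exact coeff_eq_zero_of_natDegree_lt (Nat.lt_succ_self _)⟩
  obtain ⟨m, hm, hle⟩ := Ideal.exists_le_maximal _ hne
  have hsimple : IsSimpleModule A[X] (A[X] ⧸ m) := isSimpleModule_iff_isCoatom.2 hm.out
  obtain ⟨L, hL, n, ψ, hn, hnD, hspan, hker⟩ :=
    exists_matrix_rep_of_isSimpleModule hα.polynomial h1 (V := A[X] ⧸ m)
  refine ⟨L, hL, n, ψ.comp C, hn, hnD, ?_, ?_⟩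
  · have hcomm : ∀ y, Commute (ψ X) y := by
      intro y
      have hy : y ∈ Submodule.span L (Set.range ψ) := hspan ▸ trivial
      induction hy using Submodule.span_induction with
      | mem y hy =>
        obtain ⟨p, rfl⟩ := hy
        rw [Commute, SemiconjBy, ← map_mul, ← map_mul, X_mul]
      | zero => exact Commute.zero_right _
      | add x y _ _ hx hy => exact hx.add_right hy
      | smul l y _ hy => exact hy.smul_right l
    obtain ⟨c, hc⟩ := Matrix.mem_range_scalar_of_commute_transvectionStruct (M := ψ X)
        (fun t => (hcomm _).symm)
    rw [eq_top_iff, ← hspan, Submodule.span_le]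
    rintro _ ⟨p, rfl⟩
    induction p using Polynomial.induction_on' with
    | add p q hp hq => rw [map_add]; exact Submodule.add_mem _ hp hq
    | monomial i b =>
      rw [← C_mul_X_pow_eq_monomial, map_mul, map_pow, ← hc]
      have : ψ (C b) * (Matrix.scalar (Fin n) c) ^ i = c ^ i • ψ (C b) := by
        rw [← map_pow, ← Matrix.scalar_commute, Matrix.scalar_apply, ← Matrix.smul_eq_diagonal_mul]
        exact fun r => Commute.all _ _
      rw [this]
      exact Submodule.smul_mem _ _ (Submodule.subset_span ⟨b, rfl⟩)
  · intro h0
    have h2 := (hker (C a)).1 h0 (Submodule.Quotient.mk X)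
    rw [← Submodule.Quotient.mk_smul, Submodule.Quotient.mk_eq_zero] at h2
    have h3 : (1 - C a * X : A[X]) ∈ m := hle (Ideal.mem_span_singleton_self _)
    exact hm.ne_top ((Ideal.eq_top_iff_one _).2 (by simpa using m.add_mem h3 h2))

theorem IsPrimeRing.exists_matrix_embedding {k : Type*} {A : Type u} [Field k] [Ring A]
    [Nontrivial A]
    [IsNoetherianRing A] [Algebra k A]
    {D : ℕ} {α : Equiv.Perm (Fin D) → k} (hα : MultilinearIdentity k A α) (h1 : α 1 = 1)
    (hA : IsPrimeRing A) :
    ∃ (n : ℕ) (F : Type u) (_ : Field F) (Φ : A →+* Matrix (Fin n) (Fin n) F)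
      (L : Type u) (_ : Field L) (ψ : A →+* Matrix (Fin n) (Fin n) L),
      0 < n ∧ Function.Injective Φ ∧ Submodule.span L (Set.range ψ) = ⊤ := by
  have hrep := fun a : {a : A // ¬ IsNilpotent a} =>
    exists_matrix_rep_of_not_isNilpotent hα h1 a.1 a.2
  choose L hL n ψ hn hnD hspan hne using hrep
  let P : ℕ → A → Prop := fun m x => ∀ a, n a = m → ψ a x = 0
  obtain ⟨m, hm⟩ : ∃ m, ∀ x, P m x → x = 0 := by
    by_contra! hcon
    obtain ⟨b, hb, hb'⟩ := hA.exists_common P (by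
      intro m a b c hb a' ha'
      rw [map_mul, map_mul, hb a' ha', mul_zero, zero_mul]) (Finset.range (D + 1))
      (fun m _ => hcon m)
    apply hb
    refine hA.eq_zero_of_nil (fun x => ∀ a, ψ a x = 0) ?_ ?_ b ?_
    · intro a b c hb a'
      rw [map_mul, map_mul, hb, mul_zero, zero_mul]
    · intro a ha
      by_contra hnil
      exact hne ⟨a, hnil⟩ (ha _)
    · intro a
      exact hb' (n a) (Finset.mem_range.2 (Nat.lt_succ_of_le (hnD a))) a rfl
  have hex : ∃ a, n a = m := by
    by_contra! h
    exact one_ne_zero (hm 1 fun a ha => (h a ha).elim)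
  have hrep' : ∀ a : {a // n a = m}, ∃ ψ' : A →+* Matrix (Fin m) (Fin m) (L a),
      Submodule.span (L a) (Set.range ψ') = ⊤ ∧ ∀ x, ψ' x = 0 → ψ a x = 0 := by
    rintro ⟨a, rfl⟩
    exact ⟨ψ a, hspan a, fun x h => h⟩
  choose ψ' hspan' hψ' using hrep'
  obtain ⟨a0, ha0⟩ := hex
  let Ψ : A →+* Matrix (Fin m) (Fin m) (∀ a : {a // n a = m}, L a) :=
    { toFun := fun x => Matrix.of fun i j a => ψ' a x i j
      map_one' := by
        ext i j a
        by_cases h : i = j <;> simp [h, Matrix.one_apply]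
      map_mul' := by
        intro x y
        ext i j a
        simp [Matrix.mul_apply]
      map_zero' := by ext; simp
      map_add' := by intros; ext; simp }
  have hΨ : Function.Injective Ψ := by
    rw [injective_iff_map_eq_zero]
    intro x hx
    apply hm
    intro a ha
    apply hψ' ⟨a, ha⟩
    ext i j
    exact congrFun (congrFun (congrFun hx i) j) ⟨a, ha⟩
  obtain ⟨F, hF, Φ, hΦ⟩ := hA.exists_matrix_field Ψ hΨ
  exact ⟨m, F, hF, Φ, L a0, hL a0, ψ' ⟨a0, ha0⟩, ha0 ▸ hn a0, hΦ, hspan' ⟨a0, ha0⟩⟩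

end

/-- A Capelli type polynomial: it is alternating in the variables `x`. -/
def capelli {R : Type*} [Ring R] {m : ℕ} (u v x : Fin m → R) : R :=
  ∑ σ : Equiv.Perm (Fin m), (Equiv.Perm.sign σ) •
    (List.ofFn fun k => u k * x (σ k) * v k).prod

lemma map_capelli {R S : Type*} [Ring R] [Ring S] (f : R →+* S) {m : ℕ} (u v x : Fin m → R) :
    f (capelli u v x) = capelli (f ∘ u) (f ∘ v) (f ∘ x) := by
  simp only [capelli, map_sum, Units.smul_def, map_zsmul, map_list_prod, List.map_ofFn]
  simp [Function.comp_def]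

/-- The Capelli polynomial as an alternating map. -/
def capelliAlt (F : Type*) {E : Type*} [CommRing F] [Ring E] [Algebra F E] {m : ℕ}
    (u v : Fin m → E) :
    E [⋀^Fin m]→ₗ[F] E :=
  MultilinearMap.alternatization ((MultilinearMap.mkPiAlgebraFin F m E).compLinearMap
    (fun k => (LinearMap.mulRight F (v k)).comp (LinearMap.mulLeft F (u k))))

lemma capelliAlt_apply (F : Type*) {E : Type*} [CommRing F] [Ring E] [Algebra F E] {m : ℕ}
    (u v x : Fin m → E) : capelliAlt F u v x = capelli u v x := by
  simp [capelliAlt, capelli, MultilinearMap.alternatization_apply]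

lemma capelli_eq_zero_of_span {R L E : Type*} [Ring R] [Field L] [Ring E] [Algebra L E]
    (ψ : R →+* E) (hψ : Submodule.span L (Set.range ψ) = ⊤) {m : ℕ}
    (h : ∀ u v x : Fin m → R, ψ (capelli u v x) = 0) (u v x : Fin m → E) : capelli u v x = 0 := by
  let fx : (Fin m → E) → (Fin m → E) → MultilinearMap L (fun _ : Fin m => E) E := fun u v =>
    (capelliAlt L u v).toMultilinearMap
  let fu : (Fin m → E) → (Fin m → E) → MultilinearMap L (fun _ : Fin m => E) E := fun v x =>
    ∑ σ : Equiv.Perm (Fin m), (Equiv.Perm.sign σ : ℤ) •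
      ((MultilinearMap.mkPiAlgebraFin L m E).compLinearMap
        (fun k => LinearMap.mulRight L (x (σ k) * v k)))
  let fv : (Fin m → E) → (Fin m → E) → MultilinearMap L (fun _ : Fin m => E) E := fun u x =>
    ∑ σ : Equiv.Perm (Fin m), (Equiv.Perm.sign σ : ℤ) •
      ((MultilinearMap.mkPiAlgebraFin L m E).compLinearMap
        (fun k => LinearMap.mulLeft L (u k * x (σ k))))
  have hfx : ∀ u v x, fx u v x = capelli u v x := fun u v x => capelliAlt_apply L u v x
  have hfu : ∀ u v x, fu v x u = capelli u v x := fun u v x => by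
    simp [fu, capelli, Units.smul_def]
  have hfv : ∀ u v x, fv u x v = capelli u v x := fun u v x => by
    have (k : Fin m) (σ : Equiv.Perm (Fin m)) : u k * x (σ k) * v k = u k * (x (σ k) * v k) :=
        mul_assoc _ _ _
    simp only [capelli, this]
    simp [fv, Units.smul_def]
  have h1 : ∀ (u v : Fin m → R) (x : Fin m → E), capelli (ψ ∘ u) (ψ ∘ v) x = 0 := by
    intro u v x
    have : fx (ψ ∘ u) (ψ ∘ v) = 0 := by
      refine MultilinearMap.ext_of_span_eq_top (g := fun _ => ψ) (fun _ => hψ) fun j => ?_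
      have := h u v j
      rw [map_capelli] at this
      exact (hfx _ _ _).trans this
    rw [← hfx, this]; rfl
  have h2 : ∀ (v : Fin m → R) (u x : Fin m → E), capelli u (ψ ∘ v) x = 0 := by
    intro v u x
    have : fu (ψ ∘ v) x = 0 := by
      refine MultilinearMap.ext_of_span_eq_top (g := fun _ => ψ) (fun _ => hψ) fun j => ?_
      exact (hfu _ _ _).trans (h1 j v x)
    rw [← hfu, this]; rfl
  have : fv u x = 0 := by
    refine MultilinearMap.ext_of_span_eq_top (g := fun _ => ψ) (fun _ => hψ) fun j => ?_
    rw [hfv]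
    exact h2 j u x
  rw [← hfv, this]; rfl

lemma exists_capelli_ne_zero {L : Type*} [Field L] {n : ℕ} (hn : 0 < n) :
    ∃ u v x : Fin (n * n) → Matrix (Fin n) (Fin n) L, capelli u v x ≠ 0 := by
  let i0 : Fin n := ⟨0, hn⟩
  let e : Fin (n * n) ≃ Fin n × Fin n := finProdFinEquiv.symm
  refine ⟨fun k => Matrix.single i0 (e k).1 1, fun k => Matrix.single (e k).2 i0 1,
    fun k => Matrix.single (e k).1 (e k).2 1, ?_⟩
  have hterm : ∀ (k j : Fin (n * n)), (Matrix.single i0 (e k).1 (1 : L) *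
      Matrix.single (e j).1 (e j).2 1 *
      Matrix.single (e k).2 i0 1) = if j = k then Matrix.single i0 i0 1 else 0 := by
    intro k j
    split_ifs with h
    · subst h; simp
    · by_cases h1 : (e k).1 = (e j).1
      · by_cases h2 : (e j).2 = (e k).2
        · exact absurd (e.injective (Prod.ext h1.symm h2)) h
        · rw [h1, Matrix.single_mul_single_same, Matrix.single_mul_single_of_ne _ _ _ _ h2]
      · rw [Matrix.single_mul_single_of_ne _ _ _ _ h1, zero_mul]
  have hsum : capelli (fun k => Matrix.single i0 (e k).1 (1 : L))
      (fun k => Matrix.single (e k).2 i0 1)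
      (fun k => Matrix.single (e k).1 (e k).2 1) = Matrix.single i0 i0 1 := by
    unfold capelli
    simp only [hterm]
    rw [Finset.sum_eq_single 1]
    · simp only [Equiv.Perm.coe_one, id, if_true, Equiv.Perm.sign_one, one_smul, List.ofFn_const,
        List.prod_replicate]
      obtain ⟨r, hr⟩ := Nat.exists_eq_succ_of_ne_zero (Nat.mul_pos hn hn).ne'
      rw [hr]
      have : IsIdempotentElem (Matrix.single i0 i0 (1 : L)) := by simp [IsIdempotentElem]
      exact this.pow_succ_eq r
    · intro σ _ hσ
      obtain ⟨k, hk⟩ : ∃ k, σ k ≠ k := by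
        by_contra! h
        exact hσ (Equiv.ext h)
      rw [List.prod_eq_zero, smul_zero]
      rw [List.mem_ofFn]
      exact ⟨k, if_neg hk⟩
    · simp
  rw [hsum]
  intro h
  have := congrFun (congrFun h i0) i0
  simp at this

open Polynomial in
lemma Matrix.charpoly_coeff_mul_det {F : Type*} [CommRing F] {m : ℕ}
    (A M : Matrix (Fin m) (Fin m) F)
    (i : ℕ) : A.charpoly.coeff i * M.det =
      ∑ S : Finset (Fin m), if S.card = i then
        (Matrix.of fun r c => if c ∈ S then M r c else - (A * M) r c).det else 0 := by
  have h1 : A.charpoly * C M.det = (A.charmatrix * M.map C).det := by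
    rw [Matrix.det_mul, Matrix.charpoly]
    congr 1
    exact RingHom.map_det C M
  have h2 : Matrix.transpose (A.charmatrix * M.map C) = (fun c => (X : F[X]) • fun r => C (M r c)) +
      (fun c r => - C ((A * M) r c)) := by
    funext c r
    simp only [Matrix.charmatrix, Matrix.transpose_apply, Matrix.sub_mul, Matrix.scalar_apply,
      Matrix.sub_apply, Matrix.mul_apply, Matrix.map_apply, Pi.add_apply,
      Pi.smul_apply, RingHom.mapMatrix_apply, map_sum, map_mul, smul_eq_mul]
    rw [sub_eq_add_neg]
    congr 1
    simp [Matrix.diagonal_apply]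
  have h3 : (A.charmatrix * M.map C).det = ∑ S : Finset (Fin m), X ^ S.card * C
      (Matrix.of fun r c => if c ∈ S then M r c else - (A * M) r c).det := by
    rw [← Matrix.det_transpose, h2]
    have := (Matrix.detRowAlternating (R := F[X]) (n := Fin m)).toMultilinearMap.map_add_univ
      (fun c => (X : F[X]) • fun r => C (M r c)) (fun c r => - C ((A * M) r c))
    change Matrix.detRowAlternating _ = _
    refine this.trans (Finset.sum_congr rfl fun S _ => ?_)
    have h4 :=
      (Matrix.detRowAlternating (R := F[X]) (n := Fin m)).toMultilinearMap.map_piecewise_smul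
      (fun _ => (X : F[X])) (S.piecewise (fun c r => C (M r c)) (fun c r => - C ((A * M) r c))) S
    have h5 : S.piecewise (fun c => (X : F[X]) • fun r => C (M r c))
        (fun c r => - C ((A * M) r c)) =
      S.piecewise (fun c =>
          (X : F[X]) • (S.piecewise (fun c r => C (M r c)) (fun c r => - C ((A * M) r c))) c)
        (S.piecewise (fun c r => C (M r c)) (fun c r => - C ((A * M) r c))) := by
      funext c
      by_cases hc : c ∈ S <;> simp [hc]
    rw [h5]
    refine h4.trans ?_
    rw [Finset.prod_const, smul_eq_mul]
    congr 1
    rw [RingHom.map_det]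
    change Matrix.det _ = _
    rw [← Matrix.det_transpose]
    congr 1
    funext r c
    by_cases hc : r ∈ S <;> simp [hc]
  have h6 := congrArg (fun p => p.coeff i) (h1.trans h3)
  simp only [coeff_mul_C, finsetSum_coeff, coeff_X_pow] at h6
  rw [h6]
  refine Finset.sum_congr rfl fun S _ => ?_
  by_cases h : i = S.card <;> simp [h, eq_comm (a := S.card)]

/-- The coefficients of the characteristic polynomial of `φ` act on alternating maps of top
degree. -/
lemma AlternatingMap.charpoly_coeff_smul {F V W : Type*} [Field F] [AddCommGroup V] [Module F V]
    [Module.Finite F V] [AddCommGroup W] [Module F W] {m : ℕ} (b : Module.Basis (Fin m) F V)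
        (f : V [⋀^Fin m]→ₗ[F] W)
    (φ : V →ₗ[F] V) (x : Fin m → V) (i : ℕ) :
    φ.charpoly.coeff i • f x = ∑ S : Finset (Fin m), if S.card = i then
      f (fun j => if j ∈ S then x j else - φ (x j)) else 0 := by
  have hf : ∀ y, f y = b.det y • f b := by
    have : f = ((LinearMap.toSpanSingleton F W (f b)).compAlternatingMap b.det) := by
      refine Module.Basis.ext_alternating b fun v hv => ?_
      obtain ⟨σ, hσ⟩ : ∃ σ : Equiv.Perm (Fin m), v = σ :=
        ⟨Equiv.ofBijective v (Finite.injective_iff_bijective.1 hv), rfl⟩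
      subst hσ
      have h1 := f.map_perm b σ
      have h2 := b.det.map_perm b σ
      simp only [Function.comp_def] at h1 h2
      simp [h1, h2, b.det_self, Units.smul_def, Int.cast_smul_eq_zsmul]
    intro y
    exact DFunLike.congr_fun this y
  rw [hf x, smul_smul, b.det_apply, ← LinearMap.charpoly_toMatrix φ b,
      Matrix.charpoly_coeff_mul_det,
    Finset.sum_smul]
  refine Finset.sum_congr rfl fun S _ => ?_
  split_ifs with h
  · refine Eq.trans ?_ (hf _).symm
    rw [b.det_apply]
    refine congrArg (fun M : Matrix (Fin m) (Fin m) F => M.det • f b) ?_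
    ext r c
    have h3 : (LinearMap.toMatrix b b φ * b.toMatrix x) r c = b.repr (φ (x c)) r := by
      have := congrFun (LinearMap.toMatrix_mulVec_repr b b φ (x c)) r
      rw [← this]
      rfl
    rw [Matrix.of_apply, h3, Module.Basis.toMatrix_apply, Module.Basis.toMatrix_apply]
    split_ifs <;> simp
  · simp

/-! ### Shirshov's height argument -/

/-- The numerical value of a word, in base `s + 1` with digits `1, …, s`; it orders words first by
length and then lexicographically. -/
def wordVal {s : ℕ} : List (Fin s) → ℕ
  | [] => 0
  | d :: t => (d + 1) * (s + 1) ^ t.length + wordVal t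

lemma wordVal_lt {s : ℕ} (l : List (Fin s)) : wordVal l < (s + 1) ^ l.length := by
  induction l with
  | nil => simp [wordVal]
  | cons d t ih =>
    simp only [wordVal, List.length_cons, pow_succ]
    have : (d : ℕ) + 1 ≤ s := d.2
    nlinarith [Nat.mul_le_mul_right ((s + 1) ^ t.length) this]

lemma le_wordVal {s : ℕ} (l : List (Fin s)) (h : l ≠ []) : (s + 1) ^ (l.length - 1) ≤
    wordVal l := by
  cases l with
  | nil => exact absurd rfl h
  | cons d t =>
    simp only [wordVal, List.length_cons, Nat.add_sub_cancel]
    nlinarith [Nat.zero_le ((d : ℕ) * (s + 1) ^ t.length)]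

lemma wordVal_lt_of_length_lt {s : ℕ} {l l' : List (Fin s)} (h : l.length < l'.length) :
    wordVal l < wordVal l' := by
  refine (wordVal_lt l).trans_le (le_trans ?_ (le_wordVal l' (by rintro rfl; simp at h)))
  exact Nat.pow_le_pow_right (by omega) (by omega)

lemma wordVal_append {s : ℕ} (l l' : List (Fin s)) :
    wordVal (l ++ l') = wordVal l * (s + 1) ^ l'.length + wordVal l' := by
  induction l with
  | nil => simp [wordVal]
  | cons d t ih =>
    simp only [List.cons_append, wordVal, ih, List.length_append, pow_add]
    ring

lemma wordVal_append_lt {s : ℕ} {p p' q q' : List (Fin s)} (h : wordVal p < wordVal p')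
    (hl : q.length = q'.length) : wordVal (p ++ q) < wordVal (p' ++ q') := by
  rw [wordVal_append, wordVal_append, hl]
  have h1 := wordVal_lt q
  rw [hl] at h1
  nlinarith [Nat.mul_le_mul_right ((s + 1) ^ q'.length) (Nat.succ_le_of_lt h)]

lemma wordVal_append_append_lt {s : ℕ} {p q v v' : List (Fin s)} (h : wordVal v < wordVal v') :
    wordVal (p ++ v ++ q) < wordVal (p ++ v' ++ q) := by
  refine wordVal_append_lt ?_ rfl
  have hl : v.length ≤ v'.length := by
    by_contra! hl
    exact absurd (wordVal_lt_of_length_lt hl) (by omega)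
  rw [wordVal_append, wordVal_append]
  have := Nat.mul_le_mul_left (wordVal p) (Nat.pow_le_pow_right (n := s + 1) (by omega) hl)
  omega

lemma wordVal_injective {s : ℕ} {l l' : List (Fin s)} (hl : l.length = l'.length)
    (h : wordVal l = wordVal l') : l = l' := by
  induction l generalizing l' with
  | nil => exact (List.length_eq_zero_iff.1 hl.symm).symm
  | cons d t ih =>
    cases l' with
    | nil => simp at hl
    | cons d' t' =>
      simp only [List.length_cons, Nat.add_right_cancel_iff] at hl
      simp only [wordVal, hl] at h
      have h1 := wordVal_lt t
      have h2 := wordVal_lt t'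
      rw [hl] at h1
      have hd : (d : ℕ) = d' := by
        rcases lt_trichotomy (d : ℕ) d' with h3 | h3 | h3
        · nlinarith [Nat.mul_le_mul_right ((s + 1) ^ t'.length) (Nat.succ_le_of_lt h3)]
        · exact h3
        · nlinarith [Nat.mul_le_mul_right ((s + 1) ^ t'.length) (Nat.succ_le_of_lt h3)]
      rw [hd] at h
      rw [Fin.ext hd, ih hl (by omega)]

lemma wordVal_flatten_perm_lt {s D : ℕ} (v r : Fin D → List (Fin s)) (L : ℕ)
    (hL : ∀ i, (v i).length = L)
    (hv : ∀ i j, i < j → wordVal (v j) < wordVal (v i)) (σ : Equiv.Perm (Fin D)) (hσ : σ ≠ 1) :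
    wordVal (List.ofFn fun i => v (σ i) ++ r (σ i)).flatten <
      wordVal (List.ofFn fun i => v i ++ r i).flatten := by
  have key : ∀ (n : ℕ) (f g : Fin n → Fin D) (j : Fin n), (∀ i < j, f i = g i) → g j < f j →
      (List.ofFn fun i => v (f i) ++ r (f i)).flatten.length =
        (List.ofFn fun i => v (g i) ++ r (g i)).flatten.length →
      wordVal (List.ofFn fun i => v (f i) ++ r (f i)).flatten <
        wordVal (List.ofFn fun i => v (g i) ++ r (g i)).flatten := by
    intro n
    induction n with
    | zero => exact fun f g j => j.elim0
    | succ n ih =>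
      intro f g j hj hlt hlen
      rw [List.ofFn_succ, List.ofFn_succ, List.flatten_cons, List.flatten_cons] at hlen ⊢
      refine Fin.cases (motive := fun j => (∀ i < j, f i = g i) → g j < f j → _) ?_ ?_ j hj hlt
      · intro _ h0
        rw [List.append_assoc, List.append_assoc] at hlen ⊢
        refine wordVal_append_lt (hv _ _ h0) ?_
        rw [List.length_append, List.length_append (as := v (g 0)), hL, hL] at hlen
        omega
      · intro j hj hlt
        have h0 := hj 0 (Fin.succ_pos j)
        rw [h0] at hlen ⊢
        rw [List.length_append, List.length_append (as := v (g 0) ++ _)] at hlen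
        have := ih (f ∘ Fin.succ) (g ∘ Fin.succ) j
            (fun i hi => hj _ (Fin.succ_lt_succ_iff.2 hi)) hlt
          (by simpa using Nat.add_left_cancel hlen)
        have h2 := wordVal_append_append_lt (p := v (g 0) ++ r (g 0)) (q := []) this
        simpa only [List.append_nil, Function.comp_apply] using h2
  obtain ⟨i, hi⟩ : ∃ i, σ i ≠ i := by
    by_contra! h
    exact hσ (Equiv.ext h)
  have hne : (Finset.univ.filter fun i => σ i ≠ i).Nonempty := ⟨i, by simpa using hi⟩
  let j := (Finset.univ.filter fun i => σ i ≠ i).min' hne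
  have hj1 : σ j ≠ j := by simpa using Finset.min'_mem _ hne
  have hj2 : ∀ i < j, σ i = i := by
    intro i hi
    by_contra h
    exact absurd (Finset.min'_le _ i (by simpa using h)) (not_le.2 hi)
  refine key D σ id j hj2 ?_ ?_
  · refine lt_of_le_of_ne ?_ hj1.symm
    by_contra! h
    exact absurd (σ.injective (hj2 _ h)) hj1
  · rw [List.length_flatten, List.length_flatten]
    refine List.Perm.sum_eq (List.Perm.map _ ?_)
    exact Equiv.Perm.ofFn_comp_perm σ (fun i => v i ++ r i)

/-- A word is reducible if its value is a combination of values of smaller words. -/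
def IsReducibleWord (C : Type*) {T : Type*} [CommRing C] [Ring T] [Algebra C T] {s : ℕ}
    (a : Fin s → T)
    (w : List (Fin s)) : Prop :=
  (w.map a).prod ∈ Submodule.span C {t | ∃ v, wordVal v < wordVal w ∧ (v.map a).prod = t}

section
variable {C T : Type*} [CommRing C] [Ring T] [Algebra C T] {s : ℕ} {a : Fin s → T}

lemma IsReducibleWord.append {w : List (Fin s)} (h : IsReducibleWord C a w) (p q : List (Fin s)) :
    IsReducibleWord C a (p ++ w ++ q) := by
  unfold IsReducibleWord at *
  have h1 := Submodule.mem_map_of_mem (f := (LinearMap.mulRight C (q.map a).prod).comp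
    (LinearMap.mulLeft C (p.map a).prod)) h
  rw [Submodule.map_span] at h1
  have h2 : (List.map a (p ++ w ++ q)).prod = ((LinearMap.mulRight C (q.map a).prod).comp
    (LinearMap.mulLeft C (p.map a).prod)) (w.map a).prod := by simp [mul_assoc]
  rw [h2]
  refine Submodule.span_mono ?_ h1
  rintro _ ⟨_, ⟨v, hv, rfl⟩, rfl⟩
  exact ⟨p ++ v ++ q, wordVal_append_append_lt hv, by simp [mul_assoc]⟩

lemma finite_of_finite_not_isReducibleWord (ha : Algebra.adjoin C (Set.range a) = ⊤)
    (hfin : {w : List (Fin s) | ¬ IsReducibleWord C a w}.Finite) : Module.Finite C T := by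
  let B : Set T := (fun w : List (Fin s) => (w.map a).prod) '' {w | ¬ IsReducibleWord C a w}
  have hw : ∀ n, ∀ w : List (Fin s), wordVal w = n → (w.map a).prod ∈ Submodule.span C B := by
    intro n
    induction n using Nat.strong_induction_on with
    | _ n ih =>
      intro w hw
      by_cases h : IsReducibleWord C a w
      · refine Submodule.span_le.2 ?_ h
        rintro _ ⟨v, hv, rfl⟩
        exact ih _ (hw ▸ hv) v rfl
      · exact Submodule.subset_span ⟨w, h, rfl⟩
  have hB : B.Finite := hfin.image _
  refine ⟨⟨hB.toFinset, ?_⟩⟩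
  rw [Set.Finite.coe_toFinset, eq_top_iff]
  intro t _
  have ht : t ∈ Subalgebra.toSubmodule (Algebra.adjoin C (Set.range a)) := by rw [ha]; trivial
  rw [Algebra.adjoin_eq_span] at ht
  refine Submodule.span_le.2 ?_ ht
  rintro x hx
  rw [← FreeMonoid.mrange_lift] at hx
  obtain ⟨w, rfl⟩ := hx
  rw [FreeMonoid.lift_apply]
  exact hw _ _ rfl

lemma IsReducibleWord.replicate {u : List (Fin s)} (hu : u ≠ []) (h : IsIntegral C (u.map a).prod) :
    ∃ N, IsReducibleWord C a (List.replicate N u).flatten := by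
  obtain ⟨p, hp, hp0⟩ := h
  have hlen : 0 < u.length := List.length_pos_iff.2 hu
  have hpow : ∀ N, ((List.replicate N u).flatten.map a).prod = (u.map a).prod ^ N := by
    intro N
    induction N with
    | zero => simp
    | succ N ih =>
      rw [List.replicate_succ, List.flatten_cons, List.map_append,
        List.prod_append, ih,
        pow_succ']
  refine ⟨p.natDegree, ?_⟩
  unfold IsReducibleWord
  rw [hpow]
  rw [Polynomial.eval₂_eq_sum_range, Finset.sum_range_succ, hp.coeff_natDegree, map_one,
    one_mul] at hp0
  rw [eq_neg_of_add_eq_zero_right hp0]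
  refine Submodule.neg_mem _ (Submodule.sum_mem _ fun i hi => ?_)
  rw [← Algebra.smul_def]
  refine Submodule.smul_mem _ _ (Submodule.subset_span ⟨(List.replicate i u).flatten, ?_, hpow i⟩)
  refine wordVal_lt_of_length_lt ?_
  simp only [List.length_flatten, List.map_replicate, List.sum_replicate, smul_eq_mul]
  exact Nat.mul_lt_mul_of_pos_right (Finset.mem_range.1 hi) hlen

lemma MultilinearIdentity.isReducibleWord {D : ℕ} {α : Equiv.Perm (Fin D) → C} (h1 : α 1 = 1)
    (h : MultilinearIdentity C T α) (v r : Fin D → List (Fin s)) (L : ℕ)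
    (hL : ∀ i, (v i).length = L)
    (hv : ∀ i j, i < j → wordVal (v j) < wordVal (v i)) :
    IsReducibleWord C a (List.ofFn fun i => v i ++ r i).flatten := by
  unfold IsReducibleWord
  have hprod : ∀ σ : Equiv.Perm (Fin D),
      ((List.ofFn fun i => v (σ i) ++ r (σ i)).flatten.map a).prod =
      (List.ofFn fun i => ((v (σ i) ++ r (σ i)).map a).prod).prod := by
    intro σ
    rw [List.map_flatten, List.prod_flatten, List.map_map, List.map_ofFn]
    rfl
  have h2 := h (fun i => ((v i ++ r i).map a).prod)
  rw [← Finset.add_sum_erase _ _ (Finset.mem_univ 1), h1, one_smul] at h2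
  have h3 := hprod 1
  simp only [Equiv.Perm.coe_one, id] at h2 h3
  rw [h3, eq_neg_of_add_eq_zero_left h2]
  refine Submodule.neg_mem _ (Submodule.sum_mem _ fun σ hσ => ?_)
  refine Submodule.smul_mem _ _ (Submodule.subset_span ⟨_, ?_, hprod σ⟩)
  exact wordVal_flatten_perm_lt v r L hL hv σ (Finset.ne_of_mem_erase hσ)

/-- The factor of length `n` of the infinite word `x` starting at position `i`. -/
def wordSeg {s : ℕ} (x : ℕ → Fin s) (i n : ℕ) : List (Fin s) := (List.range' i n).map x

lemma wordSeg_append {s : ℕ} (x : ℕ → Fin s) (i m n : ℕ) :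
    wordSeg x i m ++ wordSeg x (i + m) n = wordSeg x i (m + n) := by
  rw [wordSeg, wordSeg, ← List.map_append, List.range'_append_1, wordSeg]

lemma length_wordSeg {s : ℕ} (x : ℕ → Fin s) (i n : ℕ) : (wordSeg x i n).length = n := by
  simp [wordSeg]

lemma getElem?_wordSeg {s : ℕ} (x : ℕ → Fin s) (i n t : ℕ) (h : t < n) :
    (wordSeg x i n)[t]? = some (x (i + t)) := by
  simp [wordSeg, h]

lemma wordSeg_eq_wordSeg {s : ℕ} {x y : ℕ → Fin s} {i j n : ℕ} :
    wordSeg x i n = wordSeg y j n ↔ ∀ t < n, x (i + t) = y (j + t) := by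
  refine ⟨fun h t ht => ?_, fun h => ?_⟩
  · have := congrArg (fun l => l[t]?) h
    simpa [getElem?_wordSeg, ht] using this
  · refine List.ext_getElem? fun t => ?_
    by_cases ht : t < n
    · rw [getElem?_wordSeg _ _ _ _ ht, getElem?_wordSeg _ _ _ _ ht, h t ht]
    · rw [List.getElem?_eq_none (by simpa [length_wordSeg] using ht),
        List.getElem?_eq_none (by simpa [length_wordSeg] using ht)]

lemma exists_infinite_irreducible_word (h : {w : List (Fin s) | ¬ IsReducibleWord C a w}.Infinite) :
    ∃ x : ℕ → Fin s, ∀ i n, ¬ IsReducibleWord C a (wordSeg x i n) := by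
  have h1 : ∀ n, ∃ w : List (Fin s), ¬ IsReducibleWord C a w ∧ n < w.length := by
    intro n
    by_contra! h1
    exact h ((List.finite_length_le (Fin s) n).subset fun w hw => h1 w hw)
  choose w hw hn using h1
  let U := Filter.hyperfilter ℕ
  have hU : ∀ i, ∀ᶠ n in (U : Filter ℕ), i ≤ n := fun i =>
    Nat.hyperfilter_le_atTop (Filter.eventually_ge_atTop i)
  have h2 : ∀ i : ℕ, ∃ d, ∀ᶠ n in (U : Filter ℕ), (w n)[i]? = some d := by
    intro i
    rw [← Ultrafilter.eventually_exists_iff]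
    filter_upwards [hU i] with n hn'
    exact ⟨_, List.getElem?_eq_getElem (hn'.trans_lt (hn n))⟩
  choose x hx using h2
  refine ⟨x, fun i n hred => ?_⟩
  have h3 : ∀ᶠ m in (U : Filter ℕ), ∀ t : Fin n, (w m)[i + t]? = some (x (i + t)) :=
    Filter.eventually_all.2 fun t => hx _
  obtain ⟨m, hm⟩ := h3.exists
  refine hw m ?_
  have h4 : wordSeg x i n = ((w m).drop i).take n := by
    refine List.ext_getElem? fun t => ?_
    by_cases ht : t < n
    · rw [getElem?_wordSeg _ _ _ _ ht, List.getElem?_take, if_pos ht, List.getElem?_drop]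
      exact (hm ⟨t, ht⟩).symm
    · rw [List.getElem?_eq_none (by simpa [length_wordSeg] using ht), List.getElem?_take, if_neg ht]
  have h5 : w m = (w m).take i ++ wordSeg x i n ++ ((w m).drop i).drop n := by
    rw [h4, List.append_assoc, List.take_append_drop, List.take_append_drop]
  rw [h5]
  exact hred.append _ _

lemma exists_recurrent_word (x : ℕ → Fin s) :
    ∃ y : ℕ → Fin s, ∀ i n N, ∃ p ≥ N, wordSeg x p n = wordSeg y i n := by
  let U := Filter.hyperfilter ℕ
  have hU : ∀ i, ∀ᶠ n in (U : Filter ℕ), i ≤ n := fun i =>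
    Nat.hyperfilter_le_atTop (Filter.eventually_ge_atTop i)
  have h2 : ∀ i, ∃ d, ∀ᶠ n in (U : Filter ℕ), x (n + i) = d := by
    intro i
    rw [← Ultrafilter.eventually_exists_iff]
    exact Filter.Eventually.of_forall fun n => ⟨_, rfl⟩
  choose y hy using h2
  refine ⟨y, fun i n N => ?_⟩
  have h3 : ∀ᶠ m in (U : Filter ℕ), ∀ t : Fin n, x (m + (i + t)) = y (i + t) :=
    Filter.eventually_all.2 fun t => hy _
  obtain ⟨m, hm, hN⟩ := (h3.and (hU N)).exists
  refine ⟨m + i, by omega, wordSeg_eq_wordSeg.2 fun t ht => ?_⟩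
  rw [add_assoc]
  exact hm ⟨t, ht⟩

lemma wordSeg_flatten (x : ℕ → Fin s) (pos : ℕ → ℕ) (h : ∀ j, pos j ≤ pos (j + 1)) (D : ℕ) :
    (List.ofFn fun i : Fin D => wordSeg x (pos i) (pos (i + 1) - pos i)).flatten =
      wordSeg x (pos 0) (pos D - pos 0) := by
  induction D with
  | zero => simp [wordSeg]
  | succ D ih =>
    have h0 : pos 0 ≤ pos D := monotone_nat_of_le_succ h (Nat.zero_le _)
    rw [List.ofFn_succ', List.concat_eq_append, List.flatten_append]
    simp only [Fin.val_castSucc, Fin.val_last, List.flatten_cons, List.flatten_nil, List.append_nil]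
    rw [ih]
    have h1 := wordSeg_append x (pos 0) (pos D - pos 0) (pos (D + 1) - pos D)
    rw [show pos 0 + (pos D - pos 0) = pos D by omega,
      show pos D - pos 0 + (pos (D + 1) - pos D) = pos (D + 1) - pos 0 by have := h D; omega] at h1
    exact h1

/-- Shirshov's theorem: an affine algebra satisfying a polynomial identity in which all short words
are integral is a finite module. -/
theorem finite_of_isIntegral_words {D : ℕ} {α : Equiv.Perm (Fin D) → C} (h1 : α 1 = 1)
    (h : MultilinearIdentity C T α) (ha : Algebra.adjoin C (Set.range a) = ⊤)
    (hinte : ∀ u : List (Fin s), u ≠ [] → u.length ≤ D → IsIntegral C (u.map a).prod) :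
    Module.Finite C T := by
  refine finite_of_finite_not_isReducibleWord ha ?_
  by_contra hinf
  obtain ⟨x, hx⟩ := exists_infinite_irreducible_word hinf
  obtain ⟨y, hy⟩ := exists_recurrent_word x
  by_cases hL : ∃ L, ∃ S : Finset ℕ, S.card = D ∧ ∀ n ∈ S, ∃ i, wordVal (wordSeg y i L) = n
  · obtain ⟨L, S, hS, hSL⟩ := hL
    have hv : ∀ j : Fin D, ∃ i, wordVal (wordSeg y i L) = S.orderEmbOfFin hS j.rev := fun j =>
      hSL _ (Finset.orderEmbOfFin_mem _ _ _)
    choose i hi using hv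
    have hocc : ∀ (j : ℕ) (N : ℕ), ∃ p ≥ N, ∀ hj : j < D, wordSeg x p L =
        wordSeg y (i ⟨j, hj⟩) L := by
      intro j N
      by_cases hj : j < D
      · obtain ⟨p, hp, hp'⟩ := hy (i ⟨j, hj⟩) L N
        exact ⟨p, hp, fun _ => hp'⟩
      · exact ⟨N, le_rfl, fun hj' => absurd hj' hj⟩
    choose f hf hf' using hocc
    let pos : ℕ → ℕ := fun j => Nat.rec (f 0 0) (fun j p => f (j + 1) (p + L)) j
    have hpos : ∀ j, pos j + L ≤ pos (j + 1) := fun j => hf (j + 1) (pos j + L)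
    have hpos' : ∀ j : Fin D, wordSeg x (pos j) L = wordSeg y (i j) L := by
      rintro ⟨j, hj⟩
      cases j with
      | zero => exact hf' 0 0 hj
      | succ j => exact hf' (j + 1) (pos j + L) hj
    have hseg : ∀ j : Fin D, wordSeg x (pos j) (pos (j + 1) - pos j) =
        wordSeg y (i j) L ++ wordSeg x (pos j + L) (pos (j + 1) - pos j - L) := by
      intro j
      rw [← hpos', wordSeg_append]
      congr 1
      have := hpos j
      omega
    have hfl := wordSeg_flatten x pos (fun j => (Nat.le_add_right _ _).trans (hpos j)) D
    simp only [hseg] at hfl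
    refine hx (pos 0) (pos D - pos 0) ?_
    rw [← hfl]
    refine MultilinearIdentity.isReducibleWord h1 h _ _ L (fun i => length_wordSeg _ _ _) ?_
    intro j j' hjj
    rw [hi, hi]
    exact (S.orderEmbOfFin hS).strictMono (Fin.rev_lt_rev.2 hjj)
  · have hpair : ∀ L, ∃ i j : Fin D, i < j ∧ wordSeg y i L = wordSeg y j L := by
      intro L
      by_contra! hne
      refine hL ⟨L, Finset.univ.image fun i : Fin D => wordVal (wordSeg y i L), ?_, ?_⟩
      · rw [Finset.card_image_of_injective, Finset.card_univ, Fintype.card_fin]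
        intro i j hij
        have hij' := wordVal_injective (by rw [length_wordSeg, length_wordSeg]) hij
        rcases lt_trichotomy i j with h3 | h3 | h3
        · exact absurd hij' (hne i j h3)
        · exact h3
        · exact absurd hij'.symm (hne j i h3)
      · intro n hn
        obtain ⟨i, -, rfl⟩ := Finset.mem_image.1 hn
        exact ⟨_, rfl⟩
    obtain ⟨i, j, hij, hper⟩ : ∃ i j : Fin D, i < j ∧ ∀ t, y (i + t) = y (j + t) := by
      by_contra! hne
      choose! t ht using hne
      let M := Finset.univ.sup fun p : Fin D × Fin D => t p.1 p.2 + 1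
      obtain ⟨i, j, hij, he⟩ := hpair M
      refine ht i j hij (wordSeg_eq_wordSeg.1 he _ ?_)
      exact Nat.lt_of_succ_le (Finset.le_sup (f := fun p : Fin D × Fin D => t p.1 p.2 + 1)
        (Finset.mem_univ (i, j)))
    have hij' : (i : ℕ) < j := hij
    let u := wordSeg y i (j - i)
    have hul : u.length = j - i := length_wordSeg _ _ _
    obtain ⟨N, hN⟩ := IsReducibleWord.replicate (C := C) (a := a) (u := u)
      (List.length_pos_iff.1 (by omega)) (hinte u (List.length_pos_iff.1 (by omega)) (by omega))
    have hrep : ∀ N, (List.replicate N u).flatten = wordSeg y i (N * (j - i)) := by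
      intro N
      induction N with
      | zero => simp [wordSeg]
      | succ N ih =>
        rw [List.replicate_succ, List.flatten_cons, ih, add_mul, one_mul, add_comm (N * _),
          ← wordSeg_append]
        congr 1
        refine wordSeg_eq_wordSeg.2 fun t _ => ?_
        rw [hper t]
        congr 1
        omega
    rw [hrep] at hN
    obtain ⟨p, -, hp⟩ := hy i (N * (j - i)) 0
    rw [← hp] at hN
    exact hx _ _ hN

end

lemma IsPrimeRing.matrix {F : Type*} [Field F] (n : ℕ) :
    IsPrimeRing (Matrix (Fin n) (Fin n) F) := by
  intro a b h
  by_contra! hne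
  obtain ⟨ha, hb⟩ := hne
  obtain ⟨i, j, hij⟩ : ∃ i j, a i j ≠ 0 := by
    by_contra! h'
    exact ha (Matrix.ext h')
  obtain ⟨p, q, hpq⟩ : ∃ i j, b i j ≠ 0 := by
    by_contra! h'
    exact hb (Matrix.ext h')
  have := congrFun (congrFun (h (Matrix.single j p 1)) i) q
  rw [Matrix.mul_apply, Finset.sum_eq_single p] at this
  · simp [hij, hpq] at this
  · intro x _ hx
    simp [Matrix.mul_single_apply_of_ne, hx]
  · simp

/-- A nonzero two-sided ideal of a prime artinian ring is everything. -/
lemma IsPrimeRing.eq_top_of_isArtinianRing {B : Type*} [Ring B] [IsArtinianRing B]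
    (hB : IsPrimeRing B)
    (I : Ideal B) (hI : ∀ x ∈ I, ∀ b, x * b ∈ I) (h0 : I ≠ ⊥) : I = ⊤ := by
  have hjac : Ring.jacobson B = ⊥ := by
    by_contra hne
    obtain ⟨n, hn⟩ := IsSemiprimaryRing.isNilpotent (R := B)
    obtain ⟨x, hx, hx0⟩ := Submodule.exists_mem_ne_zero_of_ne_bot hne
    have hpow : ∀ m : ℕ, ∃ y ∈ Ring.jacobson B ^ m, y ≠ 0 := by
      intro m
      induction m with
      | zero => exact ⟨1, by rw [Submodule.pow_zero]; exact Submodule.one_le.1 le_rfl, fun h =>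
          hx0 (by rw [← mul_one x, h, mul_zero])⟩
      | succ m ih =>
        obtain ⟨y, hy, hy0⟩ := ih
        by_contra! h
        have hz : ∀ z, y * z * x = 0 := by
          intro z
          refine h _ ?_
          rw [Submodule.pow_succ, mul_assoc]
          exact Submodule.mul_mem_mul hy (Ideal.mul_mem_left _ _ hx)
        exact (hB y x hz).elim hy0 hx0
    obtain ⟨y, hy, hy0⟩ := hpow n
    rw [hn] at hy
    exact hy0 hy
  have : IsSemisimpleRing B := IsArtinianRing.isSemisimpleRing_iff_jacobson.2 hjac
  obtain ⟨I', hI'⟩ := exists_isCompl I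
  have h1 : I' = ⊥ := by
    rw [eq_bot_iff]
    intro y hy
    obtain ⟨x, hx, hx0⟩ := Submodule.exists_mem_ne_zero_of_ne_bot h0
    have hz : ∀ b, x * b * y = 0 := by
      intro b
      have : x * b * y ∈ I ⊓ I' := ⟨by rw [mul_assoc]; exact hI x hx _, Ideal.mul_mem_left _ _ hy⟩
      rw [hI'.inf_eq_bot] at this
      exact this
    exact (hB x y hz).resolve_left hx0
  rw [h1] at hI'
  simpa using hI'.sup_eq_top

section
variable {k F E : Type*} [Field k] [Field F] [Ring E] [Algebra F E] [Algebra k F]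

lemma isIntegral_of_charpoly_coeff_mem [Module.Finite F E] (C : Subalgebra k F) (w : E)
    (h : ∀ i, (LinearMap.mulLeft F w).charpoly.coeff i ∈ C) : IsIntegral C w := by
  obtain ⟨q, hq, -, hm⟩ := Polynomial.lifts_and_natDegree_eq_and_monic (f := algebraMap C F)
    (p := (LinearMap.mulLeft F w).charpoly)
    ((Polynomial.lifts_iff_coeff_lifts _).2 fun i => ⟨⟨_, h i⟩, rfl⟩) (LinearMap.charpoly_monic _)
  refine ⟨q, hm, ?_⟩
  have h1 : Polynomial.aeval w q = Polynomial.aeval w (LinearMap.mulLeft F w).charpoly := by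
    rw [← hq, Polynomial.aeval_map_algebraMap]
  rw [← Polynomial.aeval_def, h1]
  have h2 := LinearMap.aeval_self_charpoly (LinearMap.mulLeft F w)
  have h3 := Polynomial.aeval_algHom_apply (Algebra.lmul F E) w (LinearMap.mulLeft F w).charpoly
  have h4 : Algebra.lmul F E w = LinearMap.mulLeft F w := rfl
  rw [h4, h2] at h3
  have h5 := LinearMap.congr_fun h3 1
  simpa using h5.symm

variable {A : Type*} [Ring A]

/-- The additive subgroup generated by the values of the Capelli polynomial. -/
def capelliSubgroup (m : ℕ) (Φ : A →+* E) : AddSubgroup E :=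
  AddSubgroup.closure {e | ∃ u v x : Fin m → A, Φ (capelli u v x) = e}

lemma capelliSubgroup_le_range (m : ℕ) (Φ : A →+* E) {e : E} (he : e ∈ capelliSubgroup m Φ) :
    ∃ a, Φ a = e := by
  have : capelliSubgroup m Φ ≤ Φ.range.toAddSubgroup := by
    refine (AddSubgroup.closure_le _).2 ?_
    rintro _ ⟨u, v, x, rfl⟩
    exact ⟨_, rfl⟩
  exact this he

lemma mul_capelli (m : ℕ) (u v x : Fin (m + 1) → A) (a : A) :
    a * capelli u v x = capelli (Function.update u 0 (a * u 0)) v x := by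
  simp only [capelli, Finset.mul_sum]
  refine Finset.sum_congr rfl fun σ _ => ?_
  rw [mul_smul_comm]
  congr 1
  rw [List.ofFn_succ, List.ofFn_succ, List.prod_cons, List.prod_cons]
  simp [mul_assoc]

lemma capelli_mul (m : ℕ) (u v x : Fin (m + 1) → A) (a : A) :
    capelli u v x * a = capelli u (Function.update v (Fin.last m) (v (Fin.last m) * a)) x := by
  simp only [capelli, Finset.sum_mul]
  refine Finset.sum_congr rfl fun σ _ => ?_
  rw [smul_mul_assoc]
  congr 1
  rw [List.ofFn_succ', List.ofFn_succ', List.concat_eq_append, List.concat_eq_append,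
      List.prod_append,
    List.prod_append]
  simp [mul_assoc]

lemma mul_mem_capelliSubgroup (m : ℕ) (hm : 0 < m) (Φ : A →+* E) {e : E}
    (he : e ∈ capelliSubgroup m Φ) (a : A) :
    Φ a * e ∈ capelliSubgroup m Φ ∧ e * Φ a ∈ capelliSubgroup m Φ := by
  obtain ⟨m, rfl⟩ := Nat.exists_eq_succ_of_ne_zero hm.ne'
  have h1 : capelliSubgroup (m + 1) Φ ≤ (capelliSubgroup (m + 1) Φ).comap
      (AddMonoidHom.mulLeft (Φ a)) := by
    refine (AddSubgroup.closure_le _).2 ?_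
    rintro _ ⟨u, v, x, rfl⟩
    change Φ a * Φ _ ∈ capelliSubgroup (m + 1) Φ
    rw [← map_mul, mul_capelli]
    exact AddSubgroup.subset_closure ⟨_, _, _, rfl⟩
  have h2 : capelliSubgroup (m + 1) Φ ≤ (capelliSubgroup (m + 1) Φ).comap
      (AddMonoidHom.mulRight (Φ a)) := by
    refine (AddSubgroup.closure_le _).2 ?_
    rintro _ ⟨u, v, x, rfl⟩
    change Φ _ * Φ a ∈ capelliSubgroup (m + 1) Φ
    rw [← map_mul, capelli_mul]
    exact AddSubgroup.subset_closure ⟨_, _, _, rfl⟩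
  exact ⟨h1 he, h2 he⟩

lemma charpoly_coeff_smul_mem_capelliSubgroup {m : ℕ} (b : Module.Basis (Fin m) F E) (Φ : A →+* E)
    (w : A) (i : ℕ) {e : E} (he : e ∈ capelliSubgroup m Φ) :
    have := Module.Finite.of_basis b
    (LinearMap.mulLeft F (Φ w)).charpoly.coeff i • e ∈ capelliSubgroup m Φ := by
  intro _
  let r := (LinearMap.mulLeft F (Φ w)).charpoly.coeff i
  have h1 : capelliSubgroup m Φ ≤ (capelliSubgroup m Φ).comap (DistribSMul.toAddMonoidHom E r) := by
    refine (AddSubgroup.closure_le _).2 ?_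
    rintro _ ⟨u, v, x, rfl⟩
    rw [map_capelli]
    change r • _ ∈ capelliSubgroup m Φ
    rw [← capelliAlt_apply F, AlternatingMap.charpoly_coeff_smul b]
    refine AddSubgroup.sum_mem _ fun S _ => ?_
    split_ifs
    · refine AddSubgroup.subset_closure ⟨u, v, fun j => if j ∈ S then x j else - (w * x j), ?_⟩
      rw [map_capelli, capelliAlt_apply]
      congr 1
      funext j
      simp only [Function.comp_apply]
      split_ifs <;> simp
    · exact AddSubgroup.zero_mem _
  exact h1 he

end

lemma exists_smul_mem_of_mem_span {R K E : Type*} [CommRing R] [Field K] [Algebra R K]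
    [IsFractionRing R K] [Ring E] [Algebra K E] [Algebra R E] [IsScalarTower R K E] [IsDomain R]
        (T : Subalgebra R E)
    {e : E} (he : e ∈ Submodule.span K (T : Set E)) : ∃ r : R, r ≠ 0 ∧ r • e ∈ T := by
  induction he using Submodule.span_induction with
  | mem x hx => exact ⟨1, one_ne_zero, by rwa [one_smul]⟩
  | zero => exact ⟨1, one_ne_zero, by rw [smul_zero]; exact T.zero_mem⟩
  | add x y _ _ hx hy =>
    obtain ⟨r, hr, hrx⟩ := hx
    obtain ⟨s, hs, hsy⟩ := hy
    refine ⟨r * s, mul_ne_zero hr hs, ?_⟩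
    rw [smul_add]
    refine T.add_mem ?_ ?_
    · rw [mul_comm, mul_smul]; exact T.smul_mem hrx s
    · rw [mul_smul]; exact T.smul_mem hsy r
  | smul q x _ hx =>
    obtain ⟨r, hr, hrx⟩ := hx
    obtain ⟨p, s, hs, rfl⟩ := IsFractionRing.div_surjective (A := R) q
    have hs0 : s ≠ 0 := nonZeroDivisors.ne_zero hs
    refine ⟨s * r, mul_ne_zero hs0 hr, ?_⟩
    have : (s * r) • (algebraMap R K p / algebraMap R K s) • x = p • (r • x) := by
      rw [← algebraMap_smul K (s * r), ← algebraMap_smul K p, ← algebraMap_smul K r, smul_smul,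
          smul_smul,
        map_mul]
      congr 1
      have : algebraMap R K s ≠ 0 := by simpa using hs0
      field_simp
    rw [this]
    exact T.smul_mem hrx p

lemma exists_conductor {R F E : Type*} [CommRing R] [IsDomain R] [Field F] [Algebra R F]
    [FaithfulSMul R F]
    [Ring E] [Algebra F E] [Algebra R E] [IsScalarTower R F E] (hE : IsPrimeRing E)
        (T : Subalgebra R E)
    [Module.Finite R T] (hT : Submodule.span F (T : Set E) = ⊤) (J : AddSubgroup E)
        (hJT : ∀ j ∈ J, j ∈ T)
    (hJ : ∀ j ∈ J, ∀ t ∈ T, t * j ∈ J ∧ j * t ∈ J) (hJ0 : ∃ j ∈ J, j ≠ 0) :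
    ∃ c : R, c ≠ 0 ∧ algebraMap R E c ∈ J := by
  let K := FractionRing R
  let _ : Algebra K F := FractionRing.liftAlgebra R F
  have : IsScalarTower R K F := FractionRing.isScalarTower_liftAlgebra R F
  let _ : Algebra K E := Algebra.compHom E (algebraMap K F)
  have : IsScalarTower K F E := IsScalarTower.of_algebraMap_eq fun _ => rfl
  have : IsScalarTower R K E := IsScalarTower.of_algebraMap_eq fun r => by
    rw [IsScalarTower.algebraMap_apply R F E, IsScalarTower.algebraMap_apply K F E,
      ← IsScalarTower.algebraMap_apply R K F]
  let B : Subalgebra K E := Algebra.adjoin K (T : Set E)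
  have hBs : Subalgebra.toSubmodule B = Submodule.span K (T : Set E) := by
    rw [Algebra.adjoin_eq_span]
    congr 2
    exact Submonoid.closure_eq T.toSubsemiring.toSubmonoid
  have hBT : ∀ b : B, ∃ r : R, r ≠ 0 ∧ r • (b : E) ∈ T := by
    rintro ⟨b, hb⟩
    have hb' : b ∈ Subalgebra.toSubmodule B := hb
    rw [hBs] at hb'
    exact exists_smul_mem_of_mem_span T hb'
  have hfin : Module.Finite K B := by
    obtain ⟨S, hS⟩ := (Module.Finite.iff_fg.1 ‹Module.Finite R T› : (Subalgebra.toSubmodule T).FG)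
    refine Module.Finite.iff_fg.2 (⟨S, ?_⟩ : (Subalgebra.toSubmodule B).FG)
    rw [hBs]
    refine le_antisymm (Submodule.span_mono ?_) (Submodule.span_le.2 ?_)
    · have : (S : Set E) ⊆ Submodule.span R (S : Set E) := Submodule.subset_span
      rw [hS] at this
      exact this
    · intro t ht
      have ht' : t ∈ Submodule.span R (S : Set E) := by rw [hS]; exact ht
      exact Submodule.span_le_restrictScalars R K _ ht'
  have hart : IsArtinianRing B := IsArtinianRing.of_finite K B
  have hTB : ∀ t ∈ T, t ∈ B := fun t ht => Algebra.subset_adjoin ht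
  have hB : IsPrimeRing B := by
    intro b b' h
    have h1 : ∀ x : E, (b : E) * x * b' = 0 := by
      intro x
      have hx : x ∈ Submodule.span F (T : Set E) := by rw [hT]; trivial
      induction hx using Submodule.span_induction with
      | mem x hx => exact congrArg Subtype.val (h ⟨x, hTB x hx⟩)
      | zero => simp
      | add x y _ _ hx hy => rw [mul_add, add_mul, hx, hy, add_zero]
      | smul q x _ hx => rw [mul_smul_comm, smul_mul_assoc, hx, smul_zero]
    exact (hE _ _ h1).imp (fun h => Subtype.ext h) (fun h => Subtype.ext h)
  have hJR : ∀ j ∈ J, ∀ r : R, r • j ∈ J := by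
    intro j hj r
    rw [Algebra.smul_def]
    exact (hJ j hj _ (T.algebraMap_mem r)).1
  have hmul : ∀ (b b' : B) (r r' : R), (r * r') • ((b : E) * b') = (r • (b : E)) *
      (r' • (b' : E)) := by
    intro b b' r r'
    rw [smul_mul_smul_comm]
  let I : Ideal B :=
    { carrier := {b | ∃ r : R, r ≠ 0 ∧ r • (b : E) ∈ J}
      add_mem' := by
        rintro x y ⟨r, hr, hx⟩ ⟨s, hs, hy⟩
        refine ⟨r * s, mul_ne_zero hr hs, ?_⟩
        rw [Subalgebra.coe_add, smul_add]
        refine J.add_mem ?_ ?_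
        · rw [mul_comm, mul_smul]; exact hJR _ hx _
        · rw [mul_smul]; exact hJR _ hy _
      zero_mem' := ⟨1, one_ne_zero, by simp⟩
      smul_mem' := by
        rintro b x ⟨r, hr, hx⟩
        obtain ⟨s, hs, hb⟩ := hBT b
        refine ⟨s * r, mul_ne_zero hs hr, ?_⟩
        rw [smul_eq_mul, Subalgebra.coe_mul, hmul]
        exact (hJ _ hx _ hb).1 }
  have hI : I = ⊤ := by
    refine hB.eq_top_of_isArtinianRing I ?_ ?_
    · rintro x ⟨r, hr, hx⟩ b
      obtain ⟨s, hs, hb⟩ := hBT b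
      refine ⟨r * s, mul_ne_zero hr hs, ?_⟩
      rw [Subalgebra.coe_mul, hmul]
      exact (hJ _ hx _ hb).2
    · obtain ⟨j, hj, hj0⟩ := hJ0
      intro h
      have : (⟨j, hTB j (hJT j hj)⟩ : B) ∈ I := ⟨1, one_ne_zero, by rwa [one_smul]⟩
      rw [h] at this
      exact hj0 (congrArg Subtype.val this)
  obtain ⟨c, hc, hcJ⟩ : (1 : B) ∈ I := by rw [hI]; trivial
  refine ⟨c, hc, ?_⟩
  rw [Algebra.algebraMap_eq_smul_one]
  exact hcJ

lemma exists_algebraMap_of_span_eq_top {k F E A : Type*} [Field k] [Field F] [Ring A] [Algebra k A]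
    [Ring E] [Nontrivial E] [Algebra F E] [Algebra.IsCentral F E] (Φ : A →+* E)
    (hΦ : Submodule.span F (Set.range Φ) = ⊤) :
    ∃ f : k →+* F, ∀ c, algebraMap F E (f c) = Φ (algebraMap k A c) := by
  have hinj : Function.Injective (algebraMap F E) := (algebraMap F E).injective
  have h1 : ∀ c, ∃ d, algebraMap F E d = Φ (algebraMap k A c) := by
    intro c
    have : Φ (algebraMap k A c) ∈ Subalgebra.center F E := by
      rw [Subalgebra.mem_center_iff]
      intro x
      have hx : x ∈ Submodule.span F (Set.range Φ) := by rw [hΦ]; trivial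
      induction hx using Submodule.span_induction with
      | mem x hx =>
        obtain ⟨a, rfl⟩ := hx
        rw [← map_mul, ← map_mul, Algebra.commutes]
      | zero => simp
      | add x y _ _ hx hy => rw [add_mul, mul_add, hx, hy]
      | smul q x _ hx => rw [smul_mul_assoc, mul_smul_comm, hx]
    exact Algebra.IsCentral.out this
  choose f hf using h1
  refine ⟨⟨⟨⟨f, ?_⟩, ?_⟩, ?_, ?_⟩, hf⟩
  · exact hinj (by rw [hf, map_one, map_one, map_one])
  · intro x y; exact hinj (by simp only [hf, map_mul])
  · exact hinj (by simp only [hf, map_zero])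
  · intro x y; exact hinj (by simp only [hf, map_add])

/-- A prime affine noetherian algebra satisfying a polynomial identity has a finite central-type
extension sharing a nonzero central element. -/
theorem IsPrimeRing.exists_finite_extension {k : Type u'} {A : Type u} [Field k] [Ring A]
    [Nontrivial A]
    [IsNoetherianRing A] [Algebra k A] [Algebra.FiniteType k A]
    {D : ℕ} {α : Equiv.Perm (Fin D) → k} (hα : MultilinearIdentity k A α) (h1 : α 1 = 1)
    (hA : IsPrimeRing A) :
    ∃ (g : ℕ) (T : Type u) (_ : Ring T) (_ : Algebra (MvPolynomial (Fin g) k) T) (φ : A →+* T)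
      (c : MvPolynomial (Fin g) k), Function.Injective φ ∧
      (∀ x, φ (algebraMap k A x) = algebraMap (MvPolynomial (Fin g) k) T (MvPolynomial.C x)) ∧
      Module.Finite (MvPolynomial (Fin g) k) T ∧
      (∀ (r : MvPolynomial (Fin g) k) (t : T), r • t = 0 → r = 0 ∨ t = 0) ∧
      c ≠ 0 ∧ ∀ t, ∃ a, φ a = c • t := by
  obtain ⟨n, F, _, Φ, L, _, ψ, hn, hΦ, hψ⟩ := hA.exists_matrix_embedding hα h1
  let E := Matrix (Fin n) (Fin n) F
  have : Nonempty (Fin n) := ⟨⟨0, hn⟩⟩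
  let m := n * n
  have hm : 0 < m := Nat.mul_pos hn hn
  let b : Module.Basis (Fin m) F E := (Matrix.stdBasis F (Fin n) (Fin n)).reindex finProdFinEquiv
  have : Module.Finite F E := Module.Finite.of_basis b
  obtain ⟨u, v, x, hux⟩ : ∃ u v x : Fin m → A, Φ (capelli u v x) ≠ 0 := by
    by_contra! hne
    obtain ⟨u, v, x, hux⟩ := exists_capelli_ne_zero (L := L) hn
    refine hux (capelli_eq_zero_of_span ψ hψ (fun u v x => ?_) u v x)
    rw [(map_eq_zero_iff Φ hΦ).1 (hne u v x), map_zero]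
  have hspan : Submodule.span F (Set.range Φ) = ⊤ := by
    rw [map_capelli, ← capelliAlt_apply F] at hux
    have hli : LinearIndependent F (Φ ∘ x) := by
      by_contra hli
      exact hux (AlternatingMap.map_linearDependent _ _ hli)
    have hcard : Fintype.card (Fin m) = Module.finrank F E := by
      rw [Module.finrank_eq_card_basis b]
    rw [eq_top_iff, ← hli.span_eq_top_of_card_eq_finrank' hcard]
    exact Submodule.span_mono (Set.range_comp_subset_range _ _)
  obtain ⟨f, hf⟩ := exists_algebraMap_of_span_eq_top (k := k) Φ hspan
  let _ : Algebra k F := f.toAlgebra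
  have hJcap : ∃ j ∈ capelliSubgroup m Φ, j ≠ 0 :=
    ⟨_, AddSubgroup.subset_closure ⟨u, v, x, rfl⟩, hux⟩
  obtain ⟨S, hS⟩ := ‹Algebra.FiniteType k A›
  let s := S.card
  let a : Fin s → A := fun i => S.equivFin.symm i
  have haS : Set.range a = S := by
    ext y
    constructor
    · rintro ⟨i, rfl⟩; exact (S.equivFin.symm i).2
    · intro hy; exact ⟨S.equivFin ⟨y, hy⟩, by simp [a]⟩
  let W : Set F := (fun p : List (Fin s) × ℕ =>
    (LinearMap.mulLeft F (Φ (p.1.map a).prod)).charpoly.coeff p.2) ''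
        ({l | l.length ≤ D} ×ˢ Set.Iic m)
  have hW : W.Finite := ((List.finite_length_le _ D).prod (Set.finite_Iic m)).image _
  let C : Subalgebra k F := Algebra.adjoin k W
  have hCfg : Algebra.FiniteType k C := (Subalgebra.fg_iff_finiteType _).1
    ⟨hW.toFinset, by rw [Set.Finite.coe_toFinset]⟩
  have hinte : ∀ l : List (Fin s), l.length ≤ D → IsIntegral C (Φ (l.map a).prod) := by
    intro l hl
    refine isIntegral_of_charpoly_coeff_mem C _ fun i => ?_
    by_cases hi : i ≤ m
    · exact Algebra.subset_adjoin ⟨(l, i), ⟨hl, hi⟩, rfl⟩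
    · rw [Polynomial.coeff_eq_zero_of_natDegree_lt]
      · exact C.zero_mem
      · rw [LinearMap.charpoly_natDegree, Module.finrank_eq_card_basis b, Fintype.card_fin]
        omega
  have hCJ : ∀ c ∈ C, ∀ j ∈ capelliSubgroup m Φ, c • j ∈ capelliSubgroup m Φ := by
    intro c hc
    induction hc using Algebra.adjoin_induction with
    | mem x hx =>
      obtain ⟨p, -, rfl⟩ := hx
      exact fun j hj => charpoly_coeff_smul_mem_capelliSubgroup b Φ _ _ hj
    | algebraMap r =>
      intro j hj
      rw [Algebra.smul_def]
      have : algebraMap F E (algebraMap k F r) = Φ (algebraMap k A r) := hf r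
      rw [this]
      exact (mul_mem_capelliSubgroup m hm Φ hj _).1
    | add x y _ _ hx hy =>
      intro j hj
      rw [add_smul]
      exact AddSubgroup.add_mem _ (hx j hj) (hy j hj)
    | mul x y _ _ hx hy => intro j hj; rw [mul_smul]; exact hx _ (hy j hj)
  let T : Subalgebra C E := Algebra.adjoin C (Set.range (Φ ∘ a))
  let a' : Fin s → T := fun i => ⟨Φ (a i), Algebra.subset_adjoin ⟨i, rfl⟩⟩
  have ha' : Algebra.adjoin C (Set.range a') = ⊤ := by
    have : Set.range a' = ((↑) : T → E) ⁻¹' (Set.range (Φ ∘ a)) := by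
      ext y
      constructor
      · rintro ⟨i, rfl⟩; exact ⟨i, rfl⟩
      · rintro ⟨i, hi⟩; exact ⟨i, Subtype.ext hi⟩
    rw [this]
    exact Algebra.adjoin_adjoin_coe_preimage
  have hlist : ∀ l : List T, (l.prod : E) = (l.map Subtype.val).prod := fun l =>
      map_list_prod T.val l
  have hTid : MultilinearIdentity C T (fun σ => algebraMap k C (α σ)) := by
    intro z
    refine Subtype.ext ?_
    refine Eq.trans ?_ (hα.extend Φ hspan (fun i => (z i : E)))
    rw [AddSubmonoidClass.coe_finsetSum]
    refine Finset.sum_congr rfl fun σ _ => ?_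
    rw [← hf, ← Algebra.smul_def, Subalgebra.coe_smul, hlist, List.map_ofFn]
    rfl
  have hTfin : Module.Finite C T := by
    refine finite_of_isIntegral_words (a := a') (by rw [h1, map_one]) hTid ha' fun l _ hl => ?_
    rw [← isIntegral_algHom_iff T.val Subtype.val_injective]
    have : T.val (l.map a').prod = Φ (l.map a).prod := by
      rw [map_list_prod, map_list_prod, List.map_map, List.map_map]
      rfl
    rw [this]
    exact hinte l hl
  have hΦT : ∀ y, Φ y ∈ T := by
    intro y
    have hy : y ∈ Algebra.adjoin k (S : Set A) := by rw [hS]; trivial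
    induction hy using Algebra.adjoin_induction with
    | mem x hx =>
      rw [← haS] at hx
      obtain ⟨i, rfl⟩ := hx
      exact (a' i).2
    | algebraMap r =>
      rw [← hf]
      exact T.algebraMap_mem (algebraMap k C r)
    | add x y _ _ hx hy => rw [map_add]; exact T.add_mem hx hy
    | mul x y _ _ hx hy => rw [map_mul]; exact T.mul_mem hx hy
  have hTJ : ∀ t ∈ T, ∀ j ∈ capelliSubgroup m Φ,
      t * j ∈ capelliSubgroup m Φ ∧ j * t ∈ capelliSubgroup m Φ := by
    intro t ht
    induction ht using Algebra.adjoin_induction with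
    | mem x hx =>
      obtain ⟨i, rfl⟩ := hx
      exact fun j hj => mul_mem_capelliSubgroup m hm Φ hj _
    | algebraMap r =>
      intro j hj
      rw [← Algebra.commutes r j, ← Algebra.smul_def]
      exact ⟨hCJ r r.2 j hj, hCJ r r.2 j hj⟩
    | add x y _ _ hx hy =>
      intro j hj
      rw [add_mul, mul_add]
      exact ⟨AddSubgroup.add_mem _ (hx j hj).1 (hy j hj).1,
          AddSubgroup.add_mem _ (hx j hj).2 (hy j hj).2⟩
    | mul x y _ _ hx hy =>
      intro j hj
      rw [mul_assoc x y j, ← mul_assoc j x y]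
      exact ⟨(hx _ (hy j hj).1).1, (hy _ (hx j hj).2).2⟩
  obtain ⟨g, ρ, hρ, hρfin⟩ := exists_finite_inj_algHom_of_fg k C
  let R := MvPolynomial (Fin g) k
  let _ : Algebra R C := ρ.toRingHom.toAlgebra
  have hRC : Module.Finite R C := hρfin
  let _ : Algebra R F := ((algebraMap C F).comp ρ.toRingHom).toAlgebra
  let _ : Algebra R E := Algebra.compHom E (algebraMap R F)
  have : IsScalarTower R C F := IsScalarTower.of_algebraMap_eq fun _ => rfl
  have : IsScalarTower R F E := IsScalarTower.of_algebraMap_eq fun _ => rfl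
  have : IsScalarTower R C E := IsScalarTower.of_algebraMap_eq fun _ => rfl
  have hRF : Function.Injective (algebraMap R F) := Subtype.val_injective.comp hρ
  have : FaithfulSMul R F := (faithfulSMul_iff_algebraMap_injective R F).2 hRF
  let T' : Subalgebra R E := T.restrictScalars R
  have hT'fin : Module.Finite R T' := (Module.Finite.trans C T : Module.Finite R T)
  have hEprime : IsPrimeRing E := IsPrimeRing.matrix n
  obtain ⟨c, hc, hcJ⟩ := exists_conductor (R := R) (F := F) hEprime T'
    (by
      rw [eq_top_iff, ← hspan]
      refine Submodule.span_mono ?_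
      rintro _ ⟨y, rfl⟩
      exact hΦT y) (capelliSubgroup m Φ)
    (fun j hj => by
      obtain ⟨y, rfl⟩ := capelliSubgroup_le_range m Φ hj
      exact hΦT y) (fun j hj t ht => hTJ t ht j hj) hJcap
  refine ⟨g, T', inferInstance, inferInstance, Φ.codRestrict T' hΦT, c, ?_, ?_, hT'fin, ?_, hc, ?_⟩
  · exact fun y z h => hΦ (congrArg Subtype.val h)
  · intro y
    refine Subtype.ext ?_
    change Φ _ = algebraMap F E (algebraMap C F (ρ (MvPolynomial.C y)))
    rw [← hf]
    congr 2
    exact (congrArg Subtype.val (ρ.commutes y)).symm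
  · intro r t h
    have h2 : algebraMap R F r • (t : E) = 0 := by
      rw [algebraMap_smul]
      exact congrArg Subtype.val h
    refine (smul_eq_zero.1 h2).imp (fun h3 => ?_) (fun h3 => Subtype.ext h3)
    exact (map_eq_zero_iff _ hRF).1 h3
  · intro t
    obtain ⟨y, hy⟩ := capelliSubgroup_le_range m Φ (hTJ t t.2 _ hcJ).2
    refine ⟨y, Subtype.ext ?_⟩
    refine hy.trans ?_
    exact (Algebra.smul_def c (t : E)).symm

/-! ### Ext groups of unbundled modules -/

/-- `Ext` groups between unbundled modules living in the same universe as the ring. -/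
def ModExt (H : Type u) [Ring H] (M : Type u) [AddCommGroup M] [Module H M]
    (B : Type u) [AddCommGroup B] [Module H B] (q : ℕ) : Type (u + 1) :=
  Abelian.Ext (C := ModuleCat.{u} H) (ModuleCat.of H M) (ModuleCat.of H B) q

/-- A short exact sequence of modules, given by its two maps. -/
structure IsShortExact {H : Type u} [Ring H] {M' M M'' : Type u} [AddCommGroup M'] [Module H M']
    [AddCommGroup M] [Module H M] [AddCommGroup M''] [Module H M'']
    (i : M' →ₗ[H] M) (p : M →ₗ[H] M'') : Prop where
  inj : Function.Injective i
  exact : Function.Exact i p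
  surj : Function.Surjective p

namespace IsShortExact

variable {H : Type u} [Ring H]

theorem of_submodule {M : Type u} [AddCommGroup M] [Module H M] (N : Submodule H M) :
    IsShortExact N.subtype N.mkQ :=
  ⟨N.injective_subtype, LinearMap.exact_subtype_mkQ N, N.mkQ_surjective⟩

theorem of_surjective {M N : Type u} [AddCommGroup M] [Module H M] [AddCommGroup N] [Module H N]
    (p : M →ₗ[H] N) (hp : Function.Surjective p) : IsShortExact (LinearMap.ker p).subtype p :=
  ⟨Submodule.injective_subtype _, p.exact_subtype_ker_map, hp⟩

theorem of_injective {M N : Type u} [AddCommGroup M] [Module H M] [AddCommGroup N] [Module H N]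
    (i : M →ₗ[H] N) (hi : Function.Injective i) : IsShortExact i (LinearMap.range i).mkQ :=
  ⟨hi, LinearMap.exact_map_mkQ_range i, Submodule.mkQ_surjective _⟩

variable {M' M M'' : Type u} [AddCommGroup M'] [Module H M']
    [AddCommGroup M] [Module H M] [AddCommGroup M''] [Module H M'']
    {i : M' →ₗ[H] M} {p : M →ₗ[H] M''}

theorem shortExact (h : IsShortExact i p) :
    (ShortComplex.mk (ModuleCat.ofHom i) (ModuleCat.ofHom p)
      (by ext x; exact h.exact.apply_apply_eq_zero x)).ShortExact := by
  have : Mono (ModuleCat.ofHom i) := (ModuleCat.mono_iff_injective _).2 h.inj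
  have : Epi (ModuleCat.ofHom p) := (ModuleCat.epi_iff_surjective _).2 h.surj
  refine ⟨?_⟩
  rw [ShortComplex.moduleCat_exact_iff]
  exact fun x hx => (h.exact x).1 hx

end IsShortExact

namespace ModExt

variable {H : Type u} [Ring H]
variable {M M' M'' N : Type u} [AddCommGroup M] [Module H M] [AddCommGroup M'] [Module H M']
  [AddCommGroup M''] [Module H M''] [AddCommGroup N] [Module H N]
variable {B B' B'' C : Type u} [AddCommGroup B] [Module H B] [AddCommGroup B'] [Module H B']
  [AddCommGroup B''] [Module H B''] [AddCommGroup C] [Module H C]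
variable {q : ℕ}

noncomputable instance : AddCommGroup (ModExt H M B q) :=
  inferInstanceAs (AddCommGroup (Abelian.Ext (C := ModuleCat.{u} H) _ _ q))

/-- Precomposition with a linear map. -/
noncomputable def pre (f : M →ₗ[H] M') : ModExt H M' B q →+ ModExt H M B q :=
  (Abelian.Ext.mk₀ (ModuleCat.ofHom f)).precomp (ModuleCat.of H B) (zero_add q)

/-- Postcomposition with a linear map. -/
noncomputable def post (g : B →ₗ[H] B') : ModExt H M B q →+ ModExt H M B' q :=
  (Abelian.Ext.mk₀ (ModuleCat.ofHom g)).postcomp (ModuleCat.of H M) (add_zero q)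

/-- The connecting map of a short exact sequence in the first variable. -/
noncomputable def preδ {i : M' →ₗ[H] M} {p : M →ₗ[H] M''} (h : IsShortExact i p) :
    ModExt H M' B q →+ ModExt H M'' B (q + 1) :=
  h.shortExact.extClass.precomp (ModuleCat.of H B) (add_comm 1 q)

/-- The connecting map of a short exact sequence in the second variable. -/
noncomputable def postδ {i : B' →ₗ[H] B} {p : B →ₗ[H] B''} (h : IsShortExact i p) :
    ModExt H M B'' q →+ ModExt H M B' (q + 1) :=
  h.shortExact.extClass.postcomp (ModuleCat.of H M) rfl

theorem pre_id (x : ModExt H M B q) : pre LinearMap.id x = x :=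
  Abelian.Ext.mk₀_id_comp (C := ModuleCat.{u} H) x

theorem post_id (x : ModExt H M B q) : post LinearMap.id x = x :=
  Abelian.Ext.comp_mk₀_id (C := ModuleCat.{u} H) x

theorem pre_pre (f : M →ₗ[H] M') (g : M' →ₗ[H] M'') (x : ModExt H M'' B q) :
    pre f (pre g x) = pre (g ∘ₗ f) x :=
  Abelian.Ext.mk₀_comp_mk₀_assoc (C := ModuleCat.{u} H) _ _ _

theorem post_post (f : B →ₗ[H] B') (g : B' →ₗ[H] B'') (x : ModExt H M B q) :
    post g (post f x) = post (g ∘ₗ f) x := by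
  refine (Abelian.Ext.comp_assoc_of_third_deg_zero (C := ModuleCat.{u} H) _ _ _
    (add_zero q)).trans ?_
  rw [Abelian.Ext.mk₀_comp_mk₀]
  rfl

theorem pre_post (f : M →ₗ[H] M') (g : B →ₗ[H] B') (x : ModExt H M' B q) :
    pre f (post g x) = post g (pre f x) :=
  (Abelian.Ext.comp_assoc_of_third_deg_zero (C := ModuleCat.{u} H) _ _ _ (zero_add q)).symm

theorem pre_add (f g : M →ₗ[H] M') (x : ModExt H M' B q) :
    pre (f + g) x = pre f x + pre g x := by
  refine (congrArg (fun z => Abelian.Ext.comp z x (zero_add q))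
    (Abelian.Ext.mk₀_add (ModuleCat.ofHom f) (ModuleCat.ofHom g))).trans ?_
  exact Abelian.Ext.add_comp (C := ModuleCat.{u} H) _ _ _ _

theorem post_add (f g : B →ₗ[H] B') (x : ModExt H M B q) :
    post (f + g) x = post f x + post g x := by
  refine (congrArg (fun z => Abelian.Ext.comp x z (add_zero q))
    (Abelian.Ext.mk₀_add (ModuleCat.ofHom f) (ModuleCat.ofHom g))).trans ?_
  exact Abelian.Ext.comp_add (C := ModuleCat.{u} H) _ _ _ _

theorem pre_zero (x : ModExt H M' B q) : pre (0 : M →ₗ[H] M') x = 0 := by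
  simpa using pre_add (0 : M →ₗ[H] M') 0 x

theorem post_zero (x : ModExt H M B q) : post (0 : B →ₗ[H] B') x = 0 := by
  simpa using post_add (0 : B →ₗ[H] B') 0 x

theorem post_sum {ι : Type*} (s : Finset ι) (f : ι → B →ₗ[H] B') (x : ModExt H M B q) :
    post (∑ i ∈ s, f i) x = ∑ i ∈ s, post (f i) x := by
  classical
  induction s using Finset.induction_on with
  | empty => simp [post_zero]
  | insert a s ha ih => rw [Finset.sum_insert ha, Finset.sum_insert ha, post_add, ih]

section contravariant

variable {i : M' →ₗ[H] M} {p : M →ₗ[H] M''} (h : IsShortExact i p)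

include h in
theorem pre_exact₂ (x : ModExt H M B q) (hx : pre i x = 0) : ∃ y, pre p y = x :=
  Abelian.Ext.contravariant_sequence_exact₂ h.shortExact _ x hx

theorem pre_exact₁ (x : ModExt H M' B q) (hx : preδ h x = 0) : ∃ y, pre i y = x :=
  Abelian.Ext.contravariant_sequence_exact₁ h.shortExact _ x (add_comm 1 q) hx

theorem pre_exact₃ (x : ModExt H M'' B (q + 1)) (hx : pre p x = 0) : ∃ y, preδ h y = x :=
  Abelian.Ext.contravariant_sequence_exact₃ h.shortExact _ x hx (add_comm 1 q)

theorem preδ_pre (x : ModExt H M B q) : preδ h (pre i x) = 0 :=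
  h.shortExact.extClass_comp_assoc (h := add_comm 1 q) _

include h in
theorem pre_pre_zero (x : ModExt H M'' B q) : pre i (pre p x) = 0 := by
  rw [pre_pre, h.exact.linearMap_comp_eq_zero, pre_zero]

theorem preδ_post (g : B →ₗ[H] B') (x : ModExt H M' B q) :
    preδ h (post g x) = post g (preδ h x) :=
  (Abelian.Ext.comp_assoc_of_third_deg_zero (C := ModuleCat.{u} H) _ _ _ (add_comm 1 q)).symm

theorem preδ_naturality {N' N'' : Type u} [AddCommGroup N'] [Module H N'] [AddCommGroup N'']
    [Module H N''] {j : N' →ₗ[H] N} {r : N →ₗ[H] N''} (h' : IsShortExact j r)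
    (a : M' →ₗ[H] N') (b : M →ₗ[H] N) (c : M'' →ₗ[H] N'') (hab : b ∘ₗ i = j ∘ₗ a)
    (hbc : c ∘ₗ p = r ∘ₗ b) (x : ModExt H N' B q) :
    preδ h (pre a x) = pre c (preδ h' x) := by
  have key := ShortComplex.ShortExact.extClass_naturality h.shortExact h'.shortExact
    { τ₁ := ModuleCat.ofHom a
      τ₂ := ModuleCat.ofHom b
      τ₃ := ModuleCat.ofHom c
      comm₁₂ := by
        ext x; exact (LinearMap.congr_fun hab x).symm
      comm₂₃ := by
        ext x; exact (LinearMap.congr_fun hbc x).symm }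
  refine (Abelian.Ext.comp_assoc (C := ModuleCat.{u} H) _ _ _ (add_zero 1) (zero_add q)
    (add_comm 1 q)).symm.trans ?_
  refine Eq.trans ?_ (Abelian.Ext.comp_assoc (C := ModuleCat.{u} H) _ _ _ (zero_add 1)
    (add_comm 1 q) (by lia))
  exact congrArg (fun z => Abelian.Ext.comp z x (add_comm 1 q)) key

end contravariant

section covariant

variable {i : B' →ₗ[H] B} {p : B →ₗ[H] B''} (h : IsShortExact i p)

include h in
theorem post_exact₂ (x : ModExt H M B q) (hx : post p x = 0) : ∃ y, post i y = x :=
  Abelian.Ext.covariant_sequence_exact₂ _ h.shortExact x hx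

theorem post_exact₃ (x : ModExt H M B'' q) (hx : postδ h x = 0) : ∃ y, post p y = x :=
  Abelian.Ext.covariant_sequence_exact₃ _ h.shortExact x rfl hx

theorem post_exact₁ (x : ModExt H M B' (q + 1)) (hx : post i x = 0) : ∃ y, postδ h y = x :=
  Abelian.Ext.covariant_sequence_exact₁ _ h.shortExact x hx rfl

include h in
theorem post_zero_injective : Function.Injective (post (M := M) (q := 0) i) := by
  have : Mono (ModuleCat.ofHom i) := (ModuleCat.mono_iff_injective _).2 h.inj
  exact Abelian.Ext.postcomp_mk₀_injective_of_mono (ModuleCat.of H M) (ModuleCat.ofHom i)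

theorem pre_postδ (f : M →ₗ[H] M') (x : ModExt H M' B'' q) :
    pre f (postδ h x) = postδ h (pre f x) :=
  (Abelian.Ext.comp_assoc (C := ModuleCat.{u} H) _ _ _ (zero_add q) rfl (by lia)).symm

theorem postδ_naturality {C' C'' : Type u} [AddCommGroup C'] [Module H C'] [AddCommGroup C'']
    [Module H C''] {j : C' →ₗ[H] C} {r : C →ₗ[H] C''} (h' : IsShortExact j r)
    (a : B' →ₗ[H] C') (b : B →ₗ[H] C) (c : B'' →ₗ[H] C'') (hab : b ∘ₗ i = j ∘ₗ a)
    (hbc : c ∘ₗ p = r ∘ₗ b) (x : ModExt H M B'' q) :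
    post a (postδ h x) = postδ h' (post c x) := by
  have key := ShortComplex.ShortExact.extClass_naturality h.shortExact h'.shortExact
    { τ₁ := ModuleCat.ofHom a
      τ₂ := ModuleCat.ofHom b
      τ₃ := ModuleCat.ofHom c
      comm₁₂ := by
        ext x; exact (LinearMap.congr_fun hab x).symm
      comm₂₃ := by
        ext x; exact (LinearMap.congr_fun hbc x).symm }
  refine (Abelian.Ext.comp_assoc_of_third_deg_zero (C := ModuleCat.{u} H) _ _ _ rfl).trans ?_
  refine Eq.trans ?_
    (Abelian.Ext.comp_assoc_of_second_deg_zero (C := ModuleCat.{u} H) _ _ _ rfl).symm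
  exact congrArg (fun z => Abelian.Ext.comp x z rfl) key

end covariant

/-- `Ext` in degree zero is the group of linear maps. -/
noncomputable def homEquiv : ModExt H M B 0 ≃+ (M →ₗ[H] B) :=
  Abelian.Ext.addEquiv₀.trans
    { ModuleCat.homEquiv (M := ModuleCat.of H M) (N := ModuleCat.of H B) with
      map_add' := fun _ _ => rfl }

theorem homEquiv_pre (f : M →ₗ[H] M') (x : ModExt H M' B 0) :
    homEquiv (pre f x) = homEquiv x ∘ₗ f := by
  obtain ⟨g, rfl⟩ := homEquiv.symm.surjective x
  rw [AddEquiv.apply_symm_apply]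
  apply homEquiv.symm.injective
  rw [AddEquiv.symm_apply_apply]
  exact Abelian.Ext.mk₀_comp_mk₀ _ _

theorem homEquiv_post (f : B →ₗ[H] B') (x : ModExt H M B 0) :
    homEquiv (post f x) = f ∘ₗ homEquiv x := by
  obtain ⟨g, rfl⟩ := homEquiv.symm.surjective x
  rw [AddEquiv.apply_symm_apply]
  apply homEquiv.symm.injective
  rw [AddEquiv.symm_apply_apply]
  exact Abelian.Ext.mk₀_comp_mk₀ _ _

theorem subsingleton_of_projective [Module.Projective H M] :
    Subsingleton (ModExt H M B (q + 1)) := by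
  have : Projective (ModuleCat.of H M) := (IsProjective.iff_projective _).1 inferInstance
  exact Abelian.Ext.subsingleton_of_projective (ModuleCat.of H M) (ModuleCat.of H B) q

theorem subsingleton_of_injective [Module.Injective H B] :
    Subsingleton (ModExt H M B (q + 1)) := by
  have : Injective (ModuleCat.of H B) := Module.injective_object_of_injective_module H B
  exact Abelian.Ext.subsingleton_of_injective (ModuleCat.of H M) (ModuleCat.of H B) q

theorem subsingleton_of_preEquiv (e : M ≃ₗ[H] M') [Subsingleton (ModExt H M B q)] :
    Subsingleton (ModExt H M' B q) :=
  ⟨fun x y => by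
    rw [← pre_id x, ← pre_id y, ← e.comp_symm, ← pre_pre, ← pre_pre, Subsingleton.elim (pre _ x)]⟩

theorem subsingleton_of_postEquiv (e : B ≃ₗ[H] B') [Subsingleton (ModExt H M B q)] :
    Subsingleton (ModExt H M B' q) :=
  ⟨fun x y => by
    rw [← post_id x, ← post_id y, ← e.comp_symm, ← post_post, ← post_post,
      Subsingleton.elim (post _ x)]⟩

theorem exists_subsingleton_of_hasFiniteGlobalDimension (hgl : HasFiniteGlobalDimension H) :
    ∃ n : ℕ, ∀ (M N : Type u) [AddCommGroup M] [Module H M] [AddCommGroup N] [Module H N],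
      ∀ i : ℕ, n < i → Subsingleton (ModExt H M N i) := by
  obtain ⟨n, hn⟩ := hgl
  refine ⟨n, fun M N _ _ _ _ i hi => ?_⟩
  have h1 := hn M N i hi
  have h2 : Subsingleton (ModExt H (ULift.{u} M) (ULift.{u} N) i) := h1
  have h3 : Subsingleton (ModExt H M (ULift.{u} N) i) := subsingleton_of_preEquiv ULift.moduleEquiv
  exact subsingleton_of_postEquiv ULift.moduleEquiv

end ModExt

theorem Module.Finite.of_addMonoidHom_exact {R X Y Z : Type*} [CommRing R] [IsNoetherianRing R]
    [AddCommGroup X] [Module R X] [AddCommGroup Y] [Module R Y] [AddCommGroup Z] [Module R Z]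
    (f : X →+ Y) (g : Y →+ Z) (hf : ∀ (r : R) x, f (r • x) = r • f x)
    (hg : ∀ (r : R) x, g (r • x) = r • g x) (hfg : ∀ y, g y = 0 → ∃ x, f x = y)
    [Module.Finite R X] [Module.Finite R Z] : Module.Finite R Y := by
  let f' : X →ₗ[R] Y := { f with map_smul' := hf }
  let g' : Y →ₗ[R] Z := { g with map_smul' := hg }
  have h1 : IsNoetherian R X := inferInstance
  have h2 : IsNoetherian R Z := inferInstance
  have h3 : LinearMap.ker g' ≤ LinearMap.range f' := fun y hy => hfg y hy
  have h4 : IsNoetherian R (LinearMap.range f') := isNoetherian_of_surjective f'.rangeRestrict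
    f'.range_rangeRestrict
  have h5 : IsNoetherian R (LinearMap.ker g') := isNoetherian_of_le h3
  have h6 : IsNoetherian R Y := isNoetherian_of_range_eq_ker (LinearMap.ker g').subtype g'
    (by simp)
  infer_instance

namespace ModExt

variable {H : Type u} [Ring H]
variable {M M' M'' N : Type u} [AddCommGroup M] [Module H M] [AddCommGroup M'] [Module H M']
  [AddCommGroup M''] [Module H M''] [AddCommGroup N] [Module H N]
variable {B B' B'' C : Type u} [AddCommGroup B] [Module H B] [AddCommGroup B'] [Module H B']
  [AddCommGroup B''] [Module H B''] [AddCommGroup C] [Module H C]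
variable {q : ℕ}
variable {R : Type*} [CommRing R] [Module R M] [SMulCommClass R H M]
  [Module R M'] [SMulCommClass R H M'] [Module R M''] [SMulCommClass R H M'']

noncomputable instance instModule : Module R (ModExt H M B q) where
  smul r x := pre (Module.toModuleEnd H M r) x
  one_smul x := by
    change pre (Module.toModuleEnd H M (1 : R)) x = x
    rw [map_one]; exact pre_id x
  mul_smul r s x := by
    change pre (Module.toModuleEnd H M (r * s)) x = pre _ (pre _ x)
    rw [mul_comm, map_mul, pre_pre]; rfl
  smul_zero r := map_zero _
  smul_add r x y := map_add _ x y
  add_smul r s x := by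
    change pre (Module.toModuleEnd H M (r + s)) x = pre _ x + pre _ x
    rw [map_add, pre_add]
  zero_smul x := by
    change pre (Module.toModuleEnd H M (0 : R)) x = 0
    rw [map_zero, pre_zero]

theorem smul_eq (r : R) (x : ModExt H M B q) : r • x = pre (Module.toModuleEnd H M r) x := rfl

theorem pre_smul (f : M →ₗ[H] M') (hf : ∀ (r : R) m, f (r • m) = r • f m) (r : R)
    (x : ModExt H M' B q) : pre f (r • x) = r • pre f x := by
  rw [smul_eq, smul_eq, pre_pre, pre_pre]
  congr 1
  congr 1
  ext m
  exact (hf r m).symm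

theorem post_smul (g : B →ₗ[H] B') (r : R) (x : ModExt H M B q) :
    post g (r • x) = r • post g x :=
  (pre_post _ _ _).symm

theorem postδ_smul {i : B' →ₗ[H] B} {p : B →ₗ[H] B''} (h : IsShortExact i p) (r : R)
    (x : ModExt H M B'' q) : postδ h (r • x) = r • postδ h x :=
  (pre_postδ h _ _).symm

theorem preδ_smul {i : M' →ₗ[H] M} {p : M →ₗ[H] M''} (h : IsShortExact i p)
    (hi : ∀ (r : R) m, i (r • m) = r • i m) (hp : ∀ (r : R) m, p (r • m) = r • p m) (r : R)
    (x : ModExt H M' B q) : preδ h (r • x) = r • preδ h x := by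
  refine preδ_naturality h h (Module.toModuleEnd H M' r) (Module.toModuleEnd H M r)
    (Module.toModuleEnd H M'' r) ?_ ?_ x
  · ext m; exact (hi r m).symm
  · ext m; exact (hp r m).symm

theorem homEquiv_smul_apply (r : R) (x : ModExt H M B 0) (m : M) :
    homEquiv (r • x) m = homEquiv x (r • m) := by
  rw [smul_eq, homEquiv_pre]; rfl

/-- Postcomposition as a linear map. -/
noncomputable def postLinear (R : Type*) [CommRing R] [Module R M] [SMulCommClass R H M] (q : ℕ)
    (g : B →ₗ[H] B') : ModExt H M B q →ₗ[R] ModExt H M B' q :=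
  { post g with map_smul' := post_smul g }

@[simp]
theorem postLinear_apply (g : B →ₗ[H] B') (x : ModExt H M B q) :
    postLinear R q g x = post g x := rfl

/-- A class in `Ext` with values in a finite power is recovered from its components. -/
theorem eq_sum_post_single {n : ℕ} (x : ModExt H M (Fin n → B) q) :
    x = ∑ i, post (LinearMap.single H (fun _ => B) i) (post (LinearMap.proj i) x) := by
  classical
  simp_rw [post_post]
  rw [← post_sum]
  conv_lhs => rw [← post_id x]
  congr 1
  congr 1
  ext i b j
  simp [Pi.single_apply]

theorem smul_pi_eq_zero {n : ℕ} (r : R) (h : ∀ x : ModExt H M B q, r • x = 0)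
    (x : ModExt H M (Fin n → B) q) : r • x = 0 := by
  classical
  rw [eq_sum_post_single (r • x)]
  simp [post_smul, h]

/-- If every `Ext^q(M, H)` with `q ≥ j` is killed by an element of a submonoid, the same holds
for `Ext^q(M, B)` with `B` finitely generated. -/
theorem exists_mem_smul_eq_zero [IsNoetherianRing H] {n : ℕ}
    (hn : ∀ (M N : Type u) [AddCommGroup M] [Module H M] [AddCommGroup N] [Module H N],
      ∀ i : ℕ, n < i → Subsingleton (ModExt H M N i))
    (S : Submonoid R) {j : ℕ} (h : ∀ q, j ≤ q → ∃ r ∈ S, ∀ x : ModExt H M H q, r • x = 0)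
    (B : Type u) [AddCommGroup B] [Module H B] [Module.Finite H B] (q : ℕ) (hq : j ≤ q) :
    ∃ r ∈ S, ∀ x : ModExt H M B q, r • x = 0 := by
  obtain ⟨m, hm⟩ : ∃ m, n < q + m := ⟨n + 1, by lia⟩
  induction m generalizing q B with
  | zero =>
    have := hn M B q (by simpa using hm)
    exact ⟨1, S.one_mem, fun x => Subsingleton.elim _ _⟩
  | succ m ih =>
    obtain ⟨l, p, hp⟩ := Module.Finite.exists_fin' H B
    have hex := IsShortExact.of_surjective p hp
    obtain ⟨r₁, h₁, hr₁⟩ := ih (LinearMap.ker p) (q + 1) (by lia) (by lia)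
    obtain ⟨r₂, h₂, hr₂⟩ := h q hq
    refine ⟨r₂ * r₁, S.mul_mem h₂ h₁, fun x => ?_⟩
    obtain ⟨y, hy⟩ := post_exact₃ hex (r₁ • x) (by rw [postδ_smul, hr₁])
    rw [mul_smul, ← hy, ← post_smul, smul_pi_eq_zero r₂ hr₂, map_zero]

theorem subsingleton_of_forall [IsNoetherianRing H] {n : ℕ}
    (hn : ∀ (M N : Type u) [AddCommGroup M] [Module H M] [AddCommGroup N] [Module H N],
      ∀ i : ℕ, n < i → Subsingleton (ModExt H M N i))
    {j : ℕ} (h : ∀ q, j ≤ q → Subsingleton (ModExt H M H q))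
    (B : Type u) [AddCommGroup B] [Module H B] [Module.Finite H B] (q : ℕ) (hq : j ≤ q) :
    Subsingleton (ModExt H M B q) := by
  obtain ⟨r, hr, hr'⟩ := exists_mem_smul_eq_zero (R := ℤ) hn (M := M) ⊥ (j := j)
    (fun q hq => ⟨1, Submonoid.one_mem _, fun x => by
      have := h q hq
      exact Subsingleton.elim _ _⟩) B q hq
  obtain rfl := Submonoid.mem_bot.1 hr
  exact subsingleton_of_forall_eq 0 fun x =>
    (@one_smul ℤ _ _ (instModule.toMulAction) x).symm.trans (hr' x)

end ModExt

open Polynomial in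
theorem LinearMap.aeval_intertwine {R E E' : Type*} [CommRing R] [AddCommGroup E] [Module R E]
    [AddCommGroup E'] [Module R E'] (δ : E →ₗ[R] E') (D : Module.End R E) (D' : Module.End R E')
    (h : ∀ x, D' (δ x) = δ (D x)) (p : R[X]) (x : E) : aeval D' p (δ x) = δ (aeval D p x) := by
  induction p using Polynomial.induction_on generalizing x with
  | C a => simp [Module.algebraMap_end_apply]
  | add p r hp hr => simp [hp, hr]
  | monomial n a ih =>
    have h1 : aeval D' (C a * X ^ (n + 1)) (δ x) = aeval D' (C a * X ^ n) (D' (δ x)) := by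
      rw [pow_succ, ← mul_assoc, map_mul, Module.End.mul_apply, aeval_X]
    have h2 : aeval D (C a * X ^ (n + 1)) x = aeval D (C a * X ^ n) (D x) := by
      rw [pow_succ, ← mul_assoc, map_mul, Module.End.mul_apply, aeval_X]
    rw [h1, h, ih, h2]

open Polynomial in
theorem LinearMap.aeval_adjoint {R E Y W : Type*} [CommRing R] [AddCommGroup E] [Module R E]
    [AddCommGroup Y] [Module R Y] [AddCommGroup W] (Φ : E →+ Y →+ W) (D : Module.End R E)
    (N : Module.End R Y) (hr : ∀ (r : R) e y, Φ (r • e) y = Φ e (r • y))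
    (h : ∀ e y, Φ (D e) y = Φ e (N y)) (p : R[X]) (e : E) (y : Y) :
    Φ (aeval D p e) y = Φ e (aeval N p y) := by
  induction p using Polynomial.induction_on generalizing e y with
  | C a => simp [Module.algebraMap_end_apply, hr]
  | add p r hp hr => simp [hp, hr]
  | monomial n a ih =>
    have h1 : aeval D (C a * X ^ (n + 1)) e = aeval D (C a * X ^ n) (D e) := by
      rw [pow_succ, ← mul_assoc, map_mul, Module.End.mul_apply, aeval_X]
    have h2 : aeval N (C a * X ^ (n + 1)) y = N (aeval N (C a * X ^ n) y) := by
      rw [pow_succ, ← mul_assoc, mul_comm, map_mul, Module.End.mul_apply, aeval_X]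
    rw [h1, ih, h, h2]

/-- The left module of `k`-linear maps from a right module to a vector space. -/
def Coind (k : Type u') (U W : Type u) [Field k] [AddCommGroup U] [Module k U] [AddCommGroup W]
    [Module k W] : Type u :=
  U →ₗ[k] W

namespace Coind

variable {k : Type u'} [Field k] {H : Type u} [Ring H] [Algebra k H]
variable {U U' U'' W : Type u} [AddCommGroup U] [Module k U] [Module Hᵐᵒᵖ U]
  [IsScalarTower k Hᵐᵒᵖ U] [AddCommGroup U'] [Module k U'] [Module Hᵐᵒᵖ U']
  [IsScalarTower k Hᵐᵒᵖ U'] [AddCommGroup U''] [Module k U''] [Module Hᵐᵒᵖ U'']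
  [IsScalarTower k Hᵐᵒᵖ U''] [AddCommGroup W] [Module k W]

instance : AddCommGroup (Coind k U W) := inferInstanceAs (AddCommGroup (U →ₗ[k] W))

instance : FunLike (Coind k U W) U W := inferInstanceAs (FunLike (U →ₗ[k] W) U W)

instance : LinearMapClass (Coind k U W) k U W :=
  inferInstanceAs (LinearMapClass (U →ₗ[k] W) k U W)

@[ext]
theorem ext {f g : Coind k U W} (h : ∀ x, f x = g x) : f = g := LinearMap.ext h

instance : Module H (Coind k U W) where
  smul h f := LinearMap.comp (f : U →ₗ[k] W) (Algebra.lsmul k k U (MulOpposite.op h))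
  one_smul f := ext fun x => congrArg f (one_smul Hᵐᵒᵖ x)
  mul_smul a b f := ext fun x => congrArg f (mul_smul (MulOpposite.op b) (MulOpposite.op a) x)
  smul_zero _ := rfl
  smul_add _ _ _ := rfl
  add_smul a _ f := ext fun x => (congrArg f (add_smul (MulOpposite.op a) _ x)).trans
      (map_add f _ _)
  zero_smul f := ext fun x => (congrArg f (zero_smul Hᵐᵒᵖ x)).trans (map_zero f)

theorem smul_apply (h : H) (f : Coind k U W) (x : U) : (h • f) x = f (MulOpposite.op h • x) := rfl

theorem add_apply (f g : Coind k U W) (x : U) : (f + g) x = f x + g x := rfl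

theorem zero_apply (x : U) : (0 : Coind k U W) x = 0 := rfl

theorem sum_apply {ι : Type*} (s : Finset ι) (f : ι → Coind k U W) (x : U) :
    (∑ i ∈ s, f i) x = ∑ i ∈ s, f i x := LinearMap.sum_apply s f x

/-- A homomorphism of right modules is linear over the ground field. -/
def restrict (f : U' →ₗ[Hᵐᵒᵖ] U) : U' →ₗ[k] U := f.restrictScalars k

variable (k W) in
/-- Functoriality of coinduction. -/
def map (f : U' →ₗ[Hᵐᵒᵖ] U) : Coind k U W →ₗ[H] Coind k U' W where
  toFun φ := LinearMap.comp (φ : U →ₗ[k] W) (f.restrictScalars k)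
  map_add' _ _ := rfl
  map_smul' h φ := ext fun x => congrArg φ (map_smul f (MulOpposite.op h) x).symm

theorem map_apply (f : U' →ₗ[Hᵐᵒᵖ] U) (φ : Coind k U W) (x : U') : map k W f φ x = φ (f x) := rfl

theorem isShortExact_map {i : U' →ₗ[Hᵐᵒᵖ] U} {p : U →ₗ[Hᵐᵒᵖ] U''} (h : IsShortExact i p) :
    IsShortExact (map (H := H) k W p) (map k W i) where
  inj f g hfg := ext fun x => by
    obtain ⟨y, rfl⟩ := h.surj x
    exact congrArg (fun φ : Coind k U W => φ y) hfg
  exact φ := by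
    constructor
    · intro hφ
      have h0 : LinearMap.ker (p.restrictScalars k) ≤ LinearMap.ker (φ : U →ₗ[k] W) := by
        intro x hx
        obtain ⟨y, rfl⟩ := (h.exact x).1 hx
        exact congrArg (fun φ : Coind k U' W => φ y) hφ
      obtain ⟨s, hs⟩ := (p.restrictScalars k).exists_rightInverse_of_surjective
        (LinearMap.range_eq_top.2 h.surj)
      refine ⟨LinearMap.comp (φ : U →ₗ[k] W) s, ext fun x => ?_⟩
      have : s (p x) - x ∈ LinearMap.ker (p.restrictScalars k) := by
        rw [LinearMap.mem_ker, map_sub, sub_eq_zero]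
        exact LinearMap.congr_fun hs (p x)
      have h2 : φ (s (p x) - x) = 0 := h0 this
      rw [map_sub, sub_eq_zero] at h2
      exact h2
    · rintro ⟨ψ, rfl⟩
      exact ext fun x => (congrArg ψ (h.exact.apply_apply_eq_zero x)).trans (map_zero ψ)
  surj φ := by
    obtain ⟨s, hs⟩ := (i.restrictScalars k).exists_leftInverse_of_injective
      (LinearMap.ker_eq_bot.2 h.inj)
    exact ⟨LinearMap.comp (φ : U' →ₗ[k] W) s, ext fun x =>
      congrArg φ (LinearMap.congr_fun hs x)⟩

instance injective_pi (m : ℕ) : Module.Injective H (Coind k (Fin m → Hᵐᵒᵖ) W) where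
  out X Y _ _ _ _ f hf g := by
    let _ : Module k X := Module.compHom X (algebraMap k H)
    let _ : Module k Y := Module.compHom Y (algebraMap k H)
    have _ : IsScalarTower k H X := ⟨fun c h x => by
      rw [Algebra.smul_def, mul_smul]; rfl⟩
    have _ : IsScalarTower k H Y := ⟨fun c h x => by
      rw [Algebra.smul_def, mul_smul]; rfl⟩
    have hk : ∀ (c : k) (φ : Coind k (Fin m → Hᵐᵒᵖ) W) u,
        (algebraMap k H c • φ) u = c • φ u := fun c φ u => by
      rw [smul_apply, ← map_smul, ← MulOpposite.algebraMap_apply, algebraMap_smul]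
    let gi : Fin m → X →ₗ[k] W := fun i =>
      { toFun := fun x => g x (Pi.single i 1)
        map_add' := fun x y => by rw [map_add, add_apply]
        map_smul' := fun c x => by
          rw [← algebraMap_smul H c x, map_smul, hk]; rfl }
    obtain ⟨s, hs⟩ := (f.restrictScalars k).exists_leftInverse_of_injective
      (LinearMap.ker_eq_bot.2 hf)
    let h : Y →ₗ[H] Coind k (Fin m → Hᵐᵒᵖ) W :=
      { toFun := fun y => (({
          toFun := fun u => ∑ i, gi i (s ((u i).unop • y))
          map_add' := fun a b => by simp [add_smul, Finset.sum_add_distrib]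
          map_smul' := fun c a => by simp [Finset.smul_sum] } : (Fin m → Hᵐᵒᵖ) →ₗ[k] W) :
            Coind k (Fin m → Hᵐᵒᵖ) W)
        map_add' := fun a b => ext fun u => by
          change ∑ i, gi i (s ((u i).unop • (a + b))) =
            ∑ i, gi i (s ((u i).unop • a)) + ∑ i, gi i (s ((u i).unop • b))
          simp [smul_add, Finset.sum_add_distrib]
        map_smul' := fun c a => ext fun u => by
          change ∑ i, gi i (s ((u i).unop • (c • a))) =
            ∑ i, gi i (s (((MulOpposite.op c • u) i).unop • a))
          simp [mul_smul] }
    refine ⟨h, fun x => ext fun u => ?_⟩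
    change ∑ i, gi i (s ((u i).unop • f x)) = g x u
    have : ∀ i, gi i (s ((u i).unop • f x)) = g x (Pi.single i (u i)) := fun i => by
      rw [← map_smul]
      have : s (f ((u i).unop • x)) = (u i).unop • x := LinearMap.congr_fun hs _
      rw [this]
      change g ((u i).unop • x) (Pi.single i 1) = _
      rw [map_smul, smul_apply, MulOpposite.op_unop, ← Pi.single_smul, smul_eq_mul, mul_one]
    rw [Finset.sum_congr rfl fun i _ => this i, ← map_sum, Finset.univ_sum_single]

open Polynomial ModExt

variable {M : Type u} [AddCommGroup M] [Module H M] {R : Type*} [CommRing R] [Module R M]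
  [SMulCommClass R H M]

theorem exists_monic_zero [Module.Finite R M] [Module.Finite Hᵐᵒᵖ U] (d : U →ₗ[Hᵐᵒᵖ] U) :
    ∃ p : R[X], p.Monic ∧
      aeval (postLinear (M := M) R 0 (map (H := H) k W d)) p = 0 := by
  obtain ⟨m, s, hs⟩ := Module.Finite.exists_fin (R := Hᵐᵒᵖ) (M := U)
  have hspan : ∀ x : U, ∃ c : Fin m → Hᵐᵒᵖ, ∑ i, c i • s i = x := fun x =>
    (Submodule.mem_span_range_iff_exists_fun _).1 (hs ▸ Submodule.mem_top)
  choose c hc using fun j => hspan (d (s j))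
  have := SMulCommClass.symm R H M
  let N : Module.End R (Fin m → M) := LinearMap.pi fun i => ∑ j,
    (Module.toModuleEnd R M (c j i).unop) ∘ₗ LinearMap.proj j
  obtain ⟨p, hp, hp0⟩ := LinearMap.exists_monic_and_aeval_eq_zero R N
  refine ⟨p, hp, ?_⟩
  let Φ : ModExt H M (Coind k U W) 0 →+ (Fin m → M) →+ W :=
    { toFun := fun x =>
        { toFun := fun y => ∑ i, homEquiv x (y i) (s i)
          map_zero' := by simp [zero_apply]
          map_add' := fun a b => by simp [add_apply, Finset.sum_add_distrib] }
      map_zero' := by ext y; simp [zero_apply]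
      map_add' := fun a b => by ext y; simp [add_apply, Finset.sum_add_distrib] }
  have hΦ : ∀ x y, Φ x y = ∑ i, homEquiv x (y i) (s i) := fun _ _ => rfl
  have hinj : ∀ x, (∀ y, Φ x y = 0) → x = 0 := by
    intro x hx
    apply homEquiv.injective
    rw [map_zero]
    ext y u
    obtain ⟨a, rfl⟩ := hspan u
    rw [map_sum]
    refine (Finset.sum_eq_zero fun i _ => ?_).trans (zero_apply _).symm
    have h1 := hx (Pi.single i ((a i).unop • y))
    rw [hΦ, Finset.sum_eq_single i, Pi.single_eq_same, map_smul, smul_apply] at h1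
    · exact h1
    · intro j _ hj
      rw [Pi.single_eq_of_ne hj, map_zero, zero_apply]
    · simp
  refine LinearMap.ext fun x => hinj _ fun y => ?_
  rw [LinearMap.aeval_adjoint Φ _ N, hp0, LinearMap.zero_apply, map_zero]
  · intro r e y
    simp only [hΦ, homEquiv_smul_apply, Pi.smul_apply]
  · intro e y
    simp only [hΦ, postLinear_apply, homEquiv_post, LinearMap.comp_apply, map_apply]
    simp only [← hc, map_sum, N, LinearMap.pi_apply, LinearMap.sum_apply, LinearMap.comp_apply,
      LinearMap.proj_apply, sum_apply]
    rw [Finset.sum_comm]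
    refine Finset.sum_congr rfl fun i _ => Finset.sum_congr rfl fun j _ => ?_
    change _ = homEquiv e ((c j i).unop • y j) (s i)
    rw [map_smul (homEquiv e), smul_apply, MulOpposite.op_unop]

/-- Endomorphisms of a finitely generated right module act integrally on `Ext` into the
coinduced modules. -/
theorem exists_monic [IsNoetherianRing Hᵐᵒᵖ] [Module.Finite R M] (q : ℕ) :
    ∀ (U : Type u) [AddCommGroup U] [Module k U] [Module Hᵐᵒᵖ U] [IsScalarTower k Hᵐᵒᵖ U]
      [Module.Finite Hᵐᵒᵖ U] (d : U →ₗ[Hᵐᵒᵖ] U), ∃ p : R[X], p.Monic ∧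
      aeval (postLinear (M := M) R q (map (H := H) k W d)) p = 0 := by
  induction q with
  | zero => intro U _ _ _ _ _ d; exact exists_monic_zero d
  | succ q ih =>
    intro U _ _ _ _ _ d
    obtain ⟨m, π, hπ⟩ := Module.Finite.exists_fin' Hᵐᵒᵖ U
    obtain ⟨e, he⟩ := Module.projective_lifting_property π (d ∘ₗ π) hπ
    have he' : ∀ x, π (e x) = d (π x) := fun x => LinearMap.congr_fun he x
    let eΩ : LinearMap.ker π →ₗ[Hᵐᵒᵖ] LinearMap.ker π := e.restrict fun x hx => by
      rw [LinearMap.mem_ker, he', LinearMap.mem_ker.1 hx, map_zero]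
    obtain ⟨p, hp, hp0⟩ := ih (LinearMap.ker π) eΩ
    refine ⟨p, hp, LinearMap.ext fun x => ?_⟩
    have hex := isShortExact_map (k := k) (W := W) (IsShortExact.of_surjective π hπ)
    have := subsingleton_of_injective (M := M) (B := Coind k (Fin m → Hᵐᵒᵖ) W) (q := q) (H := H)
    obtain ⟨y, rfl⟩ := post_exact₁ hex x (Subsingleton.elim _ _)
    let δ : ModExt H M (Coind k (LinearMap.ker π) W) q →ₗ[R] ModExt H M (Coind k U W) (q + 1) :=
      { postδ hex with map_smul' := postδ_smul hex }
    refine (LinearMap.aeval_intertwine δ (postLinear R q (map (H := H) k W eΩ)) _ ?_ p y).trans ?_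
    · intro y
      refine postδ_naturality hex hex (map k W d) (map k W e) (map k W eΩ) ?_ ?_ y
      · ext φ x
        exact congrArg φ (he' x)
      · ext φ x
        rfl
    · rw [hp0]; exact map_zero δ

end Coind

/-- A module over a ring `T`, regarded as a module along a homomorphism `φ : H → T`, inherits
linearity of maps. -/
def LinearMap.alongHom {H T : Type*} [Ring H] [Ring T] (φ : H →+* T) {X Y : Type*}
    [AddCommGroup X] [Module T X] [Module H X] [AddCommGroup Y] [Module T Y] [Module H Y]
    (hX : ∀ (h : H) (x : X), φ h • x = h • x) (hY : ∀ (h : H) (y : Y), φ h • y = h • y)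
    (f : X →ₗ[T] Y) : X →ₗ[H] Y where
  toFun := f
  map_add' := f.map_add
  map_smul' h x := by rw [← hX, map_smul, hY]; rfl

/-- The action of a central element. -/
def LinearMap.centralSMul {H T : Type*} [Ring H] [Ring T] (φ : H →+* T) (X : Type*)
    [AddCommGroup X] [Module T X] [Module H X] (hX : ∀ (h : H) (x : X), φ h • x = h • x)
    (d : T) (hd : ∀ t, d * t = t * d) : X →ₗ[H] X where
  toFun x := d • x
  map_add' := smul_add d
  map_smul' h x := by
    rw [← hX, ← hX, smul_smul, hd, mul_smul]; rfl

open Polynomial in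
/-- Integrality for actions compatible with an exact sequence. -/
theorem LinearMap.aeval_mul_eq_zero_of_exact {R X Y Z : Type*} [CommRing R] [AddCommGroup X]
    [Module R X] [AddCommGroup Y] [Module R Y] [AddCommGroup Z] [Module R Z]
    (f : X →ₗ[R] Y) (g : Y →ₗ[R] Z) (hfg : ∀ y, g y = 0 → ∃ x, f x = y)
    (a : Module.End R X) (b : Module.End R Y) (c : Module.End R Z)
    (hab : ∀ x, b (f x) = f (a x)) (hbc : ∀ y, c (g y) = g (b y)) {p₁ p₂ : R[X]}
    (h₁ : aeval a p₁ = 0) (h₂ : aeval c p₂ = 0) : aeval b (p₁ * p₂) = 0 := by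
  ext y
  rw [map_mul, Module.End.mul_apply]
  obtain ⟨x, hx⟩ := hfg (aeval b p₂ y) (by
    rw [← LinearMap.aeval_intertwine g b c hbc, h₂]; rfl)
  rw [← hx, LinearMap.aeval_intertwine f a b hab, h₁, LinearMap.zero_apply, map_zero]
  rfl

namespace ModExt

variable {k : Type u'} [Field k] {H : Type u} [Ring H] [Algebra k H]

section Integral

open Polynomial

variable {T : Type u} [Ring T] [Algebra k T]
variable {M : Type u} [AddCommGroup M] [Module H M] {R : Type*} [CommRing R] [Module R M]
  [SMulCommClass R H M]

set_option maxHeartbeats 1000000 in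
/-- Central elements of a finite overring act integrally on `Ext` with values in modules over the
overring. -/
theorem exists_monic_central [IsNoetherianRing Hᵐᵒᵖ] [Module.Finite R M] (φ : H →+* T)
    [Module Hᵐᵒᵖ T] (hT : ∀ (h : H) (t : T), MulOpposite.op h • t = t * φ h)
    [IsScalarTower k Hᵐᵒᵖ T] [Module.Finite Hᵐᵒᵖ T] (d : T) (hd : ∀ t, d * t = t * d) (q : ℕ) :
    ∀ (B : Type u) [AddCommGroup B] [Module T B] [Module H B]
      (hB : ∀ (h : H) (b : B), φ h • b = h • b), ∃ p : R[X], p.Monic ∧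
      aeval (postLinear (M := M) R q (LinearMap.centralSMul φ B hB d hd)) p = 0 := by
  have hstep : ∀ q, ∀ (B : Type u) [AddCommGroup B] [Module T B] [Module H B]
      (hB : ∀ (h : H) (b : B), φ h • b = h • b),
      (∀ (C : Type u) [AddCommGroup C] [Module T C] [Module H C]
      (hC : ∀ (h : H) (b : C), φ h • b = h • b), q ≠ 0 → ∃ p : R[X], p.Monic ∧
      aeval (postLinear (M := M) R (q - 1) (LinearMap.centralSMul φ C hC d hd)) p = 0) →
      ∃ p : R[X], p.Monic ∧
      aeval (postLinear (M := M) R q (LinearMap.centralSMul φ B hB d hd)) p = 0 := by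
    intro q B _ _ _ hB ih
    let _ : Module k B := Module.compHom B (algebraMap k T)
    have hk : ∀ (x : k) (b : B), x • b = algebraMap k T x • b := fun _ _ => rfl
    let W := Coind k T B
    let ι : B →ₗ[T] W :=
      { toFun := fun b => (({
          toFun := fun t => t • b
          map_add' := fun s t => add_smul s t b
          map_smul' := fun x t => by
            rw [RingHom.id_apply, hk, Algebra.smul_def, mul_smul] } : T →ₗ[k] B) : Coind k T B)
        map_add' := fun a b => Coind.ext fun t => smul_add t a b
        map_smul' := fun s b => Coind.ext fun t => smul_smul t s b }
    have hι : ∀ b t, ι b t = t • b := fun _ _ => rfl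
    have hW : ∀ (h : H) (f : W), φ h • f = h • f := fun h f => Coind.ext fun t => by
      rw [Coind.smul_apply, Coind.smul_apply, hT]; rfl
    have hιinj : Function.Injective ι := fun a b h => by
      have := congrArg (fun f : W => f 1) h
      simpa [hι] using this
    let C := W ⧸ LinearMap.range ι
    let _ : Module H C := Module.compHom C φ
    have hC : ∀ (h : H) (b : C), φ h • b = h • b := fun _ _ => rfl
    let ιH : B →ₗ[H] W := LinearMap.alongHom φ hB hW ι
    let πH : W →ₗ[H] C := LinearMap.alongHom φ hW hC (LinearMap.range ι).mkQ
    have hex : IsShortExact ιH πH :=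
      ⟨hιinj, fun w => Submodule.Quotient.mk_eq_zero (LinearMap.range ι),
        Submodule.mkQ_surjective (LinearMap.range ι)⟩
    let dT : T →ₗ[Hᵐᵒᵖ] T :=
      { toFun := fun t => d * t
        map_add' := mul_add d
        map_smul' := fun h t => by
          obtain ⟨h, rfl⟩ := MulOpposite.op_surjective h
          change d * (MulOpposite.op h • t) = MulOpposite.op h • (d * t)
          rw [hT, hT, mul_assoc] }
    obtain ⟨p₂, hp₂, h₂⟩ := Coind.exists_monic (k := k) (M := M) (R := R) (W := B) q T dT
    have hι_comm : ∀ b, Coind.map (H := H) k B dT (ιH b) =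
        ιH (LinearMap.centralSMul φ B hB d hd b) := fun b => Coind.ext fun t => by
      change (d * t) • b = t • d • b
      rw [hd, mul_smul]
    have hπ_comm : ∀ f : W, LinearMap.centralSMul φ C hC d hd (πH f) =
        πH (Coind.map (H := H) k B dT f) := fun f => by
      have : Coind.map (H := H) k B dT f = d • f := Coind.ext fun t => by
        rw [Coind.smul_apply]
        exact congrArg f (hd t)
      rw [this]
      rfl
    have hcomm₁ : ∀ y, postLinear (M := M) R q (Coind.map (H := H) k B dT) (postLinear R q ιH y) =
        postLinear R q ιH (postLinear R q (LinearMap.centralSMul φ B hB d hd) y) := fun y => by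
      simp only [postLinear_apply, post_post]
      congr 1
      congr 1
      exact LinearMap.ext hι_comm
    obtain _ | q := q
    · refine ⟨p₂, hp₂, LinearMap.ext fun x => post_zero_injective hex ?_⟩
      refine (LinearMap.aeval_intertwine (postLinear R 0 ιH) _ _ hcomm₁ p₂ x).symm.trans ?_
      rw [h₂]
      exact (map_zero _).symm
    · obtain ⟨p₁, hp₁, h₁⟩ := ih C hC (by simp)
      refine ⟨p₁ * p₂, hp₁.mul hp₂, ?_⟩
      refine LinearMap.aeval_mul_eq_zero_of_exact
        (show ModExt H M C q →ₗ[R] ModExt H M B (q + 1) from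
          { postδ hex with map_smul' := postδ_smul hex })
        (postLinear R (q + 1) ιH) (fun y hy => post_exact₁ hex y hy) _ _ _ ?_ hcomm₁ h₁ h₂
      intro x
      refine postδ_naturality hex hex (LinearMap.centralSMul φ B hB d hd)
        (Coind.map (H := H) k B dT) (LinearMap.centralSMul φ C hC d hd) ?_ ?_ x
      · exact LinearMap.ext fun b => hι_comm b
      · exact LinearMap.ext fun b => hπ_comm b
  induction q with
  | zero => intro B _ _ _ hB; exact hstep 0 B hB fun C _ _ _ _ h => absurd rfl h
  | succ q ih => intro B _ _ _ hB; exact hstep (q + 1) B hB fun C _ _ _ hC _ => ih C hC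

end Integral

end ModExt

open Polynomial in
/-- A finitely generated submodule can be enlarged to one stable under an integral endomorphism. -/
theorem Submodule.exists_fg_stable {R E : Type*} [CommRing R] [AddCommGroup E] [Module R E]
    (D : Module.End R E) {p : R[X]} (hp : p.Monic) (hD : aeval D p = 0) (V : Submodule R E)
    (hV : V.FG) : ∃ V' : Submodule R E, V'.FG ∧ V ≤ V' ∧ (∀ v ∈ V', D v ∈ V') ∧
      ∀ D' : Module.End R E, Commute D D' → (∀ v ∈ V, D' v ∈ V) → ∀ v ∈ V', D' v ∈ V' := by
  refine ⟨⨆ i : Fin (p.natDegree + 1), V.map (D ^ (i : ℕ)), ?_, ?_, ?_, ?_⟩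
  · exact Submodule.fg_iSup _ fun i => hV.map _
  · refine le_trans ?_ (le_iSup _ 0)
    exact fun v hv => ⟨v, hv, rfl⟩
  · have h1 : ∀ i : ℕ, i < p.natDegree + 1 → ∀ v ∈ V, (D ^ i) v ∈
        ⨆ i : Fin (p.natDegree + 1), V.map (D ^ (i : ℕ)) := fun i hi v hv =>
      Submodule.mem_iSup_of_mem ⟨i, hi⟩ (Submodule.mem_map_of_mem hv)
    intro v hv
    induction hv using Submodule.iSup_induction' with
    | zero => simp
    | add x y _ _ hx hy => rw [map_add]; exact Submodule.add_mem _ hx hy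
    | mem i x hx =>
      obtain ⟨v, hv, rfl⟩ := hx
      obtain hi | hi := Nat.lt_or_ge (i : ℕ) p.natDegree
      · rw [← Module.End.mul_apply, ← pow_succ']
        exact h1 _ (by lia) v hv
      · have hi' : (i : ℕ) = p.natDegree := by lia
        have h2 : aeval D p (D v) = 0 := by rw [hD]; rfl
        rw [aeval_eq_sum_range, Finset.sum_range_succ, hp.coeff_natDegree, one_smul,
          LinearMap.add_apply, add_comm, ← eq_neg_iff_add_eq_zero, ← Module.End.mul_apply,
          ← pow_succ] at h2
        rw [hi', ← Module.End.mul_apply, ← pow_succ', h2, LinearMap.sum_apply]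
        refine Submodule.neg_mem _ (Submodule.sum_mem _ fun j hj => ?_)
        rw [LinearMap.smul_apply, ← Module.End.mul_apply, ← pow_succ]
        exact Submodule.smul_mem _ _ (h1 _ (by have := Finset.mem_range.1 hj; lia) v hv)
  · intro D' hDD' hV' v hv
    induction hv using Submodule.iSup_induction' with
    | zero => simp
    | add x y _ _ hx hy => rw [map_add]; exact Submodule.add_mem _ hx hy
    | mem i x hx =>
      obtain ⟨v, hv, rfl⟩ := hx
      refine Submodule.mem_iSup_of_mem i ⟨D' v, hV' v hv, ?_⟩
      rw [← Module.End.mul_apply, ← Module.End.mul_apply, (hDD'.pow_left _).eq]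

theorem Submodule.exists_fg_stable_family {R E : Type*} [CommRing R] [AddCommGroup E] [Module R E]
    {g : ℕ} (D : Fin g → Module.End R E) (hD : ∀ i, ∃ p : Polynomial R, p.Monic ∧
      Polynomial.aeval (D i) p = 0) (hcomm : ∀ i j, Commute (D i) (D j)) (V : Submodule R E)
    (hV : V.FG) : ∃ V' : Submodule R E, V'.FG ∧ V ≤ V' ∧ ∀ i, ∀ v ∈ V', D i v ∈ V' := by
  suffices ∀ s : Finset (Fin g), ∃ V' : Submodule R E, V'.FG ∧ V ≤ V' ∧
      ∀ i ∈ s, ∀ v ∈ V', D i v ∈ V' by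
    obtain ⟨V', h1, h2, h3⟩ := this Finset.univ
    exact ⟨V', h1, h2, fun i => h3 i (Finset.mem_univ i)⟩
  intro s
  induction s using Finset.induction_on with
  | empty => exact ⟨V, hV, le_rfl, by simp⟩
  | insert a s _ ih =>
    obtain ⟨V', h1, h2, h3⟩ := ih
    obtain ⟨p, hp, hp0⟩ := hD a
    obtain ⟨V'', k1, k2, k3, k4⟩ := exists_fg_stable (D a) hp hp0 V' h1
    refine ⟨V'', k1, h2.trans k2, fun i hi => ?_⟩
    obtain rfl | hi := Finset.mem_insert.1 hi
    · exact k3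
    · exact k4 _ (hcomm a i) (h3 i hi)

namespace ModExt

variable {H : Type u} [Ring H]

/-- The action on `Ext` through the second variable. -/
noncomputable abbrev postModule (S : Type*) [CommRing S] {M B : Type u} [AddCommGroup M]
    [Module H M]
    [AddCommGroup B] [Module H B] [Module S B] [SMulCommClass S H B] (q : ℕ) :
    Module S (ModExt H M B q) where
  smul s x := post (Module.toModuleEnd H B s) x
  one_smul x := by
    change post (Module.toModuleEnd H B (1 : S)) x = x
    rw [map_one]; exact post_id x
  mul_smul r s x := by
    change post (Module.toModuleEnd H B (r * s)) x = post _ (post _ x)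
    rw [map_mul, post_post]; rfl
  smul_zero r := map_zero _
  smul_add r x y := map_add _ x y
  add_smul r s x := by
    change post (Module.toModuleEnd H B (r + s)) x = post _ x + post _ x
    rw [map_add, post_add]
  zero_smul x := by
    change post (Module.toModuleEnd H B (0 : S)) x = 0
    rw [map_zero, post_zero]

theorem finite_postModule [IsNoetherianRing H] (S : Type*) [CommRing S] [IsNoetherianRing S]
    (B : Type u) [AddCommGroup B] [Module H B] [Module S B] [SMulCommClass S H B]
    [Module.Finite S B] (q : ℕ) (M : Type u) [AddCommGroup M] [Module H M] [Module.Finite H M] :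
    let _ : Module S (ModExt H M B q) := postModule S q
    Module.Finite S (ModExt H M B q) := by
  induction q generalizing M with
  | zero =>
    intro _
    obtain ⟨n, s, hs⟩ := Module.Finite.exists_fin (R := H) (M := M)
    let f : ModExt H M B 0 →ₗ[S] (Fin n → B) :=
      { toFun := fun x i => homEquiv x (s i)
        map_add' := fun x y => by ext i; simp
        map_smul' := fun r x => by
          ext i
          change homEquiv (post _ x) (s i) = _
          rw [homEquiv_post]; rfl }
    refine Module.Finite.of_injective f fun x y hxy => homEquiv.injective ?_
    refine LinearMap.ext_on_range hs fun i => congrFun hxy i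
  | succ q ih =>
    intro _
    obtain ⟨n, p, hp⟩ := Module.Finite.exists_fin' H M
    have hex := IsShortExact.of_surjective p hp
    have hF : Subsingleton (ModExt H (Fin n → H) B (q + 1)) := subsingleton_of_projective
    let _ : Module S (ModExt H (LinearMap.ker p) B q) := postModule S q
    have := ih (LinearMap.ker p)
    let f : ModExt H (LinearMap.ker p) B q →ₗ[S] ModExt H M B (q + 1) :=
      { preδ hex with map_smul' := fun r x => preδ_post hex _ x }
    exact Module.Finite.of_surjective f fun x => pre_exact₃ hex x (Subsingleton.elim _ _)

/-- Central elements act in the same way through both variables of `Ext`. -/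
theorem pre_central_eq_post_central (z : H) (hz : ∀ t, z * t = t * z) {B : Type u}
    [AddCommGroup B] [Module H B] (q : ℕ) (M : Type u) [AddCommGroup M] [Module H M]
    (x : ModExt H M B q) :
    pre (LinearMap.centralSMul (RingHom.id H) M (fun _ _ => rfl) z hz) x =
      post (LinearMap.centralSMul (RingHom.id H) B (fun _ _ => rfl) z hz) x := by
  induction q generalizing M with
  | zero =>
    apply homEquiv.injective
    rw [homEquiv_pre, homEquiv_post]
    ext m
    exact map_smul (homEquiv x) z m
  | succ q ih =>
    have hp : Function.Surjective (Finsupp.linearCombination H (id : M → M)) :=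
      Finsupp.linearCombination_id_surjective H M
    have hex := IsShortExact.of_surjective _ hp
    have hF : Subsingleton (ModExt H (M →₀ H) B (q + 1)) := subsingleton_of_projective
    obtain ⟨y, rfl⟩ := pre_exact₃ hex x (Subsingleton.elim _ _)
    rw [← preδ_post, ← ih]
    symm
    refine preδ_naturality hex hex _
      (LinearMap.centralSMul (RingHom.id H) (M →₀ H) (fun _ _ => rfl) z hz) _ ?_ ?_ y
    · rfl
    · exact LinearMap.ext fun m =>
        (map_smul (Finsupp.linearCombination H (id : M → M)) z m).symm

theorem finite_of_overring {k : Type u'} [Field k] [Algebra k H] [IsNoetherianRing H]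
    [IsNoetherianRing Hᵐᵒᵖ] {M : Type u} [AddCommGroup M] [Module H M] [Module.Finite H M]
    {R : Type*} [CommRing R] [Algebra k R] [Module R M] [SMulCommClass R H M]
    [Module.Finite R M] (hk : ∀ (x : k) (m : M), algebraMap k R x • m = algebraMap k H x • m)
    {T : Type u} [Ring T] {g : ℕ} [Algebra (MvPolynomial (Fin g) k) T] (φ : H →+* T)
    (hφ : ∀ x, φ (algebraMap k H x) = algebraMap _ T (MvPolynomial.C x : MvPolynomial (Fin g) k))
    [Module Hᵐᵒᵖ T] (hT : ∀ (h : H) (t : T), MulOpposite.op h • t = t * φ h)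
    [Module.Finite Hᵐᵒᵖ T] (B : Type u) [AddCommGroup B] [Module T B] [Module H B]
    (hB : ∀ (h : H) (b : B), φ h • b = h • b) [Module (MvPolynomial (Fin g) k) B]
    [IsScalarTower (MvPolynomial (Fin g) k) T B] [Module.Finite (MvPolynomial (Fin g) k) B]
    (q : ℕ) : Module.Finite R (ModExt H M B q) := by
  let S := MvPolynomial (Fin g) k
  let _ : Algebra k T := ((algebraMap S T).comp (algebraMap k S)).toAlgebra' fun x t =>
    Algebra.commutes _ t
  have : IsScalarTower k Hᵐᵒᵖ T := ⟨fun x h t => by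
    obtain ⟨h, rfl⟩ := MulOpposite.op_surjective h
    rw [← MulOpposite.op_smul, hT, hT, Algebra.smul_def, map_mul, hφ, Algebra.smul_def,
      ← mul_assoc, ← mul_assoc, ← Algebra.commutes]; rfl⟩
  have hsm : ∀ (s : S) (b : B), s • b = algebraMap S T s • b := fun s b =>
    (algebraMap_smul T s b).symm
  have : SMulCommClass S H B := ⟨fun s h b => by
    rw [hsm, hsm, ← hB, ← hB, smul_smul, smul_smul, Algebra.commutes]⟩
  let D : S → Module.End R (ModExt H M B q) := fun s =>
    postLinear R q (Module.toModuleEnd H B s)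
  have hD : ∀ i, ∃ p : Polynomial R, p.Monic ∧ Polynomial.aeval (D (MvPolynomial.X i)) p = 0 := by
    intro i
    obtain ⟨p, hp, hp0⟩ := exists_monic_central (k := k) (M := M) (R := R) φ hT
      (algebraMap S T (MvPolynomial.X i)) (Algebra.commutes _) q B hB
    refine ⟨p, hp, ?_⟩
    convert hp0 using 4
    ext b
    exact hsm _ b
  have hDmul : ∀ s t, D (s * t) = D s * D t := fun s t => by
    ext x
    change post _ x = post _ (post _ x)
    rw [post_post, map_mul]; rfl
  have hDadd : ∀ s t, D (s + t) = D s + D t := fun s t => by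
    ext x
    change post _ x = post _ x + post _ x
    rw [map_add, post_add]
  have hDC : ∀ (x : k) y, D (MvPolynomial.C x) y = algebraMap k R x • y := fun x y => by
    have hz : ∀ t, algebraMap k H x * t = t * algebraMap k H x := Algebra.commutes x
    refine Eq.trans ?_ ((pre_central_eq_post_central (algebraMap k H x) hz q M y).symm.trans ?_)
    · change post _ y = post _ y
      congr 1
      congr 1
      ext b
      exact (hsm _ b).trans ((congrArg (· • b) (hφ x)).symm.trans (hB _ b))
    · rw [smul_eq]
      congr 1
      congr 1
      ext m
      exact (hk x m).symm
  let _ : Module S (ModExt H M B q) := postModule S q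
  obtain ⟨n, s, hs⟩ := (finite_postModule (H := H) S B q M).exists_fin
  obtain ⟨V, hV, hsV, hst⟩ := Submodule.exists_fg_stable_family (fun i => D (MvPolynomial.X i)) hD
    (fun i j => by rw [Commute, SemiconjBy, ← hDmul, mul_comm, hDmul])
    (Submodule.span R (Set.range s)) (Submodule.fg_span (Set.finite_range s))
  have hstab : ∀ (r : S) (v), v ∈ V → r • v ∈ V := by
    intro r
    induction r using MvPolynomial.induction_on with
    | C x =>
      intro v hv
      have := V.smul_mem (algebraMap k R x) hv
      rw [← hDC] at this
      exact this
    | add a b ha hb => intro v hv; rw [add_smul]; exact V.add_mem (ha v hv) (hb v hv)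
    | mul_X a i ha => intro v hv; rw [mul_smul]; exact ha _ (hst i v hv)
  refine ⟨?_⟩
  convert hV
  symm
  rw [eq_top_iff]
  intro x _
  have hx : x ∈ Submodule.span S (Set.range s) := hs ▸ Submodule.mem_top
  induction hx using Submodule.span_induction with
  | mem x h => exact hsV (Submodule.subset_span h)
  | zero => exact V.zero_mem
  | add x y _ _ hx hy => exact V.add_mem (hx trivial) (hy trivial)
  | smul r x _ hx => exact hstab r x (hx trivial)

end ModExt

/-- A finite torsion-free overring of a quotient `H / P`, containing the quotient up to a
denominator `c`. -/
structure Overring (k : Type u') [Field k] (H : Type u) [Ring H] [Algebra k H] (P : Ideal H)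
    (g : ℕ) (T : Type u) [Ring T] [Algebra (MvPolynomial (Fin g) k) T] where
  φ : H →+* T
  map_eq_zero : ∀ h, φ h = 0 ↔ h ∈ P
  map_algebraMap : ∀ x, φ (algebraMap k H x) =
    algebraMap _ T (MvPolynomial.C x : MvPolynomial (Fin g) k)
  finite : Module.Finite (MvPolynomial (Fin g) k) T
  torsionFree : ∀ (r : MvPolynomial (Fin g) k) (t : T), r • t = 0 → r = 0 ∨ t = 0
  c : MvPolynomial (Fin g) k
  c_ne_zero : c ≠ 0
  σ : T → H
  map_σ : ∀ t, φ (σ t) = c • t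

/-- An ideal which is prime in the noncommutative sense. -/
structure Ideal.IsPrimeTwoSided {H : Type u} [Ring H] (P : Ideal H) : Prop where
  twoSided : P.IsTwoSided
  ne_top : P ≠ ⊤
  mem_or_mem : ∀ a b, (∀ x, a * x * b ∈ P) → a ∈ P ∨ b ∈ P

theorem Ideal.IsPrimeTwoSided.exists_overring {k : Type u'} {H : Type u} [Field k] [Ring H]
    [IsNoetherianRing H] [Algebra k H] [Algebra.FiniteType k H]
    {D : ℕ} {α : Equiv.Perm (Fin D) → k} (hα : MultilinearIdentity k H α) (h1 : α 1 = 1)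
    {P : Ideal H} (hP : P.IsPrimeTwoSided) :
    ∃ (g : ℕ) (T : Type u) (_ : Ring T) (_ : Algebra (MvPolynomial (Fin g) k) T),
      Nonempty (Overring k H P g T) := by
  have := hP.twoSided
  let A := H ⧸ P
  let _ : Algebra k A := ((Ideal.Quotient.mk P).comp (algebraMap k H)).toAlgebra' fun x t => by
    obtain ⟨t, rfl⟩ := Ideal.Quotient.mk_surjective t
    rw [RingHom.comp_apply, ← map_mul, Algebra.commutes, map_mul]
  let π : H →ₐ[k] A := { Ideal.Quotient.mk P with commutes' := fun _ => rfl }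
  have hπ : Function.Surjective π := Ideal.Quotient.mk_surjective
  have : Nontrivial A := Ideal.Quotient.nontrivial_iff.2 hP.ne_top
  have : IsNoetherianRing A := isNoetherianRing_of_surjective H A π.toRingHom hπ
  have : Algebra.FiniteType k A := Algebra.FiniteType.of_surjective π hπ
  have hA : IsPrimeRing A := by
    intro a b hab
    obtain ⟨a, rfl⟩ := hπ a
    obtain ⟨b, rfl⟩ := hπ b
    refine (hP.mem_or_mem a b fun x => ?_).imp Ideal.Quotient.eq_zero_iff_mem.2
      Ideal.Quotient.eq_zero_iff_mem.2
    exact Ideal.Quotient.eq_zero_iff_mem.1 ((by simp [π] :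
      Ideal.Quotient.mk P (a * x * b) = π a * π x * π b).trans (hab _))
  have hαA : MultilinearIdentity k A α := fun z => by
    choose y hy using fun i => hπ (z i)
    have h2 := congrArg π (hα y)
    rw [map_sum, map_zero] at h2
    rw [← h2]
    refine Finset.sum_congr rfl fun τ _ => ?_
    refine (Algebra.smul_def (α τ) _).trans ?_
    rw [Algebra.smul_def, map_mul, map_list_prod, List.map_ofFn]
    simp only [Function.comp_def, hy]
    rfl
  obtain ⟨g, T, _, _, φ, c, hφ, hφk, hfin, htf, hc, hcT⟩ := hA.exists_finite_extension hαA h1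
  choose σ hσ using fun t => (hcT t).imp fun _ h => h
  choose τ hτ using fun t => hπ (σ t)
  refine ⟨g, T, inferInstance, inferInstance, ⟨{
    φ := φ.comp π.toRingHom
    map_eq_zero := fun h => ?_
    map_algebraMap := fun x => ?_
    finite := hfin
    torsionFree := htf
    c := c
    c_ne_zero := hc
    σ := τ
    map_σ := fun t => ?_ }⟩⟩
  · exact (map_eq_zero_iff φ hφ).trans Ideal.Quotient.eq_zero_iff_mem
  · exact (congrArg φ (π.commutes x)).trans (hφk x)
  · exact (congrArg φ (hτ t)).trans (hσ t)

namespace Overring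

variable {k : Type u'} [Field k] {H : Type u} [Ring H] [Algebra k H] {P : Ideal H} {g : ℕ}
  {T : Type u} [Ring T] [Algebra (MvPolynomial (Fin g) k) T] (O : Overring k H P g T)

/-- The right action of `H` on an overring. -/
abbrev rightModule : Module Hᵐᵒᵖ T := Module.compHom T (RingHom.op O.φ)

include O in
theorem noZeroSMul (r : MvPolynomial (Fin g) k) (hr : r ≠ 0) {s t : T} (h : r • s = r • t) :
    s = t :=
  sub_eq_zero.1 ((O.torsionFree r (s - t) (by rw [smul_sub, h, sub_self])).resolve_left hr)

theorem finite_rightModule [IsNoetherianRing Hᵐᵒᵖ] :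
    let _ := O.rightModule
    Module.Finite Hᵐᵒᵖ T := by
  intro _
  have hT : ∀ (h : Hᵐᵒᵖ) (t : T), h • t = t * O.φ h.unop := fun _ _ => rfl
  let f : Hᵐᵒᵖ →ₗ[Hᵐᵒᵖ] T :=
    { toFun := fun h => O.φ h.unop
      map_add' := fun a b => map_add O.φ _ _
      map_smul' := fun a b => map_mul O.φ _ _ }
  let m : T →ₗ[Hᵐᵒᵖ] LinearMap.range f := LinearMap.codRestrict (LinearMap.range f)
    { toFun := fun t => O.c • t
      map_add' := smul_add _
      map_smul' := fun h t => by
        rw [RingHom.id_apply, hT, hT, smul_mul_assoc] }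
    fun t => ⟨MulOpposite.op (O.σ t), O.map_σ t⟩
  have : IsNoetherian Hᵐᵒᵖ (LinearMap.range f) := isNoetherian_of_surjective f.rangeRestrict
    f.range_rangeRestrict
  have := isNoetherian_of_injective m fun s t h =>
    O.noZeroSMul O.c O.c_ne_zero (congrArg Subtype.val h)
  infer_instance

/-- The left action of `H` on an overring. -/
abbrev leftModule : Module H T := Module.compHom T O.φ

theorem finite_leftModule [IsNoetherianRing H] :
    let _ := O.leftModule
    Module.Finite H T := by
  intro _
  have hT : ∀ (h : H) (t : T), h • t = O.φ h * t := fun _ _ => rfl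
  let f : H →ₗ[H] T :=
    { toFun := fun h => O.φ h
      map_add' := fun a b => map_add O.φ _ _
      map_smul' := fun a b => map_mul O.φ _ _ }
  let m : T →ₗ[H] LinearMap.range f := LinearMap.codRestrict (LinearMap.range f)
    { toFun := fun t => O.c • t
      map_add' := smul_add _
      map_smul' := fun h t => by
        rw [RingHom.id_apply, hT, hT, mul_smul_comm] }
    fun t => ⟨O.σ t, O.map_σ t⟩
  have : IsNoetherian H (LinearMap.range f) := isNoetherian_of_surjective f.rangeRestrict
    f.range_rangeRestrict
  have := isNoetherian_of_injective m fun s t h =>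
    O.noZeroSMul O.c O.c_ne_zero (congrArg Subtype.val h)
  infer_instance

theorem sub_mem_of_eq {a b : H} (h : O.φ a = O.φ b) : a - b ∈ P := by
  rw [← O.map_eq_zero, map_sub, h, sub_self]

include O in
theorem nontrivial (hP : P ≠ ⊤) : Nontrivial T :=
  ⟨1, 0, fun h => hP ((Ideal.eq_top_iff_one P).2 ((O.map_eq_zero 1).1 (by rw [map_one, h])))⟩

theorem σ_one_notMem [Nontrivial T] : O.σ 1 ∉ P := fun h => by
  rw [← O.map_eq_zero, O.map_σ] at h
  exact (O.torsionFree _ _ h).elim O.c_ne_zero one_ne_zero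

end Overring

namespace ModExt

variable {k : Type u'} [Field k] {H : Type u} [Ring H] [Algebra k H]

theorem finite_of_isShortExact {M : Type u} [AddCommGroup M] [Module H M] {R : Type*} [CommRing R]
    [IsNoetherianRing R] [Module R M] [SMulCommClass R H M] {B' B B'' : Type u} [AddCommGroup B']
    [Module H B'] [AddCommGroup B] [Module H B] [AddCommGroup B''] [Module H B'']
    {i : B' →ₗ[H] B} {p : B →ₗ[H] B''} (h : IsShortExact i p) {q : ℕ}
    (h₁ : Module.Finite R (ModExt H M B' q)) (h₂ : Module.Finite R (ModExt H M B'' q)) :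
    Module.Finite R (ModExt H M B q) :=
  Module.Finite.of_addMonoidHom_exact (post i) (post p) (post_smul i) (post_smul p)
    (post_exact₂ h)

/-- If kernel and cokernel of `f : B₁ → B₂` have finite `Ext` groups, finiteness passes from
`B₁` to `B₂`. -/
theorem finite_of_ker_of_coker {M : Type u} [AddCommGroup M] [Module H M] {R : Type*} [CommRing R]
    [IsNoetherianRing R] [Module R M] [SMulCommClass R H M] {B₁ B₂ : Type u} [AddCommGroup B₁]
    [Module H B₁] [AddCommGroup B₂] [Module H B₂] (f : B₁ →ₗ[H] B₂)
    (h₁ : ∀ q, Module.Finite R (ModExt H M B₁ q))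
    (hk : ∀ q, Module.Finite R (ModExt H M (LinearMap.ker f) q))
    (hc : ∀ q, Module.Finite R (ModExt H M (B₂ ⧸ LinearMap.range f) q)) (q : ℕ) :
    Module.Finite R (ModExt H M B₂ q) := by
  refine finite_of_isShortExact (IsShortExact.of_submodule (LinearMap.range f)) ?_ (hc q)
  have hex : IsShortExact (LinearMap.ker f).subtype f.rangeRestrict :=
    ⟨Subtype.val_injective, fun x => by
      simp [Subtype.ext_iff], f.surjective_rangeRestrict⟩
  have h1 := h₁ q
  have h2 := hk (q + 1)
  exact Module.Finite.of_addMonoidHom_exact (post f.rangeRestrict) (postδ hex)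
    (post_smul _) (postδ_smul hex) (post_exact₃ hex)

end ModExt

namespace ModExt

variable {k : Type u'} [Field k] {H : Type u} [Ring H] [Algebra k H]

set_option maxHeartbeats 1000000 in
theorem finite_of_prime_killing [IsNoetherianRing H] [IsNoetherianRing Hᵐᵒᵖ] {M : Type u}
    [AddCommGroup M] [Module H M] [Module.Finite H M]
    {R : Type*} [CommRing R] [IsNoetherianRing R] [Algebra k R] [Module R M] [SMulCommClass R H M]
    [Module.Finite R M] (hk : ∀ (x : k) (m : M), algebraMap k R x • m = algebraMap k H x • m)
    {P : Ideal H} {g : ℕ} {T : Type u} [Ring T] [Algebra (MvPolynomial (Fin g) k) T]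
    (O : Overring k H P g T) (B : Type u) [AddCommGroup B] [Module H B] [Module.Finite H B]
    (hB : ∀ h ∈ P, ∀ b : B, h • b = 0)
    (ih : ∀ (B' : Type u) [AddCommGroup B'] [Module H B'] [Module.Finite H B'],
      (∀ h ∈ P, ∀ b : B', h • b = 0) → (∀ b : B', O.σ 1 • b = 0) →
      ∀ q, Module.Finite R (ModExt H M B' q)) (q : ℕ) :
    Module.Finite R (ModExt H M B q) := by
  obtain ⟨n, p, hp⟩ := Module.Finite.exists_fin' H B
  have hcongr : ∀ {a a' : H} (b : B), O.φ a = O.φ a' → a • b = a' • b := fun b h => by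
    rw [← sub_eq_zero, ← sub_smul]
    exact hB _ (O.sub_mem_of_eq h) b
  let _ : Module H T := O.leftModule
  let F := Fin n → T
  have hF : ∀ (h : H) (t : F), h • t = O.φ h • t := fun _ _ => rfl
  let b : Fin n → B := fun i => p (Pi.single i 1)
  let ψ : F →ₗ[H] B :=
    { toFun := fun t => ∑ i, O.σ (t i) • b i
      map_add' := fun s t => by
        rw [← Finset.sum_add_distrib]
        refine Finset.sum_congr rfl fun i _ => ?_
        rw [← add_smul]
        refine hcongr _ ?_
        rw [map_add, O.map_σ, O.map_σ, O.map_σ, Pi.add_apply, smul_add]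
      map_smul' := fun h t => by
        rw [RingHom.id_apply, Finset.smul_sum]
        refine Finset.sum_congr rfl fun i _ => ?_
        rw [← mul_smul]
        refine hcongr _ ?_
        rw [map_mul, O.map_σ, O.map_σ, hF, Pi.smul_apply, smul_eq_mul, mul_smul_comm] }
  have hψ : ∀ t, ψ t = ∑ i, O.σ (t i) • b i := fun _ => rfl
  let N : Submodule T F :=
    { carrier := {t | ∀ s : T, ψ (s • t) = 0}
      add_mem' := fun {x y} hx hy s => by rw [smul_add, map_add, hx, hy, add_zero]
      zero_mem' := fun s => by rw [smul_zero, map_zero]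
      smul_mem' := fun r x hx s => by rw [smul_smul]; exact hx _ }
  have hN : ∀ t ∈ N, ψ t = 0 := fun t ht => by
    have := ht 1
    rwa [one_smul] at this
  let B₁ := F ⧸ N
  let _ : Module H B₁ := Module.compHom B₁ O.φ
  have hB₁ : ∀ (h : H) (x : B₁), O.φ h • x = h • x := fun _ _ => rfl
  let f : B₁ →ₗ[H] B :=
    { QuotientAddGroup.lift N.toAddSubgroup ψ.toAddMonoidHom hN with
      map_smul' := fun h x => by
        obtain ⟨x, rfl⟩ := N.mkQ_surjective x
        exact map_smul ψ h x }
  have hf : ∀ x : F, f (N.mkQ x) = ψ x := fun _ => rfl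
  let _ := O.rightModule
  have := O.finite_rightModule
  have := O.finite
  have : Module.Finite H T := O.finite_leftModule
  have : Module.Finite H F := inferInstance
  have : Module.Finite H B₁ := Module.Finite.of_surjective
    (LinearMap.alongHom O.φ (fun _ _ => rfl) hB₁ N.mkQ) N.mkQ_surjective
  have hkey : ∀ t, ψ t = 0 → O.φ (O.σ 1) • t ∈ N := fun t ht s => by
    have : ψ (s • O.φ (O.σ 1) • t) = O.σ s • ψ t := by
      rw [hψ, hψ, Finset.smul_sum]
      refine Finset.sum_congr rfl fun i _ => ?_
      refine (hcongr _ ?_).trans (mul_smul _ _ _)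
      rw [map_mul, O.map_σ, O.map_σ, O.map_σ, Pi.smul_apply, Pi.smul_apply, smul_eq_mul,
        smul_eq_mul, O.map_σ, smul_mul_assoc, one_mul, smul_mul_assoc, mul_smul_comm]
    rw [this, ht, smul_zero]
  refine finite_of_ker_of_coker f (fun q => ?_) ?_ ?_ q
  · have : Module.Finite (MvPolynomial (Fin g) k) B₁ := inferInstance
    exact finite_of_overring hk O.φ O.map_algebraMap (fun _ _ => rfl) B₁ hB₁ q
  · refine ih (LinearMap.ker f) (fun h hh x => ?_) (fun x => ?_)
    · rw [Subtype.ext_iff]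
      change h • (x : B₁) = 0
      rw [← hB₁, (O.map_eq_zero h).2 hh, zero_smul]
    · rw [Subtype.ext_iff]
      obtain ⟨x, hx⟩ := x
      obtain ⟨x, rfl⟩ := N.mkQ_surjective x
      exact (Submodule.Quotient.mk_eq_zero N).2 (hkey x hx)
  · refine ih (B ⧸ LinearMap.range f) (fun h hh x => ?_) (fun x => ?_)
    · obtain ⟨x, rfl⟩ := Submodule.mkQ_surjective _ x
      rw [← map_smul, hB h hh, map_zero]
    · obtain ⟨x, rfl⟩ := Submodule.mkQ_surjective _ x
      obtain ⟨a, rfl⟩ := hp x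
      rw [← map_smul, Submodule.mkQ_apply, Submodule.Quotient.mk_eq_zero]
      refine ⟨N.mkQ fun i => O.φ (a i), ?_⟩
      rw [hf, hψ]
      have ha : a = ∑ i, a i • Pi.single i (1 : H) := by
        ext j; simp [Pi.single_apply]
      conv_rhs => rw [ha, map_sum, Finset.smul_sum]
      refine Finset.sum_congr rfl fun i _ => ?_
      rw [map_smul, ← mul_smul]
      refine hcongr _ ?_
      rw [map_mul, O.map_σ, O.map_σ, smul_mul_assoc, one_mul]

/-- `Ext` groups of finitely generated modules over a noetherian affine PI algebra are finitely
generated over any commutative ring acting on the first variable and over which it is finite. -/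
theorem finite [IsNoetherianRing H] [IsNoetherianRing Hᵐᵒᵖ] [Algebra.FiniteType k H]
    {D : ℕ} {α : Equiv.Perm (Fin D) → k} (hα : MultilinearIdentity k H α) (h1 : α 1 = 1)
    {M : Type u} [AddCommGroup M] [Module H M] [Module.Finite H M]
    {R : Type*} [CommRing R] [IsNoetherianRing R] [Algebra k R] [Module R M] [SMulCommClass R H M]
    [Module.Finite R M] (hk : ∀ (x : k) (m : M), algebraMap k R x • m = algebraMap k H x • m)
    (B : Type u) [AddCommGroup B] [Module H B] [Module.Finite H B] (q : ℕ) :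
    Module.Finite R (ModExt H M B q) := by
  suffices ∀ (I : Ideal H) (B : Type u) [AddCommGroup B] [Module H B] [Module.Finite H B],
      I ≤ Module.annihilator H B → ∀ q, Module.Finite R (ModExt H M B q) from
    this _ B le_rfl q
  intro I
  induction I using WellFoundedGT.induction with
  | ind I ih' =>
  intro B _ _ _ hIB
  have ih : ∀ (B' : Type u) [AddCommGroup B'] [Module H B'] [Module.Finite H B'] (a : H),
      (∀ h ∈ Module.annihilator H B, ∀ b : B', h • b = 0) → a ∉ Module.annihilator H B →
      (∀ b : B', a • b = 0) → ∀ q, Module.Finite R (ModExt H M B' q) := by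
    intro B' _ _ _ a h1 ha h2
    refine ih' (Module.annihilator H B') ?_ B' le_rfl
    refine lt_of_le_of_lt hIB ((lt_of_le_of_ne fun h hh => Module.mem_annihilator.2 (h1 h hh)) ?_)
    rintro h
    rw [h] at ha
    exact ha (Module.mem_annihilator.2 h2)
  by_cases htop : Module.annihilator H B = ⊤
  · have : Subsingleton B := Module.annihilator_eq_top_iff.1 htop
    have : Module.Injective H B := ⟨fun X Y _ _ _ _ f hf g => ⟨0, fun x => Subsingleton.elim _ _⟩⟩
    intro q
    have : Subsingleton (ModExt H M B q) := subsingleton_of_forall_eq 0 fun x => by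
      rw [← post_id x, Subsingleton.elim (LinearMap.id : B →ₗ[H] B) 0, post_zero]
    infer_instance
  by_cases hprime : ∀ a b, (∀ x, a * x * b ∈ Module.annihilator H B) →
      a ∈ Module.annihilator H B ∨ b ∈ Module.annihilator H B
  · have hP : (Module.annihilator H B).IsPrimeTwoSided := ⟨inferInstance, htop, hprime⟩
    obtain ⟨g, T, _, _, ⟨O⟩⟩ := hP.exists_overring hα h1
    refine finite_of_prime_killing hk O B (fun h hh => Module.mem_annihilator.1 hh) ?_
    intro B' _ _ _ h1 h2
    have := O.nontrivial htop
    exact ih B' (O.σ 1) h1 O.σ_one_notMem h2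
  · push Not at hprime
    obtain ⟨a, b, hab, ha, hb⟩ := hprime
    intro q
    let B₁ : Submodule H B := Submodule.span H (Set.range fun x : B => b • x)
    refine finite_of_isShortExact (IsShortExact.of_submodule B₁)
      (ih B₁ a (fun h hh x => Subtype.ext (Module.mem_annihilator.1 hh x)) ha (fun x => ?_) q)
      (ih (B ⧸ B₁) b (fun h hh x => ?_) hb (fun x => ?_) q)
    · obtain ⟨x, hx⟩ := x
      refine Subtype.ext ?_
      change a • x = 0
      suffices ∀ h : H, a • h • x = 0 by simpa using this 1
      induction hx using Submodule.span_induction with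
      | mem x hx =>
        obtain ⟨y, rfl⟩ := hx
        intro h
        have := Module.mem_annihilator.1 (hab h) y
        rwa [mul_smul, mul_smul] at this
      | zero => simp
      | add x y _ _ hx hy => intro h; rw [smul_add, smul_add, hx, hy, add_zero]
      | smul r x _ hx => intro h; rw [← mul_smul h]; exact hx _
    · obtain ⟨x, rfl⟩ := Submodule.mkQ_surjective _ x
      rw [← map_smul, Module.mem_annihilator.1 hh, map_zero]
    · obtain ⟨x, rfl⟩ := Submodule.mkQ_surjective _ x
      rw [← map_smul, Submodule.mkQ_apply, Submodule.Quotient.mk_eq_zero]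
      exact Submodule.subset_span ⟨x, rfl⟩

end ModExt

section

open TensorProduct HopfAlgebra

section Diagonal

variable (k : Type u') [Field k] (H : Type u) [Ring H] [HopfAlgebra k H]

/-- The action of `H ⊗ H` on a tensor product of two modules. -/
noncomputable def tensorAct (X U : Type u) [AddCommGroup X] [Module k X] [Module H X]
    [IsScalarTower k H X] [AddCommGroup U] [Module k U] [Module H U] [IsScalarTower k H U] :
    H ⊗[k] H →ₐ[k] Module.End k (X ⊗[k] U) :=
  Module.endTensorEndAlgHom.comp
    (Algebra.TensorProduct.map (Algebra.lsmul k k X) (Algebra.lsmul k k U))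

/-- The tensor product of two modules over a Hopf algebra, with the diagonal action. -/
def Diag (X U : Type u) [AddCommGroup X] [Module k X] [AddCommGroup U] [Module k U] : Type u :=
  X ⊗[k] U

variable {X X' U : Type u} [AddCommGroup X] [Module k X] [Module H X]
    [IsScalarTower k H X] [AddCommGroup X'] [Module k X'] [Module H X']
    [IsScalarTower k H X'] [AddCommGroup U] [Module k U] [Module H U] [IsScalarTower k H U]

@[simp]
theorem tensorAct_tmul (a b : H) (x : X) (y : U) :
    tensorAct k H X U (a ⊗ₜ b) (x ⊗ₜ y) = (a • x) ⊗ₜ (b • y) := rfl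

namespace Diag

noncomputable instance : AddCommGroup (Diag k X U) := inferInstanceAs (AddCommGroup (X ⊗[k] U))

noncomputable instance : Module H (Diag k X U) :=
  let _ : Module (Module.End k (X ⊗[k] U)) (Diag k X U) := Module.End.applyModule
  Module.compHom (Diag k X U)
    ((tensorAct k H X U).comp (Bialgebra.comulAlgHom k H)).toRingHom

theorem smul_eq (h : H) (x : Diag k X U) :
    h • x = tensorAct k H X U (Coalgebra.comul h) (x : X ⊗[k] U) := rfl

theorem tensorAct_rTensor (f : X →ₗ[H] X') (z : H ⊗[k] H) (x : X ⊗[k] U) :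
    (f.restrictScalars k).rTensor U (tensorAct k H X U z x) =
      tensorAct k H X' U z ((f.restrictScalars k).rTensor U x) := by
  induction z using TensorProduct.induction_on with
  | zero => simp
  | add a b ha hb => simp [ha, hb]
  | tmul a b =>
    induction x using TensorProduct.induction_on with
    | zero => simp
    | add a b ha hb => rw [map_add, map_add, map_add, map_add, ha, hb]
    | tmul x y => simp

variable (U) in
/-- Functoriality of the diagonal tensor product in the first variable. -/
noncomputable def map (f : X →ₗ[H] X') : Diag k X U →ₗ[H] Diag k X' U where
  toFun x := (f.restrictScalars k).rTensor U x
  map_add' := map_add ((f.restrictScalars k).rTensor U)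
  map_smul' _ x := tensorAct_rTensor k H f _ x

variable (U) in
theorem isShortExact_map {X'' : Type u} [AddCommGroup X''] [Module k X''] [Module H X'']
    [IsScalarTower k H X''] {i : X' →ₗ[H] X} {p : X →ₗ[H] X''} (h : IsShortExact i p) :
    IsShortExact (map k H U i) (map k H U p) where
  inj := Module.Flat.rTensor_preserves_injective_linearMap (i.restrictScalars k) h.inj
  exact := rTensor_exact U (f := i.restrictScalars k) (g := p.restrictScalars k) h.exact h.surj
  surj := LinearMap.rTensor_surjective U (g := p.restrictScalars k) h.surj

variable (U) in
/-- The map `t ⊗ u ↦ t₁ ⊗ t₂ u`. -/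
noncomputable def actRight (t : H ⊗[k] H) : U →ₗ[k] H ⊗[k] U where
  toFun u := tensorAct k H H U t (1 ⊗ₜ u)
  map_add' x y := by rw [TensorProduct.tmul_add, map_add]
  map_smul' c x := by rw [TensorProduct.tmul_smul, map_smul]; rfl

theorem actRight_apply (t : H ⊗[k] H) (u : U) :
    actRight k H U t u = tensorAct k H H U t (1 ⊗ₜ u) := rfl

theorem actRight_tmul (a b : H) (u : U) : actRight k H U (a ⊗ₜ b) u = a ⊗ₜ (b • u) := by
  rw [actRight_apply, tensorAct_tmul, smul_eq_mul, mul_one]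

theorem actRight_add (s t : H ⊗[k] H) (u : U) :
    actRight k H U (s + t) u = actRight k H U s u + actRight k H U t u := by
  change tensorAct k H H U _ _ = tensorAct k H H U _ _ + tensorAct k H H U _ _
  rw [map_add, LinearMap.add_apply]

theorem actRight_zero (u : U) : actRight k H U (0 : H ⊗[k] H) u = 0 := by
  rw [actRight_apply, map_zero, LinearMap.zero_apply]

variable (U) in
/-- The map `t ↦ (u ↦ t₁ ⊗ t₂ u)`. -/
noncomputable def actRightLinear : H ⊗[k] H →ₗ[k] U →ₗ[k] H ⊗[k] U where
  toFun t := actRight k H U t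
  map_add' s t := LinearMap.ext fun u => actRight_add k H s t u
  map_smul' c t := LinearMap.ext fun u => by
    change tensorAct k H H U _ _ = c • tensorAct k H H U _ _
    rw [map_smul, LinearMap.smul_apply]

variable (U) in
/-- The map `a ⊗ u ↦ a₁ ⊗ F(a₂) u`. -/
noncomputable def galois (F : H →ₗ[k] H) : H ⊗[k] U →ₗ[k] H ⊗[k] U :=
  TensorProduct.lift (actRightLinear k H U ∘ₗ F.lTensor H ∘ₗ Coalgebra.comul)

theorem galois_tmul (F : H →ₗ[k] H) (a : H) (u : U) :
    galois k H U F (a ⊗ₜ u) = actRight k H U (F.lTensor H (Coalgebra.comul a)) u := rfl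

theorem actRight_smul (s : H ⊗[k] H) (b : H) (u : U) :
    actRight k H U s (b • u) = actRight k H U
      ((LinearMap.mul' k H).lTensor H (TensorProduct.assoc k H H H (s ⊗ₜ b))) u := by
  induction s using TensorProduct.induction_on with
  | zero => simp [actRight_zero]
  | add a b ha hb =>
    rw [actRight_add, ha, hb, TensorProduct.add_tmul, map_add, map_add, actRight_add]
  | tmul x y => simp [actRight_tmul, mul_smul]

theorem galois_actRight (F : H →ₗ[k] H) (t : H ⊗[k] H) (u : U) :
    galois k H U F (actRight k H U t u) = actRight k H U
      ((LinearMap.mul' k H).lTensor H (TensorProduct.assoc k H H H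
        ((F.lTensor H ∘ₗ Coalgebra.comul).rTensor H t))) u := by
  induction t using TensorProduct.induction_on with
  | zero => simp [actRight_zero]
  | add a b ha hb =>
    rw [actRight_add, map_add, ha, hb, map_add, map_add, map_add, actRight_add]
  | tmul x y =>
    rw [actRight_tmul, galois_tmul, actRight_smul, LinearMap.rTensor_tmul]
    rfl

theorem galois_galois (F F' : H →ₗ[k] H) (x : H ⊗[k] U) :
    galois k H U F (galois k H U F' x) =
      galois k H U (LinearMap.mul' k H ∘ₗ TensorProduct.map F F' ∘ₗ Coalgebra.comul) x := by
  induction x using TensorProduct.induction_on with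
  | zero => simp
  | add a b ha hb => simp only [map_add, ha, hb]
  | tmul a u =>
    rw [galois_tmul, galois_actRight, galois_tmul]
    congr 1
    have key : ∀ z : H ⊗[k] H, TensorProduct.assoc k H H H
        ((F.lTensor H ∘ₗ Coalgebra.comul).rTensor H (F'.lTensor H z)) =
        (TensorProduct.map F F').lTensor H
          (TensorProduct.assoc k H H H (Coalgebra.comul.rTensor H z)) := by
      intro z
      induction z using TensorProduct.induction_on with
      | zero => simp
      | add a b ha hb => simp only [map_add, ha, hb]
      | tmul x y =>
        simp only [LinearMap.lTensor_tmul, LinearMap.rTensor_tmul, LinearMap.comp_apply]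
        generalize (Coalgebra.comul x : H ⊗[k] H) = s
        induction s using TensorProduct.induction_on with
        | zero => simp
        | add a b ha hb => simp only [map_add, TensorProduct.add_tmul, ha, hb]
        | tmul a b => simp
    rw [key, Coalgebra.coassoc_apply, ← LinearMap.lTensor_comp_apply,
      ← LinearMap.lTensor_comp_apply]
    rfl

theorem galois_unit (x : H ⊗[k] U) :
    galois k H U (Algebra.linearMap k H ∘ₗ Coalgebra.counit) x = x := by
  induction x using TensorProduct.induction_on with
  | zero => simp
  | add a b ha hb => simp only [map_add, ha, hb]
  | tmul a u =>
    rw [galois_tmul, LinearMap.lTensor_comp_apply, Coalgebra.lTensor_counit_comul,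
      LinearMap.lTensor_tmul, actRight_tmul]
    simp

theorem galois_bijective : Function.Bijective (galois k H U LinearMap.id) := by
  have h₁ : ∀ x, galois k H U LinearMap.id (galois k H U (antipode k) x) = x := fun x => by
    rw [galois_galois]
    exact (congrArg (fun G => galois k H U G x)
      (HopfAlgebra.mul_antipode_lTensor_comul (R := k) (A := H))).trans (galois_unit k H x)
  have h₂ : ∀ x, galois k H U (antipode k) (galois k H U LinearMap.id x) = x := fun x => by
    rw [galois_galois]
    exact (congrArg (fun G => galois k H U G x)
      (HopfAlgebra.mul_antipode_rTensor_comul (R := k) (A := H))).trans (galois_unit k H x)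
  exact ⟨Function.LeftInverse.injective h₂, Function.RightInverse.surjective h₁⟩

theorem galois_smul (h : H) (x : H ⊗[k] U) :
    galois k H U LinearMap.id (h • x) =
      tensorAct k H H U (Coalgebra.comul h) (galois k H U LinearMap.id x) := by
  induction x using TensorProduct.induction_on with
  | zero => simp
  | add a b ha hb => simp only [smul_add, map_add, ha, hb]
  | tmul a u =>
    rw [TensorProduct.smul_tmul', smul_eq_mul, galois_tmul, galois_tmul, LinearMap.lTensor_id,
      LinearMap.id_apply, LinearMap.id_apply, Bialgebra.comul_mul]
    change tensorAct k H H U _ _ = tensorAct k H H U _ (tensorAct k H H U _ _)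
    rw [map_mul]
    rfl

instance projective_self : Module.Projective H (Diag k H U) := by
  have : Module.Projective H (H ⊗[k] U) :=
    Module.Projective.of_basis (Algebra.TensorProduct.basis H (Module.Basis.ofVectorSpace k U))
  let e : H ⊗[k] U →ₗ[H] Diag k H U :=
    { toFun := fun x => galois k H U LinearMap.id x
      map_add' := map_add (galois k H U LinearMap.id)
      map_smul' := galois_smul k H }
  exact Module.Projective.of_equiv (LinearEquiv.ofBijective e (galois_bijective k H))

end Diag

end Diagonal

end

section

open TensorProduct HopfAlgebra

section Diagonal

variable (k : Type u') [Field k] (H : Type u) [Ring H] [HopfAlgebra k H]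

namespace Diag

variable {X X' X'' : Type u} [AddCommGroup X] [Module k X] [Module H X]
    [IsScalarTower k H X] [AddCommGroup X'] [Module k X'] [Module H X']
    [IsScalarTower k H X'] [AddCommGroup X''] [Module k X''] [Module H X'']
    [IsScalarTower k H X'']
    (U : Type u) [AddCommGroup U] [Module k U] [Module H U] [IsScalarTower k H U]

theorem map_id : map k H U (LinearMap.id : X →ₗ[H] X) = LinearMap.id :=
  LinearMap.ext fun x => LinearMap.congr_fun (LinearMap.rTensor_id (R := k) U X) x

theorem map_comp (g : X' →ₗ[H] X'') (f : X →ₗ[H] X') :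
    map k H U (g ∘ₗ f) = map k H U g ∘ₗ map k H U f :=
  LinearMap.ext fun x => LinearMap.rTensor_comp_apply U
    (g.restrictScalars k) (f.restrictScalars k) x

theorem map_add' (f g : X →ₗ[H] X') : map k H U (f + g) = map k H U f + map k H U g :=
  LinearMap.ext fun x => LinearMap.congr_fun (LinearMap.rTensor_add U
    (f.restrictScalars k) (g.restrictScalars k)) x

/-- Functoriality as an additive map. -/
noncomputable def mapHom : (X →ₗ[H] X') →+ (Diag k X U →ₗ[H] Diag k X' U) :=
  AddMonoidHom.mk' (map k H U) (map_add' k H U)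

theorem subsingleton_of_retract {n : ℕ} (s : X →ₗ[H] (Fin n → H)) (p : (Fin n → H) →ₗ[H] X)
    (hps : p ∘ₗ s = LinearMap.id) (B : Type u) [AddCommGroup B] [Module H B] (q : ℕ) :
    Subsingleton (ModExt H (Diag k X U) B (q + 1)) := by
  refine subsingleton_of_forall_eq 0 fun x => ?_
  have h₁ : LinearMap.id = ∑ i, (p ∘ₗ LinearMap.single H (fun _ => H) i) ∘ₗ
      (LinearMap.proj i ∘ₗ s) := by
    rw [← hps]
    ext x
    simp only [LinearMap.comp_apply, LinearMap.sum_apply]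
    rw [← map_sum]
    congr 1
    ext j
    simp [Pi.single_apply]
  rw [← ModExt.pre_id x, ← map_id k H U (X := X), h₁]
  change ModExt.pre (mapHom k H U _) x = 0
  rw [map_sum]
  have : ∀ t : Finset (Fin n), ModExt.pre (∑ i ∈ t, mapHom k H U
      ((p ∘ₗ LinearMap.single H (fun _ => H) i) ∘ₗ (LinearMap.proj i ∘ₗ s))) x = 0 := by
    intro t
    induction t using Finset.induction_on with
    | empty => rw [Finset.sum_empty, ModExt.pre_zero]
    | insert a t ha ih =>
      rw [Finset.sum_insert ha, ModExt.pre_add, ih, add_zero]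
      change ModExt.pre (map k H U _) x = 0
      rw [map_comp, ← ModExt.pre_pre]
      have := ModExt.subsingleton_of_projective (H := H) (M := Diag k H U) (B := B) (q := q)
      exact (congrArg _ (Subsingleton.elim _ 0)).trans (_root_.map_zero _)
  exact this _

/-- Tensoring with a module does not raise the projective dimension. -/
theorem subsingleton_ext [IsNoetherianRing H] (j : ℕ) :
    ∀ (X : Type u) [AddCommGroup X] [Module k X] [Module H X] [IsScalarTower k H X]
      [Module.Finite H X], (∀ (B : Type u) [AddCommGroup B] [Module H B] [Module.Finite H B]
        (q : ℕ), j + 1 ≤ q → Subsingleton (ModExt H X B q)) →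
    ∀ (B : Type u) [AddCommGroup B] [Module H B] (q : ℕ), j + 1 ≤ q →
      Subsingleton (ModExt H (Diag k X U) B q) := by
  induction j with
  | zero =>
    intro X _ _ _ _ _ hX B _ _ q hq
    obtain ⟨n, p, hp⟩ := Module.Finite.exists_fin' H X
    have hex := IsShortExact.of_surjective p hp
    have := hX (LinearMap.ker p) 1 le_rfl
    obtain ⟨y, hy⟩ := ModExt.post_exact₃ (q := 0) hex (ModExt.homEquiv.symm LinearMap.id)
      (Subsingleton.elim (α := ModExt H X (LinearMap.ker p) 1) _ _)
    obtain ⟨q, rfl⟩ : ∃ r, q = r + 1 := ⟨q - 1, by lia⟩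
    refine subsingleton_of_retract k H U (ModExt.homEquiv y) p ?_ B q
    rw [← ModExt.homEquiv_post, hy, AddEquiv.apply_symm_apply]
  | succ j ih =>
    intro X _ _ _ _ _ hX B _ _ q hq
    obtain ⟨n, p, hp⟩ := Module.Finite.exists_fin' H X
    have hex := IsShortExact.of_surjective p hp
    obtain ⟨q, rfl⟩ : ∃ r, q = r + 1 := ⟨q - 1, by lia⟩
    have hΩ := ih (LinearMap.ker p) (fun B _ _ _ q hq => by
      refine subsingleton_of_forall_eq 0 fun x => ?_
      have := hX B (q + 1) (by lia)
      obtain ⟨y, rfl⟩ := ModExt.pre_exact₁ hex x (Subsingleton.elim _ _)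
      obtain ⟨q, rfl⟩ : ∃ r, q = r + 1 := ⟨q - 1, by lia⟩
      have := ModExt.subsingleton_of_projective (H := H) (M := Fin n → H) (B := B) (q := q)
      rw [Subsingleton.elim y 0, _root_.map_zero]) B q (by lia)
    refine subsingleton_of_forall_eq 0 fun x => ?_
    have := subsingleton_of_retract k H U LinearMap.id (LinearMap.id (M := Fin n → H)) rfl B q
    obtain ⟨y, rfl⟩ := ModExt.pre_exact₃ (isShortExact_map k H U hex) x (Subsingleton.elim _ _)
    rw [Subsingleton.elim y 0, _root_.map_zero]

end Diag

/-- The trivial module, as a cyclic module. -/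
abbrev TrivialModule : Type u :=
  H ⧸ (RingHom.ker (Bialgebra.counitAlgHom k H) : Ideal H)

namespace TrivialModule

theorem smul_eq (h : H) (e : TrivialModule k H) :
    h • e = (Coalgebra.counit h : k) • e := by
  obtain ⟨x, rfl⟩ := Submodule.mkQ_surjective _ e
  rw [← map_smul]
  have : ∀ c : k, c • (RingHom.ker (Bialgebra.counitAlgHom k H) : Ideal H).mkQ x =
    (RingHom.ker (Bialgebra.counitAlgHom k H) : Ideal H).mkQ (c • x) := fun _ => rfl
  rw [this, ← sub_eq_zero, ← map_sub, Submodule.mkQ_apply, Submodule.Quotient.mk_eq_zero]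
  change Bialgebra.counitAlgHom k H (h • x - _) = 0
  simp

/-- The counit on the trivial module. -/
noncomputable def toField : TrivialModule k H →ₗ[k] k :=
  ((RingHom.ker (Bialgebra.counitAlgHom k H) : Ideal H).restrictScalars k).liftQ
    Coalgebra.counit (fun _ hx => hx)

/-- The generator of the trivial module. -/
noncomputable def gen : TrivialModule k H :=
  (RingHom.ker (Bialgebra.counitAlgHom k H) : Ideal H).mkQ 1

theorem toField_gen : toField k H (gen k H) = 1 :=
  Bialgebra.counit_one

theorem eq_smul_gen (e : TrivialModule k H) : e = toField k H e • gen k H := by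
  obtain ⟨x, rfl⟩ := Submodule.mkQ_surjective _ e
  change _ = (Coalgebra.counit x : k) • gen k H
  rw [← smul_eq, gen, ← map_smul, smul_eq_mul, mul_one]

variable (N : Type u) [AddCommGroup N] [Module k N] [Module H N] [IsScalarTower k H N]

/-- Tensoring with the trivial module does nothing. -/
noncomputable def diagEquiv : N ≃ₗ[H] Diag k (TrivialModule k H) N := by
  let f : N →ₗ[H] Diag k (TrivialModule k H) N :=
    { toFun := fun n => (gen k H ⊗ₜ[k] n : TrivialModule k H ⊗[k] N)
      map_add' := fun a b => TensorProduct.tmul_add _ _ _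
      map_smul' := fun h n => by
        have : ∀ z : H ⊗[k] H, tensorAct k H (TrivialModule k H) N z (gen k H ⊗ₜ[k] n) =
            gen k H ⊗ₜ[k] ((TensorProduct.lid k H (Coalgebra.counit.rTensor H z)) • n) := by
          intro z
          induction z using TensorProduct.induction_on with
          | zero => simp
          | add a b ha hb => simp [ha, hb, add_smul, TensorProduct.tmul_add]
          | tmul a b => simp [smul_eq, TensorProduct.smul_tmul']
        refine Eq.trans ?_ (this (Coalgebra.comul h)).symm
        rw [Coalgebra.rTensor_counit_comul, TensorProduct.lid_tmul, one_smul] }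
  refine LinearEquiv.ofBijective f ⟨?_, ?_⟩
  · let g : TrivialModule k H ⊗[k] N →ₗ[k] N :=
      TensorProduct.lid k N ∘ₗ (toField k H).rTensor N
    refine Function.LeftInverse.injective (g := g) fun n => ?_
    change g (gen k H ⊗ₜ[k] n) = n
    simp [g, toField_gen]
  · intro x
    induction x using TensorProduct.induction_on with
    | zero => exact ⟨0, map_zero f⟩
    | add a b ha hb =>
      obtain ⟨a, rfl⟩ := ha
      obtain ⟨b, rfl⟩ := hb
      exact ⟨a + b, map_add f a b⟩
    | tmul e n =>
      refine ⟨toField k H e • n, ?_⟩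
      change gen k H ⊗ₜ[k] _ = _
      rw [← TensorProduct.smul_tmul, ← eq_smul_gen]

end TrivialModule

section Dual

variable (W E : Type u) [AddCommGroup W] [Module k W] [Module H W] [IsScalarTower k H W]
  [AddCommGroup E] [Module k E]

/-- The linear maps from a module to a vector space, with the action given by the antipode. -/
def ContraDual (_H : Type u) (W E : Type u) [AddCommGroup W] [Module k W] [AddCommGroup E]
    [Module k E] : Type u := W →ₗ[k] E

namespace ContraDual

noncomputable instance : AddCommGroup (ContraDual k H W E) :=
  inferInstanceAs (AddCommGroup (W →ₗ[k] E))

noncomputable instance : Module k (ContraDual k H W E) :=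
  inferInstanceAs (Module k (W →ₗ[k] E))

/-- The contragredient action. -/
noncomputable def act (h : H) (f : W →ₗ[k] E) : W →ₗ[k] E :=
  f ∘ₗ Algebra.lsmul k k W (antipode k h)

theorem act_add (a b : H) (f : W →ₗ[k] E) :
    act k H W E (a + b) f = act k H W E a f + act k H W E b f :=
  LinearMap.ext fun w => by simp [act]

theorem act_smul (c : k) (a : H) (f : W →ₗ[k] E) :
    act k H W E (c • a) f = c • act k H W E a f :=
  LinearMap.ext fun w => by simp [act]

theorem act_zero (f : W →ₗ[k] E) : act k H W E 0 f = 0 :=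
  LinearMap.ext fun w => by simp [act]

noncomputable instance : Module H (ContraDual k H W E) where
  smul h f := act k H W E h f
  one_smul f := by
    refine LinearMap.ext fun w => congrArg (show W →ₗ[k] E from f) ?_
    change antipode k (1 : H) • w = w
    rw [antipode_one, one_smul]
  mul_smul a b f := by
    refine LinearMap.ext fun w => congrArg (show W →ₗ[k] E from f) ?_
    change antipode k (a * b) • w = antipode k b • antipode k a • w
    rw [antipode_mul_antidistrib, mul_smul]
  smul_zero h := LinearMap.zero_comp _
  smul_add h f g := LinearMap.add_comp _ _ _
  add_smul a b f := act_add k H W E a b f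
  zero_smul f := act_zero k H W E f

noncomputable instance : IsScalarTower k H (ContraDual k H W E) where
  smul_assoc c h f := act_smul k H W E c h f

/-- Homomorphisms as elements of a tensor product. -/
noncomputable def equivHom [Module.Finite k W] :
    W ⊗[k] ContraDual k H W E ≃ₗ[k] (W →ₗ[k] W ⊗[k] E) :=
  lTensorHomEquivHomLTensor k W W E

theorem equivHom_smul_tmul [Module.Finite k W] (w x : W) (a b : H) (f : ContraDual k H W E) :
    equivHom k H W E ((a • w) ⊗ₜ (b • f)) x =
      (Algebra.lsmul k k W a).rTensor E (equivHom k H W E (w ⊗ₜ f) (antipode k b • x)) := by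
  have h (w : W) (f : ContraDual k H W E) (x : W) :
      equivHom k H W E (w ⊗ₜ f) x = w ⊗ₜ (show W →ₗ[k] E from f) x := by
    exact LinearMap.congr_fun (lTensorHomEquivHomLTensor_apply (R := k) (M := W) (P := W)
      (Q := E) _) x
  rw [h, h]
  rfl

end ContraDual

variable [Module.Finite k W]

/-- The coevaluation element. -/
noncomputable def coevElement : W ⊗[k] (ContraDual k H W (TrivialModule k H)) :=
  (ContraDual.equivHom k H W (TrivialModule k H)).symm
    ((TensorProduct.mk k W (TrivialModule k H)).flip (TrivialModule.gen k H))

theorem tensorAct_hom (z : H ⊗[k] H) (t : W ⊗[k] (ContraDual k H W E)) (x : W) :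
    ContraDual.equivHom k H W E (tensorAct k H W (ContraDual k H W E) z t) x =
      TensorProduct.lift ((LinearMap.mk₂ k (fun (a b : H) =>
        (Algebra.lsmul k k W a).rTensor E
          (ContraDual.equivHom k H W E t (antipode k b • x)))
        (by intros; simp [LinearMap.rTensor_add]) (by intros; simp [LinearMap.rTensor_smul])
        (by intros; simp [add_smul]) (by intros; simp))) z := by
  induction z using TensorProduct.induction_on with
  | zero => simp
  | add a b ha hb => simp only [map_add, LinearMap.add_apply, ha, hb]
  | tmul a b =>
    rw [TensorProduct.lift.tmul, LinearMap.mk₂_apply]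
    induction t using TensorProduct.induction_on with
    | zero => simp
    | add s t hs ht => simp only [map_add, LinearMap.add_apply, hs, ht]
    | tmul y f =>
      rw [tensorAct_tmul, ContraDual.equivHom_smul_tmul]

theorem tensorAct_coevElement (h : H) :
    tensorAct k H W (ContraDual k H W (TrivialModule k H)) (Coalgebra.comul h)
      (coevElement k H W) = (Coalgebra.counit h : k) • coevElement k H W := by
  apply (ContraDual.equivHom k H W (TrivialModule k H)).injective
  refine LinearMap.ext fun x => ?_
  rw [tensorAct_hom, map_smul, coevElement, LinearEquiv.apply_symm_apply]
  have : ∀ z : H ⊗[k] H, TensorProduct.lift ((LinearMap.mk₂ k (fun (a b : H) =>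
        (Algebra.lsmul k k W a).rTensor (TrivialModule k H)
          ((TensorProduct.mk k W (TrivialModule k H)).flip (TrivialModule.gen k H)
            (antipode k b • x)))
        (by intros; simp [LinearMap.rTensor_add]) (by intros; simp [LinearMap.rTensor_smul])
        (by intros; simp [add_smul])
        (by intros; simp [TensorProduct.smul_tmul']))) z =
      (LinearMap.mul' k H ((antipode k).lTensor H z) • x) ⊗ₜ TrivialModule.gen k H := by
    intro z
    induction z using TensorProduct.induction_on with
    | zero => simp
    | add a b ha hb => simp only [map_add, ha, hb, add_smul, TensorProduct.add_tmul]
    | tmul a b => simp [mul_smul]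
  rw [this, mul_antipode_lTensor_comul_apply, algebraMap_smul]
  rfl

theorem coevElement_ne_zero [Nontrivial W] : coevElement k H W ≠ 0 := by
  intro h
  obtain ⟨w, hw⟩ := exists_ne (0 : W)
  have h₁ := congrArg (fun t => ContraDual.equivHom k H W (TrivialModule k H) t w) h
  simp only [coevElement, LinearEquiv.apply_symm_apply, map_zero, LinearMap.zero_apply] at h₁
  have h₂ := congrArg (fun t => TensorProduct.rid k W ((TrivialModule.toField k H).lTensor W t)) h₁
  simp [TrivialModule.toField_gen, hw] at h₂

/-- The coevaluation map. -/
noncomputable def coev :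
    TrivialModule k H →ₗ[H] Diag k W (ContraDual k H W (TrivialModule k H)) :=
  Submodule.liftQ _ (LinearMap.toSpanSingleton H _ (coevElement k H W : Diag k W _)) fun h hh => by
    refine LinearMap.mem_ker.2 ((tensorAct_coevElement k H W h).trans ?_)
    rw [show (Coalgebra.counit h : k) = 0 from hh, zero_smul]
    rfl

theorem coev_injective [Nontrivial W] : Function.Injective (coev k H W) := by
  rw [← LinearMap.ker_eq_bot, coev, Submodule.ker_liftQ_eq_bot]
  intro h hh
  have : (Coalgebra.counit h : k) • coevElement k H W = 0 :=
    (tensorAct_coevElement k H W h).symm.trans hh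
  exact (smul_eq_zero.1 this).resolve_right (coevElement_ne_zero k H W)

end Dual

theorem exists_top_degree [IsNoetherianRing H] (hgl : HasFiniteGlobalDimension H) :
    ∃ d : ℕ, (∀ (N : Type u) [AddCommGroup N] [Module H N] (B : Type u) [AddCommGroup B]
        [Module H B] (q : ℕ), d < q → Subsingleton (ModExt H N B q)) ∧
      ∀ (W : Type u) [AddCommGroup W] [Module k W] [Module H W] [IsScalarTower k H W]
        [Module.Finite k W] [Nontrivial W], ¬ Subsingleton (ModExt H W H d) := by
  classical
  obtain ⟨n, hn⟩ := ModExt.exists_subsingleton_of_hasFiniteGlobalDimension hgl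
  have hE : Nontrivial (TrivialModule k H) := ⟨TrivialModule.gen k H, 0, fun h => by
    have := TrivialModule.toField_gen k H
    rw [h, map_zero] at this
    exact zero_ne_one this⟩
  have hex : ∃ q, ¬ Subsingleton (ModExt H (TrivialModule k H) H q) := by
    by_contra! hc
    have := ModExt.subsingleton_of_forall hn (j := 0) (fun q _ => hc q) (TrivialModule k H) 0 le_rfl
    obtain ⟨e, he⟩ := exists_ne (0 : TrivialModule k H)
    have h₁ : (LinearMap.id : TrivialModule k H →ₗ[H] TrivialModule k H) = 0 :=
      ModExt.homEquiv.symm.injective (Subsingleton.elim _ _)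
    exact he (LinearMap.congr_fun h₁ e)
  have hle : ∀ q, ¬ Subsingleton (ModExt H (TrivialModule k H) H q) → q ≤ n := fun q hq => by
    by_contra! hc
    exact hq (hn _ _ q hc)
  obtain ⟨q₀, hq₀⟩ := hex
  let d := Nat.findGreatest (fun q => ¬ Subsingleton (ModExt H (TrivialModule k H) H q)) n
  have hd : ¬ Subsingleton (ModExt H (TrivialModule k H) H d) :=
    Nat.findGreatest_spec (P := fun q => ¬ Subsingleton (ModExt H (TrivialModule k H) H q))
      (hle q₀ hq₀) hq₀
  have hd' : ∀ q, d < q → Subsingleton (ModExt H (TrivialModule k H) H q) := fun q hq => by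
    by_contra hc
    exact Nat.findGreatest_is_greatest hq (hle q hc) hc
  have htop : ∀ (N : Type u) [AddCommGroup N] [Module H N] (B : Type u) [AddCommGroup B]
      [Module H B] (q : ℕ), d < q → Subsingleton (ModExt H N B q) := by
    intro N _ _ B _ _ q hq
    let _ : Module k N := Module.compHom N (algebraMap k H)
    have : IsScalarTower k H N := IsScalarTower.of_algebraMap_smul fun _ _ => rfl
    have := Diag.subsingleton_ext k H N d (TrivialModule k H) (fun B _ _ _ q hq =>
      ModExt.subsingleton_of_forall hn (j := d + 1) (fun q hq => hd' q hq) B q hq) B q hq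
    exact ModExt.subsingleton_of_preEquiv (TrivialModule.diagEquiv k H N).symm
  refine ⟨d, htop, ?_⟩
  intro W _ _ _ _ _ _ hW
  have : Module.Finite H W := Module.Finite.of_restrictScalars_finite k H W
  have hW' : ∀ q, d ≤ q → Subsingleton (ModExt H W H q) := fun q hq => by
    rcases hq.eq_or_lt with rfl | hq
    · exact hW
    · exact htop _ _ q hq
  rcases Nat.eq_zero_or_pos d with h0 | hpos
  · have := ModExt.subsingleton_of_forall hn (j := d) hW' W 0 h0.le
    obtain ⟨e, he⟩ := exists_ne (0 : W)
    have h₁ : (LinearMap.id : W →ₗ[H] W) = 0 :=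
      ModExt.homEquiv.symm.injective (Subsingleton.elim _ _)
    exact he (LinearMap.congr_fun h₁ e)
  · have h₁ := Diag.subsingleton_ext k H (ContraDual k H W (TrivialModule k H)) (d - 1) W
      (fun B _ _ _ q hq => ModExt.subsingleton_of_forall hn hW' B q (by lia)) H d (by lia)
    have hs := IsShortExact.of_injective _ (coev_injective k H W)
    refine hd (subsingleton_of_forall_eq 0 fun x => ?_)
    have := htop (Diag k W (ContraDual k H W (TrivialModule k H)) ⧸
      LinearMap.range (coev k H W)) H (d + 1) (by lia)
    obtain ⟨y, rfl⟩ := ModExt.pre_exact₁ hs x (Subsingleton.elim _ _)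
    rw [Subsingleton.elim y 0, map_zero]

end Diagonal

end

section

open HopfAlgebra

section DualModule

/-- The dual `Hom(M, H)` of a module over a Hopf algebra, with the left action obtained by twisting
right multiplication by the antipode. -/
def DualMod (_k : Type u') (H M : Type u) [Ring H] [AddCommGroup M] [Module H M] : Type u :=
  M →ₗ[H] H

namespace DualMod

variable (k : Type u') [Field k] (H : Type u) [Ring H] [HopfAlgebra k H]
variable (M N : Type u) [AddCommGroup M] [Module H M] [AddCommGroup N] [Module H N]

noncomputable instance : AddCommGroup (DualMod k H M) :=
  inferInstanceAs (AddCommGroup (M →ₗ[H] H))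

instance : FunLike (DualMod k H M) M H := inferInstanceAs (FunLike (M →ₗ[H] H) M H)

/-- The twisted action. -/
noncomputable def act (h : H) (f : M →ₗ[H] H) : M →ₗ[H] H :=
  LinearMap.toSpanSingleton H H (antipode k h) ∘ₗ f

theorem act_apply (h : H) (f : M →ₗ[H] H) (x : M) : act k H M h f x = f x * antipode k h := rfl

noncomputable instance : Module H (DualMod k H M) where
  smul h f := act k H M h f
  one_smul f := LinearMap.ext fun x => by
    refine (act_apply k H M 1 f x).trans ?_
    rw [antipode_one, mul_one]
  mul_smul a b f := LinearMap.ext fun x => by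
    refine (act_apply k H M (a * b) f x).trans ?_
    rw [antipode_mul_antidistrib, ← mul_assoc]
    rfl
  smul_zero h := LinearMap.comp_zero _
  smul_add h f g := LinearMap.comp_add _ _ _
  add_smul a b f := LinearMap.ext fun x => by
    refine (act_apply k H M (a + b) f x).trans ?_
    rw [map_add, mul_add]
    rfl
  zero_smul f := LinearMap.ext fun x => by
    refine (act_apply k H M 0 f x).trans ?_
    rw [map_zero, mul_zero]
    rfl

noncomputable instance : Module k (DualMod k H M) := Module.compHom _ (algebraMap k H)

instance : IsScalarTower k H (DualMod k H M) := IsScalarTower.of_algebraMap_smul fun _ _ => rfl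

variable {k H M N}

theorem smul_apply (h : H) (f : DualMod k H M) (x : M) : (h • f) x = f x * antipode k h := rfl

variable (k) in
/-- Functoriality of the dual. -/
noncomputable def map (f : M →ₗ[H] N) : DualMod k H N →ₗ[H] DualMod k H M where
  toFun g := LinearMap.comp (show N →ₗ[H] H from g) f
  map_add' _ _ := rfl
  map_smul' _ _ := rfl

variable (k) in
theorem map_injective (f : M →ₗ[H] N) (hf : Function.Surjective f) :
    Function.Injective (map k f) := fun g g' h => by
  refine LinearMap.ext fun x => ?_
  obtain ⟨y, rfl⟩ := hf x
  exact LinearMap.congr_fun (show (LinearMap.comp (show N →ₗ[H] H from g) f) =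
    LinearMap.comp (show N →ₗ[H] H from g') f from h) y

/-- The functional on a free module with the given twisted coordinates. -/
noncomputable def ofCoords (k : Type u') [Field k] (H : Type u) [Ring H] [HopfAlgebra k H] {n : ℕ}
    (a : Fin n → H) : (Fin n → H) →ₗ[H] H :=
  ∑ i, LinearMap.toSpanSingleton H H (antipode k (a i)) ∘ₗ LinearMap.proj i

theorem ofCoords_apply {n : ℕ} (a x : Fin n → H) :
    ofCoords k H a x = ∑ i, x i * antipode k (a i) := by
  simp [ofCoords]

theorem projective (hS : Function.Bijective (antipode k : H →ₗ[k] H)) (n : ℕ) :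
    Module.Projective H (DualMod k H (Fin n → H)) := by
  classical
  let e : (Fin n → H) →ₗ[H] DualMod k H (Fin n → H) :=
    { toFun := fun a => ofCoords k H a
      map_add' := fun a b => LinearMap.ext fun x => by
        refine (ofCoords_apply (a + b) x).trans (Eq.trans ?_
          (congrArg₂ (· + ·) (ofCoords_apply a x) (ofCoords_apply b x)).symm)
        simp [mul_add, Finset.sum_add_distrib]
      map_smul' := fun h a => LinearMap.ext fun x => by
        refine (ofCoords_apply (h • a) x).trans (Eq.trans ?_
          (congrArg (· * antipode k h) (ofCoords_apply a x)).symm)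
        simp [antipode_mul_antidistrib, Finset.sum_mul, mul_assoc] }
  have he : ∀ a i, ofCoords k H a (Pi.single (M := fun _ : Fin n => H) i 1) =
      antipode k (a i) := by
    intro a i
    simp [ofCoords_apply, Pi.single_apply]
  refine Module.Projective.of_equiv (LinearEquiv.ofBijective e ⟨fun a b h => ?_, fun f => ?_⟩)
  · funext i
    apply hS.1
    rw [← he, ← he]
    exact LinearMap.congr_fun (show ofCoords k H a = ofCoords k H b from h) _
  · choose a ha using fun i => hS.2 ((show (Fin n → H) →ₗ[H] H from f) (Pi.single i 1))
    refine ⟨a, ?_⟩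
    have : ofCoords k H a = (show (Fin n → H) →ₗ[H] H from f) :=
      LinearMap.pi_ext' fun i => LinearMap.ext_ring ((he a i).trans (ha i))
    exact this

theorem map_smul_eq_mul [Module k M] [IsScalarTower k H M] (f : M →ₗ[H] H) (c : k) (x : M) :
    f x * antipode k (algebraMap k H c) = f (c • x) := by
  rw [← algebraMap_smul H c x, map_smul, Algebra.algebraMap_eq_smul_one, map_smul, antipode_one,
    mul_smul_comm, mul_one, smul_eq_mul, smul_mul_assoc, one_mul]

/-- The dual is the zeroth extension group. -/
noncomputable def equivExt [Module k M] [IsScalarTower k H M] :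
    DualMod k H M ≃ₗ[k] ModExt H M H 0 where
  toFun f := ModExt.homEquiv.symm (show M →ₗ[H] H from f)
  invFun x := ModExt.homEquiv x
  map_add' f g := map_add ModExt.homEquiv.symm (show M →ₗ[H] H from f) (show M →ₗ[H] H from g)
  map_smul' c f := by
    apply ModExt.homEquiv.injective
    refine (AddEquiv.apply_symm_apply _ _).trans (LinearMap.ext fun x => ?_)
    rw [RingHom.id_apply, ModExt.homEquiv_smul_apply, AddEquiv.apply_symm_apply]
    exact map_smul_eq_mul (show M →ₗ[H] H from f) c x
  left_inv f := AddEquiv.apply_symm_apply _ _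
  right_inv x := AddEquiv.symm_apply_apply _ _

theorem equivExt_map [Module k M] [IsScalarTower k H M] [Module k N] [IsScalarTower k H N]
    (f : M →ₗ[H] N) (g : DualMod k H N) :
    equivExt (map k f g) = ModExt.pre f (equivExt g) := by
  apply ModExt.homEquiv.injective
  refine (AddEquiv.apply_symm_apply _ _).trans ?_
  rw [ModExt.homEquiv_pre]
  exact congrArg (fun z => LinearMap.comp z f) (AddEquiv.apply_symm_apply _ _).symm

end DualMod

/-- Vanishing of extension groups propagates along syzygies. -/
theorem DualMod.eq_top_and_subsingleton {k : Type u'} [Field k] {H : Type u} [Ring H]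
    [HopfAlgebra k H] [IsNoetherianRing H]
    (hS : Function.Bijective (antipode k : H →ₗ[k] H)) {d : ℕ}
    (htop : ∀ (N : Type u) [AddCommGroup N] [Module H N] (B : Type u) [AddCommGroup B]
        [Module H B] (q : ℕ), d < q → Subsingleton (ModExt H N B q))
    (hd : ∀ (W : Type u) [AddCommGroup W] [Module k W] [Module H W] [IsScalarTower k H W]
        [Module.Finite k W] [Nontrivial W], ¬ Subsingleton (ModExt H W H d)) (j : ℕ) :
    ∀ (i : ℕ) (M : Type u) [AddCommGroup M] [Module k M] [Module H M] [IsScalarTower k H M]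
      [Module.Finite H M] (W : Submodule H (DualMod k H M)),
      (∀ q, i ≤ q → Subsingleton (ModExt H W H q)) →
      Module.Finite k (DualMod k H M ⧸ W) → (∀ p, 1 ≤ p → Module.Finite k (ModExt H M H p)) →
      i + j < d → W = ⊤ ∧ ∀ p, 1 ≤ p → p ≤ j → Subsingleton (ModExt H M H p) := by
  induction j with
  | zero | succ j ih =>
    intro i M _ _ _ _ _ W hW hfin hext hij
    obtain ⟨n, p, hp⟩ := Module.Finite.exists_fin' H M
    have hex := IsShortExact.of_surjective p hp
    have hproj := DualMod.projective hS n
    have hpinj := DualMod.map_injective k p hp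
    have hP : ∀ q, Subsingleton (ModExt H (DualMod k H (Fin n → H)) H (q + 1)) := fun q =>
      ModExt.subsingleton_of_projective
    have htopW : W = ⊤ := by
      by_contra hne
      have hnt : Nontrivial (DualMod k H M ⧸ W) := Submodule.Quotient.nontrivial_iff.2 hne
      refine hd (DualMod k H M ⧸ W) (subsingleton_of_forall_eq 0 fun x => ?_)
      obtain ⟨d, rfl⟩ : ∃ r, d = r + 1 := ⟨d - 1, by lia⟩
      let V := W.map (DualMod.map k p)
      have hV := IsShortExact.of_submodule V
      let e : W ≃ₗ[H] V := Submodule.equivMapOfInjective _ hpinj W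
      have hVd : Subsingleton (ModExt H V H d) :=
        have := hW d (by lia)
        ModExt.subsingleton_of_preEquiv e
      have hQ : Subsingleton (ModExt H (DualMod k H (Fin n → H) ⧸ V) H (d + 1)) := by
        refine subsingleton_of_forall_eq 0 fun x => ?_
        have := hP d
        obtain ⟨y, rfl⟩ := ModExt.pre_exact₃ hV x (Subsingleton.elim _ _)
        rw [Subsingleton.elim y 0, map_zero]
      let ι : (DualMod k H M ⧸ W) →ₗ[H] (DualMod k H (Fin n → H) ⧸ V) :=
        W.mapQ V (DualMod.map k p) (Submodule.le_comap_map _ _)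
      have hι : Function.Injective ι := by
        rw [← LinearMap.ker_eq_bot]
        refine Submodule.ker_liftQ_eq_bot _ _ _ ?_
        rw [LinearMap.ker_comp, Submodule.ker_mkQ, Submodule.comap_map_eq_of_injective hpinj]
      have := htop ((DualMod k H (Fin n → H) ⧸ V) ⧸ LinearMap.range ι) H (d + 1 + 1) (by lia)
      obtain ⟨y, rfl⟩ := ModExt.pre_exact₁ (IsShortExact.of_injective ι hι) x
        (Subsingleton.elim _ _)
      rw [Subsingleton.elim y 0, map_zero]
    refine ⟨htopW, ?_⟩
    first
    | exact fun p h1 h2 => absurd (h1.trans h2) (by lia)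
    | skip
    all_goals
      intro r hr1 hr2
      let Ω := LinearMap.ker p
      let res := DualMod.map k Ω.subtype
      let W' := LinearMap.range res
      have hΩ : ∀ q, Subsingleton (ModExt H (Fin n → H) H (q + 1)) := fun q =>
        ModExt.subsingleton_of_projective
      have hs : ∀ f : DualMod k H Ω, f ∈ W' ↔ ModExt.preδ hex (DualMod.equivExt f) = 0 := by
        intro f
        refine ⟨?_, fun h => ?_⟩
        · rintro ⟨g, rfl⟩
          rw [DualMod.equivExt_map, ModExt.preδ_pre]
        · obtain ⟨y, hy⟩ := ModExt.pre_exact₁ hex _ h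
          obtain ⟨g, rfl⟩ := (DualMod.equivExt (k := k)).surjective y
          exact ⟨g, DualMod.equivExt.injective ((DualMod.equivExt_map _ _).trans hy)⟩
      have hsW : IsShortExact (DualMod.map k p) res.rangeRestrict := by
        refine ⟨hpinj, fun g => ?_, res.surjective_rangeRestrict⟩
        constructor
        · intro h
          have h₁ : res g = 0 := congrArg Subtype.val h
          have h₂ : ModExt.pre Ω.subtype (DualMod.equivExt g) = 0 := by
            rw [← DualMod.equivExt_map]
            exact (congrArg DualMod.equivExt h₁).trans (map_zero _)
          obtain ⟨y, hy⟩ := ModExt.pre_exact₂ hex _ h₂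
          obtain ⟨g', rfl⟩ := (DualMod.equivExt (k := k)).surjective y
          exact ⟨g', DualMod.equivExt.injective ((DualMod.equivExt_map _ _).trans hy)⟩
        · rintro ⟨g', rfl⟩
          refine Subtype.ext (DualMod.equivExt.injective ?_)
          refine (DualMod.equivExt_map _ _).trans ?_
          rw [DualMod.equivExt_map, ModExt.pre_pre_zero hex]
          exact (map_zero _).symm
      have hstep := ih (i + 1) Ω W' (fun q hq => by
        refine subsingleton_of_forall_eq 0 fun x => ?_
        obtain ⟨q, rfl⟩ : ∃ r, q = r + 1 := ⟨q - 1, by lia⟩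
        have := hP q
        have h₁ : Subsingleton (ModExt H (DualMod k H M) H q) :=
          have := hW q (by lia)
          ModExt.subsingleton_of_preEquiv (M := W) ((LinearEquiv.ofEq _ _ htopW).trans
            Submodule.topEquiv)
        obtain ⟨y, rfl⟩ := ModExt.pre_exact₃ hsW x (Subsingleton.elim _ _)
        rw [Subsingleton.elim y 0, map_zero])
        (by
          have := hext 1 le_rfl
          let δ : DualMod k H Ω →ₗ[k] ModExt H M H 1 :=
            { toFun := fun f => ModExt.preδ hex (DualMod.equivExt f)
              map_add' := fun f g => by rw [map_add, map_add]
              map_smul' := fun c f => by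
                rw [map_smul]
                refine ModExt.preδ_smul hex (fun _ _ => rfl) (fun c m => ?_) c _
                rw [← algebraMap_smul H, map_smul, algebraMap_smul] }
          exact Module.Finite.of_injective ((W'.restrictScalars k).liftQ δ
            (fun f hf => (hs f).1 hf)) (LinearMap.ker_eq_bot.1
              (Submodule.ker_liftQ_eq_bot _ _ _ (fun f hf => (hs f).2 hf))))
        (fun q hq => by
          have := hext (q + 1) (by lia)
          let δ : ModExt H Ω H q →ₗ[k] ModExt H M H (q + 1) :=
            { toFun := ModExt.preδ hex
              map_add' := map_add _
              map_smul' := fun c f => by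
                refine ModExt.preδ_smul hex (fun _ _ => rfl) (fun c m => ?_) c _
                rw [← algebraMap_smul H, map_smul, algebraMap_smul] }
          refine Module.Finite.of_injective δ ?_
          rw [← LinearMap.ker_eq_bot, LinearMap.ker_eq_bot']
          intro x hx
          obtain ⟨q, rfl⟩ : ∃ r, q = r + 1 := ⟨q - 1, by lia⟩
          have := hΩ q
          obtain ⟨y, rfl⟩ := ModExt.pre_exact₁ hex x hx
          rw [Subsingleton.elim y 0, map_zero]) (by lia)
      refine subsingleton_of_forall_eq 0 fun x => ?_
      obtain ⟨r, rfl⟩ : ∃ s, r = s + 1 := ⟨r - 1, by lia⟩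
      have := hΩ r
      obtain ⟨y, rfl⟩ := ModExt.pre_exact₃ hex x (Subsingleton.elim _ _)
      rcases Nat.eq_zero_or_pos r with rfl | hpos
      · obtain ⟨f, rfl⟩ := (DualMod.equivExt (k := k)).surjective y
        exact (hs f).1 (hstep.1 ▸ Submodule.mem_top)
      · have := hstep.2 r hpos (by lia)
        rw [Subsingleton.elim y 0, map_zero]

/-- Finite-dimensional modules have extension groups into the algebra only in the top degree. -/
theorem ModExt.subsingleton_of_finiteDimensional {k : Type u'} [Field k] {H : Type u} [Ring H]
    [HopfAlgebra k H] [IsNoetherianRing H] [IsNoetherianRing Hᵐᵒᵖ] [Algebra.FiniteType k H]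
    {D : ℕ} {α : Equiv.Perm (Fin D) → k} (hα : MultilinearIdentity k H α) (h1 : α 1 = 1)
    (hS : Function.Bijective (antipode k : H →ₗ[k] H)) {d : ℕ}
    (htop : ∀ (N : Type u) [AddCommGroup N] [Module H N] (B : Type u) [AddCommGroup B]
        [Module H B] (q : ℕ), d < q → Subsingleton (ModExt H N B q))
    (hd : ∀ (W : Type u) [AddCommGroup W] [Module k W] [Module H W] [IsScalarTower k H W]
        [Module.Finite k W] [Nontrivial W], ¬ Subsingleton (ModExt H W H d))
    (V : Type u) [AddCommGroup V] [Module k V] [Module H V] [IsScalarTower k H V]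
    [Module.Finite k V] (q : ℕ) (hq : q < d) : Subsingleton (ModExt H V H q) := by
  have : Module.Finite H V := Module.Finite.of_restrictScalars_finite k H V
  have hfin := ModExt.finite hα h1 (M := V) (R := k) (fun x m => (algebraMap_smul H x m).symm) H
  have h₀ : Module.Finite k (DualMod k H V) :=
    have := hfin 0
    Module.Finite.equiv (DualMod.equivExt (k := k)).symm
  have hbot : ∀ q, Subsingleton (ModExt H (⊥ : Submodule H (DualMod k H V)) H q) := fun q => by
    refine subsingleton_of_forall_eq 0 fun x => ?_
    rw [← ModExt.pre_id x, Subsingleton.elim LinearMap.id 0, ModExt.pre_zero]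
  obtain ⟨h₁, h₂⟩ := DualMod.eq_top_and_subsingleton hS htop hd (d - 1) 0 V ⊥
    (fun q _ => hbot q) inferInstance (fun p _ => hfin p) (by lia)
  rcases Nat.eq_zero_or_pos q with rfl | hpos
  · refine subsingleton_of_forall_eq 0 fun x => ?_
    obtain ⟨f, rfl⟩ := (DualMod.equivExt (k := k)).surjective x
    have : f = 0 := (Submodule.mem_bot H).1 (h₁ ▸ Submodule.mem_top)
    rw [this, map_zero]
  · exact h₂ q hpos (by lia)

end DualModule

end

section KrullDimension

variable {A : Type*} {B : Type*} [CommRing A] [CommRing B]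

theorem ringKrullDim_le_of_isIntegral (f : A →+* B) (hf : f.IsIntegral) :
    ringKrullDim B ≤ ringKrullDim A := by
  algebraize [f]
  refine Order.krullDim_le_of_strictMono (fun I => PrimeSpectrum.comap f I) fun I J h => ?_
  exact Ideal.IsIntegral.comap_lt_comap (R := A) (I := I.asIdeal) (J := J.asIdeal) h

theorem ringKrullDim_le_of_injective_isIntegral (f : A →+* B) (hi : Function.Injective f)
    (hf : f.IsIntegral) : ringKrullDim A ≤ ringKrullDim B := by
  algebraize [f]
  refine iSup_le fun l => ?_
  obtain ⟨Q, -, hQ, hQ'⟩ := Ideal.exists_ideal_over_prime_of_isIntegral l.head.asIdeal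
    (⊥ : Ideal B) (by
      rw [← RingHom.ker_eq_comap_bot, (RingHom.injective_iff_ker_eq_bot (algebraMap A B)).1 hi]
      exact bot_le)
  have : Q.LiesOver l.head.asIdeal := ⟨hQ'.symm⟩
  obtain ⟨L, hL, -⟩ := Ideal.exists_ltSeries_of_hasGoingUp (S := B) l Q
  rw [← hL]
  exact Order.LTSeries.length_le_krullDim L

end KrullDimension

namespace MvPolynomial

variable {k : Type*} [Field k]

theorem ringKrullDim_fin (n : ℕ) : ringKrullDim (MvPolynomial (Fin n) k) = n := by
  simp

/-- A proper hypersurface in affine space is finite over an affine space of smaller dimension. -/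
theorem exists_lt_finite_quotient {n : ℕ} (hn : 0 < n) {c : MvPolynomial (Fin n) k} (hc : c ≠ 0) :
    ∃ m < n, ∃ ψ : MvPolynomial (Fin m) k →ₐ[k] MvPolynomial (Fin n) k,
      ((Ideal.Quotient.mk (Ideal.span {c})).comp
        (ψ : MvPolynomial (Fin m) k →+* MvPolynomial (Fin n) k)).Finite := by
  suffices ∃ m < n, ∃ g : MvPolynomial (Fin m) k →ₐ[k] MvPolynomial (Fin n) k ⧸ Ideal.span {c},
      g.Finite by
    obtain ⟨m, hm, g, hg⟩ := this
    choose s hs using Ideal.Quotient.mk_surjective (I := Ideal.span {c})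
    refine ⟨m, hm, aeval fun i => s (g (X i)), ?_⟩
    have : (Ideal.Quotient.mkₐ k (Ideal.span {c})).comp (aeval fun i => s (g (X i))) = g := by
      refine algHom_ext fun i => ?_
      simp [hs]
    rw [← this] at hg
    exact hg
  by_cases htop : Ideal.span {c} = ⊤
  · have : Subsingleton (MvPolynomial (Fin n) k ⧸ Ideal.span {c}) :=
      Ideal.Quotient.subsingleton_iff.2 htop
    exact ⟨0, hn, aeval fun _ => 0, RingHom.Finite.of_surjective _
      fun x => ⟨0, Subsingleton.elim _ _⟩⟩
  have : Nontrivial (MvPolynomial (Fin n) k ⧸ Ideal.span {c}) :=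
    Ideal.Quotient.nontrivial_iff.2 htop
  obtain ⟨s, g, hg, hfin⟩ :=
    exists_finite_inj_algHom_of_fg k (MvPolynomial (Fin n) k ⧸ Ideal.span {c})
  refine ⟨s, ?_, g, hfin⟩
  have h₁ := ringKrullDim_le_of_injective_isIntegral g.toRingHom hg
    (RingHom.Finite.to_isIntegral (f := g.toRingHom) hfin)
  have h₂ := ringKrullDim_quotient_succ_le_of_nonZeroDivisor (mem_nonZeroDivisors_of_ne_zero hc)
  rw [ringKrullDim_fin] at h₁ h₂
  have h₃ := (add_le_add_left h₁ 1).trans h₂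
  exact_mod_cast h₃

/-- The coordinate hyperplane of affine `(n + 1)`-space is not finite over an affine space of
dimension less than `n`. -/
theorem le_of_finite_quotient_X {n e : ℕ}
    (f : MvPolynomial (Fin e) k →+* MvPolynomial (Fin (n + 1)) k)
    (hf : ((Ideal.Quotient.mk (Ideal.span {X 0})).comp f).Finite) : n ≤ e := by
  let π : MvPolynomial (Fin (n + 1)) k →ₐ[k] MvPolynomial (Fin n) k :=
    aeval (Fin.cases 0 X)
  have hπ : Function.Surjective π := fun p => by
    refine ⟨rename Fin.succ p, ?_⟩
    rw [aeval_rename]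
    exact aeval_X_left_apply p
  let π' : MvPolynomial (Fin (n + 1)) k ⧸ Ideal.span {(X 0 : MvPolynomial (Fin (n + 1)) k)} →+*
      MvPolynomial (Fin n) k := Ideal.Quotient.lift _ (π : _ →+* _) fun a ha => by
    obtain ⟨b, rfl⟩ := Ideal.mem_span_singleton'.1 ha
    simp [π]
  have h' : π'.Finite := RingHom.Finite.of_surjective _ fun p => by
    obtain ⟨q, rfl⟩ := hπ p
    exact ⟨Ideal.Quotient.mk _ q, rfl⟩
  have := ringKrullDim_le_of_isIntegral _ (h'.comp hf).to_isIntegral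
  rw [ringKrullDim_fin, ringKrullDim_fin] at this
  exact_mod_cast this

end MvPolynomial

theorem Ideal.sup_mul_sup_le {R : Type*} [CommRing R] (I J K : Ideal R) :
    (I ⊔ K) * (J ⊔ K) ≤ I * J ⊔ K := by
  have h₁ : I * K ≤ K := Ideal.mul_le_right
  have h₂ : K * (J ⊔ K) ≤ K := Ideal.mul_le_left
  rw [Ideal.sup_mul, Ideal.mul_sup]
  exact sup_le (sup_le le_sup_left (h₁.trans le_sup_right)) (h₂.trans le_sup_right)

/-- Ideals containing a product of ideals whose quotients are finite over polynomial rings in at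
most `e` variables. -/
inductive Ideal.IsSmall (k : Type*) [Field k] {R : Type*} [CommRing R] [Algebra k R] (e : ℕ) :
    Ideal R → Prop
  | base {e' : ℕ} (he : e' ≤ e) (I : Ideal R) (f : MvPolynomial (Fin e') k →ₐ[k] R)
      (hf : ((Ideal.Quotient.mk I).comp (f : MvPolynomial (Fin e') k →+* R)).Finite) : IsSmall k e I
  | mul {I J : Ideal R} : IsSmall k e I → IsSmall k e J → IsSmall k e (I * J)
  | mono {I J : Ideal R} : I ≤ J → IsSmall k e I → IsSmall k e J

namespace Ideal.IsSmall

variable {k : Type*} [Field k] {R : Type*} [CommRing R] [Algebra k R] {e : ℕ}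

protected theorem top : IsSmall k e (⊤ : Ideal R) :=
  have : Subsingleton (R ⧸ (⊤ : Ideal R)) := Ideal.Quotient.subsingleton_iff.2 rfl
  base (Nat.zero_le e) _ (MvPolynomial.aeval fun _ => 0) (RingHom.Finite.of_surjective _
    fun _ => ⟨0, Subsingleton.elim _ _⟩)

theorem weaken {e' : ℕ} (he : e ≤ e') {I : Ideal R} (h : IsSmall k e I) : IsSmall k e' I := by
  induction h with
  | base h I f hf => exact base (h.trans he) I f hf
  | mul _ _ h₁ h₂ => exact mul h₁ h₂
  | mono h _ h' => exact mono h h'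

protected theorem bot {n : ℕ} (hn : n ≤ e) :
    IsSmall k e (⊥ : Ideal (MvPolynomial (Fin n) k)) :=
  base hn _ (AlgHom.id k _) (RingHom.Finite.of_surjective _ Ideal.Quotient.mk_surjective)

theorem map_sup {R' : Type*} [CommRing R'] [Algebra k R'] (ψ : R →ₐ[k] R') (K : Ideal R')
    (hψ : ((Ideal.Quotient.mk K).comp (ψ : R →+* R')).Finite) {I : Ideal R}
    (h : IsSmall k e I) : IsSmall k e (I.map (ψ : R →+* R') ⊔ K) := by
  induction h with
  | base he I f hf =>
    refine base he _ (ψ.comp f) ?_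
    let J := I.map (ψ : R →+* R') ⊔ K
    let a : R ⧸ I →+* R' ⧸ J := Ideal.quotientMap J (ψ : R →+* R')
      (Ideal.map_le_iff_le_comap.1 le_sup_left)
    let b : R' ⧸ K →+* R' ⧸ J := Ideal.Quotient.factor le_sup_right
    have hb : b.Finite := RingHom.Finite.of_surjective _ (Ideal.Quotient.factor_surjective _)
    have hab : a.comp (Ideal.Quotient.mk I) = b.comp ((Ideal.Quotient.mk K).comp ψ) := by
      ext x; rfl
    have ha : a.Finite := RingHom.Finite.of_comp_finite (f := Ideal.Quotient.mk I)
      (hab ▸ hb.comp hψ)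
    exact ha.comp hf
  | @mul I J _ _ h₁ h₂ =>
    refine mono ?_ (mul h₁ h₂)
    rw [Ideal.map_mul]
    exact Ideal.sup_mul_sup_le _ _ K
  | mono h _ h' => exact mono (sup_le_sup_right (Ideal.map_mono h) K) h'

theorem le_of_le_span_X {n : ℕ} {I : Ideal (MvPolynomial (Fin (n + 1)) k)}
    (h : IsSmall k e I) (hI : I ≤ Ideal.span {MvPolynomial.X 0}) : n ≤ e := by
  have hp : (Ideal.span {(MvPolynomial.X 0 : MvPolynomial (Fin (n + 1)) k)}).IsPrime :=
    (Ideal.span_singleton_prime (MvPolynomial.X_ne_zero 0)).2 (MvPolynomial.X_prime)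
  induction h with
  | base he I f hf =>
    refine (MvPolynomial.le_of_finite_quotient_X f.toRingHom ?_).trans he
    exact RingHom.Finite.comp (g := Ideal.Quotient.factor hI)
      (RingHom.Finite.of_surjective _ (Ideal.Quotient.factor_surjective _)) hf
  | mul _ _ h₁ h₂ => exact ((hp.mul_le).1 hI).elim h₁ h₂
  | mono h _ h' => exact h' (h.trans hI)

end Ideal.IsSmall

theorem Module.Finite.compHom_of_killed {S R M : Type*} [CommRing S] [CommRing R] [AddCommGroup M]
    [Module R M] [Module.Finite R M] (ψ : S →+* R) {I : Ideal R}
    (hψ : ((Ideal.Quotient.mk I).comp ψ).Finite) (hI : ∀ a ∈ I, ∀ m : M, a • m = 0) :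
    let _ : Module S M := Module.compHom M ψ
    Module.Finite S M := by
  let _ : Module S M := Module.compHom M ψ
  algebraize [(Ideal.Quotient.mk I).comp ψ]
  let _ : Module (R ⧸ I) M :=
    Module.IsTorsionBySet.module (R := R) (M := M) (I := I) (fun x a => hI a a.2 x)
  have : IsScalarTower S (R ⧸ I) M := ⟨fun a b x => by
    obtain ⟨b, rfl⟩ := Ideal.Quotient.mk_surjective b
    rw [Algebra.smul_def, mul_smul]
    rfl⟩
  have : IsScalarTower R (R ⧸ I) M := ⟨fun a b x => by
    obtain ⟨b, rfl⟩ := Ideal.Quotient.mk_surjective b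
    rw [Algebra.smul_def, mul_smul]
    rfl⟩
  have : Module.Finite (R ⧸ I) M :=
    Module.Finite.of_restrictScalars_finite R _ M
  exact Module.Finite.trans (R ⧸ I) M

namespace Submodule

variable {H : Type u} [Ring H] {M : Type u} [AddCommGroup M] [Module H M]
variable {R : Type*} [CommRing R] [Module R M] [SMulCommClass R H M]
variable (N : Submodule H M) (hN : ∀ (r : R), ∀ m ∈ N, r • m ∈ N)

/-- The action on a stable submodule of a ring commuting with the base ring. -/
abbrev stableModule : Module R N :=
  let _ : SMul R N := ⟨fun r x => ⟨r • (x : M), hN r x x.2⟩⟩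
  N.injective_subtype.module R N.subtype.toAddMonoidHom fun _ _ => rfl

/-- The action on the quotient by a stable submodule of a ring commuting with the base ring. -/
abbrev stableQuotientModule : Module R (M ⧸ N) :=
  let _ : SMul R (M ⧸ N) := ⟨fun r => N.mapQ N (Module.toModuleEnd H M r) (hN r)⟩
  N.mkQ_surjective.module R N.mkQ.toAddMonoidHom fun _ _ => rfl

theorem stableModule_smulCommClass :
    let _ : Module R N := N.stableModule hN
    SMulCommClass R H N :=
  let _ : Module R N := N.stableModule hN
  ⟨fun r h x => Subtype.ext (smul_comm r h (x : M))⟩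

theorem stableQuotientModule_smulCommClass :
    let _ : Module R (M ⧸ N) := N.stableQuotientModule hN
    SMulCommClass R H (M ⧸ N) :=
  let _ : Module R (M ⧸ N) := N.stableQuotientModule hN
  ⟨fun r h x => by
    obtain ⟨x, rfl⟩ := N.mkQ_surjective x
    exact (N.mapQ N (Module.toModuleEnd H M r) (hN r)).map_smul h _⟩

theorem stableModule_finite [IsNoetherianRing R] [Module.Finite R M] :
    let _ : Module R N := N.stableModule hN
    Module.Finite R N :=
  let _ : Module R N := N.stableModule hN
  Module.Finite.of_injective
    ({ N.subtype.toAddMonoidHom with map_smul' := fun _ _ => rfl } : N →ₗ[R] M)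
    N.injective_subtype

theorem stableQuotientModule_finite [Module.Finite R M] :
    let _ : Module R (M ⧸ N) := N.stableQuotientModule hN
    Module.Finite R (M ⧸ N) :=
  let _ : Module R (M ⧸ N) := N.stableQuotientModule hN
  Module.Finite.of_surjective
    ({ N.mkQ.toAddMonoidHom with map_smul' := fun _ _ => rfl } : M →ₗ[R] M ⧸ N)
    N.mkQ_surjective

end Submodule

/-- A module over `H` and over a polynomial ring in `n` variables, with commuting compatible
actions, and finitely generated over both. -/
structure IsBifinite (k : Type u') [Field k] (H : Type u) [Ring H] [Algebra k H] (n : ℕ)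
    (M : Type u) [AddCommGroup M] [Module H M] [Module (MvPolynomial (Fin n) k) M] : Prop where
  comm : SMulCommClass (MvPolynomial (Fin n) k) H M
  finite_left : Module.Finite H M
  finite_right : Module.Finite (MvPolynomial (Fin n) k) M
  compat : ∀ (x : k) (m : M),
    algebraMap k (MvPolynomial (Fin n) k) x • m = algebraMap k H x • m

namespace IsBifinite

variable {k : Type u'} [Field k] {H : Type u} [Ring H] [Algebra k H] {n : ℕ}
variable {M : Type u} [AddCommGroup M] [Module H M] [Module (MvPolynomial (Fin n) k) M]

theorem submodule [IsNoetherianRing H] (h : IsBifinite k H n M) (N : Submodule H M)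
    (hN : ∀ (r : MvPolynomial (Fin n) k), ∀ m ∈ N, r • m ∈ N) :
    let _ := h.comm
    let _ := N.stableModule hN
    IsBifinite k H n N :=
  let _ := h.comm
  let _ := N.stableModule hN
  have := h.finite_left
  have := h.finite_right
  ⟨N.stableModule_smulCommClass hN, inferInstance, N.stableModule_finite hN,
    fun x m => Subtype.ext (h.compat x m)⟩

theorem quotient (h : IsBifinite k H n M) (N : Submodule H M)
    (hN : ∀ (r : MvPolynomial (Fin n) k), ∀ m ∈ N, r • m ∈ N) :
    let _ := h.comm
    let _ := N.stableQuotientModule hN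
    IsBifinite k H n (M ⧸ N) :=
  let _ := h.comm
  let _ := N.stableQuotientModule hN
  have := h.finite_left
  have := h.finite_right
  ⟨N.stableQuotientModule_smulCommClass hN, inferInstance, N.stableQuotientModule_finite hN,
    fun x m => by
      obtain ⟨m, rfl⟩ := N.mkQ_surjective m
      exact congrArg N.mkQ (h.compat x m)⟩

theorem compHom {m : ℕ} (h : IsBifinite k H n M)
    (ψ : MvPolynomial (Fin m) k →ₐ[k] MvPolynomial (Fin n) k) {I : Ideal (MvPolynomial (Fin n) k)}
    (hψ : ((Ideal.Quotient.mk I).comp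
      (ψ : MvPolynomial (Fin m) k →+* MvPolynomial (Fin n) k)).Finite)
    (hI : ∀ a ∈ I, ∀ x : M, a • x = 0) :
    let _ : Module (MvPolynomial (Fin m) k) M :=
      Module.compHom M (ψ : MvPolynomial (Fin m) k →+* MvPolynomial (Fin n) k)
    IsBifinite k H m M :=
  let _ := h.comm
  let _ : Module (MvPolynomial (Fin m) k) M :=
    Module.compHom M (ψ : MvPolynomial (Fin m) k →+* MvPolynomial (Fin n) k)
  { comm := ⟨fun a b x => smul_comm (ψ a) b x⟩
    finite_left := h.finite_left
    finite_right :=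
      have := h.finite_right
      Module.Finite.compHom_of_killed _ hψ hI
    compat := fun x y => by
      refine Eq.trans ?_ (h.compat x y)
      exact congrArg (· • y) (ψ.commutes x) }

end IsBifinite

/-- Finiteness and vanishing conditions on the extension groups of an algebra. -/
structure ExtBounds (k : Type u') [Field k] (H : Type u) [Ring H] [Algebra k H] (d : ℕ) :
    Prop where
  finite : ∀ {n : ℕ} {M : Type u} [AddCommGroup M] [Module H M]
    [Module (MvPolynomial (Fin n) k) M] (h : IsBifinite k H n M) (q : ℕ),
    let _ := h.comm
    Module.Finite (MvPolynomial (Fin n) k) (ModExt H M H q)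
  subsingleton_of_lt : ∀ (N : Type u) [AddCommGroup N] [Module H N] (B : Type u) [AddCommGroup B]
    [Module H B] (q : ℕ), d < q → Subsingleton (ModExt H N B q)
  subsingleton_of_finite : ∀ (V : Type u) [AddCommGroup V] [Module k V] [Module H V]
    [IsScalarTower k H V] [Module.Finite k V] (q : ℕ), q < d → Subsingleton (ModExt H V H q)

/-- The vanishing and smallness of the extension groups of bifinite modules. -/
structure ExtSmall (k : Type u') [Field k] (H : Type u) [Ring H] [Algebra k H] (d n : ℕ)
    (M : Type u) [AddCommGroup M] [Module H M] [Module (MvPolynomial (Fin n) k) M]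
    [SMulCommClass (MvPolynomial (Fin n) k) H M] : Prop where
  vanish : ∀ q, q + n < d → Subsingleton (ModExt H M H q)
  small : ∀ q e, q + e = d → ∃ I : Ideal (MvPolynomial (Fin n) k), I.IsSmall k e ∧
    ∀ a ∈ I, ∀ x : ModExt H M H q, a • x = 0

namespace ExtBounds

variable {k : Type u'} [Field k] {H : Type u} [Ring H] [Algebra k H] {d : ℕ}

theorem extSmall_zero (E : ExtBounds k H d) {M : Type u} [AddCommGroup M] [Module H M]
    [Module (MvPolynomial (Fin 0) k) M] (h : IsBifinite k H 0 M) :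
    let _ := h.comm
    ExtSmall k H d 0 M := by
  let _ := h.comm
  let _ : Module k M := Module.compHom M (algebraMap k H)
  have : IsScalarTower k H M := ⟨fun a b m => by
    rw [Algebra.smul_def, mul_smul]; rfl⟩
  have : IsScalarTower k (MvPolynomial (Fin 0) k) M := ⟨fun a b m => by
    rw [Algebra.smul_def, mul_smul]; exact h.compat a _⟩
  have : Module.Finite k (MvPolynomial (Fin 0) k) :=
    Module.Finite.of_surjective (Algebra.linearMap k (MvPolynomial (Fin 0) k))
      (MvPolynomial.C_surjective (Fin 0))
  have := h.finite_right
  have : Module.Finite k M := Module.Finite.trans (MvPolynomial (Fin 0) k) M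
  have hv : ∀ q, q < d → Subsingleton (ModExt H M H q) := E.subsingleton_of_finite M
  refine ⟨hv, fun q e hqe => ?_⟩
  rcases Nat.eq_zero_or_pos e with rfl | he
  · refine ⟨⊥, Ideal.IsSmall.bot le_rfl, fun a ha x => ?_⟩
    rw [(Ideal.mem_bot).1 ha, zero_smul]
  · have := hv q (by lia)
    exact ⟨⊤, Ideal.IsSmall.top, fun a _ x => Subsingleton.elim _ _⟩

/-- Modules killed by a nonzero polynomial, by restriction to fewer variables. -/
theorem extSmall_of_killed {n : ℕ} (hn : 0 < n)
    (ih : ∀ m < n, ∀ {M : Type u} [AddCommGroup M] [Module H M]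
      [Module (MvPolynomial (Fin m) k) M] (h : IsBifinite k H m M),
      let _ := h.comm
      ExtSmall k H d m M)
    {M : Type u} [AddCommGroup M] [Module H M]
    [Module (MvPolynomial (Fin n) k) M] (h : IsBifinite k H n M) {c : MvPolynomial (Fin n) k}
    (hc : c ≠ 0) (hcM : ∀ m : M, c • m = 0) :
    let _ := h.comm
    (∀ q, q + n ≤ d → Subsingleton (ModExt H M H q)) ∧ ExtSmall k H d n M := by
  let _ := h.comm
  obtain ⟨m, hm, ψ, hψ⟩ := MvPolynomial.exists_lt_finite_quotient hn hc
  let _ : Module (MvPolynomial (Fin m) k) M :=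
    Module.compHom M (ψ : MvPolynomial (Fin m) k →+* MvPolynomial (Fin n) k)
  have h' : IsBifinite k H m M := h.compHom ψ hψ fun a ha x => by
    obtain ⟨z, rfl⟩ := Ideal.mem_span_singleton'.1 ha
    rw [mul_smul, hcM, smul_zero]
  let _ := h'.comm
  have key := ih m hm h'
  refine ⟨fun q hq => key.vanish q (by lia), fun q hq => key.vanish q (by lia), fun q e hqe => ?_⟩
  obtain ⟨I, hI, hI'⟩ := key.small q e hqe
  refine ⟨_, hI.map_sup ψ _ hψ, fun a ha x => ?_⟩
  let A : Ideal (MvPolynomial (Fin n) k) := Module.annihilator _ (ModExt H M H q)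
  suffices I.map (ψ : MvPolynomial (Fin m) k →+* MvPolynomial (Fin n) k) ⊔ Ideal.span {c} ≤ A from
    Module.mem_annihilator.1 (this ha) x
  refine sup_le (Ideal.map_le_iff_le_comap.2 fun b hb => Module.mem_annihilator.2 fun x => ?_)
    ((Ideal.span_singleton_le_iff_mem _).2 (Module.mem_annihilator.2 fun x => ?_))
  · exact hI' b hb x
  · refine (congrArg (fun f => ModExt.pre f x) (?_ : Module.toModuleEnd H M c = 0)).trans
      (ModExt.pre_zero x)
    ext m
    exact hcM m

end ExtBounds

/-- Consequence of the determinant trick for faithful modules. -/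
theorem Ideal.le_span_of_forall_exists_smul {R X : Type*} [CommRing R] [AddCommGroup X] [Module R X]
    [Module.Finite R X] {t : R} {I : Ideal R} (hP : (Ideal.span {t}).IsPrime)
    (hX : ∀ c : R, (∀ x : X, c • x = 0) → c = 0)
    (hI : ∀ a ∈ I, ∀ x : X, ∃ y : X, t • y = a • x) : I ≤ Ideal.span {t} := by
  intro a ha
  obtain ⟨p, hp, -, hcoeff, hp0⟩ :=
    LinearMap.exists_monic_and_natDegree_eq_and_coeff_mem_pow_and_aeval_eq_zero R
      (algebraMap R (Module.End R X) a) (Ideal.span {t}) (by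
        rintro _ ⟨x, rfl⟩
        obtain ⟨y, hy⟩ := hI a ha x
        refine (show a • x ∈ _ from ?_)
        rw [← hy]
        exact Submodule.smul_mem_smul (Ideal.mem_span_singleton_self t)
          (Submodule.mem_top (x := y)))
  have h0 : p.eval a = 0 := hX _ fun x => by
    rw [Polynomial.aeval_algebraMap_apply] at hp0
    exact LinearMap.congr_fun hp0 x
  refine hP.mem_of_pow_mem p.natDegree ?_
  rw [Polynomial.eval_eq_sum_range, Finset.sum_range_succ, hp.coeff_natDegree, one_mul] at h0
  rw [eq_neg_of_add_eq_zero_right h0]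
  refine neg_mem (Ideal.sum_mem _ fun i hi => Ideal.mul_mem_right _ _ ?_)
  exact Ideal.pow_le_self (Nat.sub_ne_zero_of_lt (Finset.mem_range.1 hi)) (hcoeff i)

namespace ExtBounds

variable {k : Type u'} [Field k] {H : Type u} [Ring H] [Algebra k H] {d : ℕ}

/-- The smallness of extension groups for all bifinite modules in `n` variables. -/
abbrev Controlled (k : Type u') [Field k] (H : Type u) [Ring H] [Algebra k H] (d n : ℕ) : Prop :=
  ∀ {M : Type u} [AddCommGroup M] [Module H M] [Module (MvPolynomial (Fin n) k) M]
    (h : IsBifinite k H n M),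
    let _ := h.comm
    ExtSmall k H d n M

section TorsionFree

variable {n : ℕ} {M : Type u} [AddCommGroup M] [Module H M] [Module (MvPolynomial (Fin n) k) M]

/-- The connecting map for multiplication by a nonzero polynomial on a torsion-free module. -/
theorem exists_connecting (E : ExtBounds k H d) (hn : 0 < n) (ih : ∀ m < n, Controlled k H d m)
    (h : IsBifinite k H n M)
    {c : MvPolynomial (Fin n) k} (hc : c ≠ 0) (hcM : ∀ m : M, c • m = 0 → m = 0) (q : ℕ) :
    let _ := h.comm
    (q + 1 + n ≤ d ∨ d ≤ q → ∀ x : ModExt H M H q, ∃ y : ModExt H M H q, c • y = x) ∧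
    ∀ e, q + 1 + e = d → ∃ I : Ideal (MvPolynomial (Fin n) k), I.IsSmall k e ∧
      ∀ a ∈ I, ∀ x : ModExt H M H q, ∃ y : ModExt H M H q, c • y = a • x := by
  let _ := h.comm
  let f := Module.toModuleEnd H M c
  have hf : ∀ m, f m = c • m := fun _ => rfl
  have hN : ∀ (r : MvPolynomial (Fin n) k), ∀ m ∈ LinearMap.range f, r • m ∈ LinearMap.range f := by
    rintro r _ ⟨m, rfl⟩
    exact ⟨r • m, (smul_comm c r m)⟩
  let _ := (LinearMap.range f).stableQuotientModule hN
  have hb := h.quotient (LinearMap.range f) hN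
  let _ := hb.comm
  have hex : IsShortExact f (LinearMap.range f).mkQ :=
    IsShortExact.of_injective f ((injective_iff_map_eq_zero f).2 hcM)
  obtain ⟨h₁, h₂⟩ := extSmall_of_killed hn ih hb hc (fun m => by
    obtain ⟨m, rfl⟩ := (LinearMap.range f).mkQ_surjective m
    exact (Submodule.Quotient.mk_eq_zero _).2 ⟨m, rfl⟩)
  refine ⟨fun hq x => ?_, fun e hqe => ?_⟩
  · have := hq.elim (h₁ (q + 1)) fun hq =>
      E.subsingleton_of_lt (M ⧸ LinearMap.range f) H (q + 1) (by lia)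
    exact ModExt.pre_exact₁ hex x (Subsingleton.elim _ _)
  · obtain ⟨I, hI, hI'⟩ := h₂.small (q + 1) e hqe
    refine ⟨I, hI, fun a ha x => ModExt.pre_exact₁ hex _ ?_⟩
    exact (ModExt.preδ_smul hex (fun r m => (smul_comm r c m).symm) (fun _ _ => rfl) a x).trans
      (hI' a ha _)

set_option maxHeartbeats 1000000 in
/-- High extension groups of torsion-free bifinite modules are torsion. -/
theorem exists_ne_zero_smul_eq_zero (E : ExtBounds k H d) (hn : 0 < n)
    (ih : ∀ m < n, Controlled k H d m) (h : IsBifinite k H n M)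
    (hM : ∀ c : MvPolynomial (Fin n) k, c ≠ 0 → ∀ m : M, c • m = 0 → m = 0) (q : ℕ)
    (hq : d < n + q) :
    let _ := h.comm
    ∃ c : MvPolynomial (Fin n) k, c ≠ 0 ∧ ∀ x : ModExt H M H q, c • x = 0 := by
  let _ := h.comm
  refine by_contra fun hne => ?_
  have hX : ∀ c : MvPolynomial (Fin n) k, (∀ x : ModExt H M H q, c • x = 0) → c = 0 :=
    fun c hc => by_contra fun h => hne ⟨c, h, hc⟩
  obtain ⟨n, rfl⟩ : ∃ n', n = n' + 1 := ⟨n - 1, by lia⟩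
  have : Module.Finite (MvPolynomial (Fin (n + 1)) k) (ModExt H M H q) := E.finite h q
  have hp : (Ideal.span {(MvPolynomial.X 0 : MvPolynomial (Fin (n + 1)) k)}).IsPrime :=
    (Ideal.span_singleton_prime (MvPolynomial.X_ne_zero 0)).2 MvPolynomial.X_prime
  have hkey := fun I => Ideal.le_span_of_forall_exists_smul (X := ModExt H M H q) (I := I) hp hX
  have hc := exists_connecting E hn ih h (MvPolynomial.X_ne_zero 0)
      (hM _ (MvPolynomial.X_ne_zero 0)) q
  rcases Nat.lt_or_ge q d with hlt | hge
  · obtain ⟨I, hI, hI'⟩ := hc.2 (d - q - 1) (by lia)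
    have := hI.le_of_le_span_X (hkey I hI')
    lia
  · refine hp.ne_top (top_le_iff.1 (hkey ⊤ fun a _ x => hc.1 (Or.inr hge) _))

theorem exists_isSmall_of_torsionFree (E : ExtBounds k H d) (hn : 0 < n)
    (ih : ∀ m < n, Controlled k H d m) (h : IsBifinite k H n M)
    (hM : ∀ c : MvPolynomial (Fin n) k, c ≠ 0 → ∀ m : M, c • m = 0 → m = 0) (q : ℕ)
    (hq : d < n + q) :
    let _ := h.comm
    (d ≤ q → ∀ x : ModExt H M H q, x = 0) ∧
    ∀ e, q + 1 + e = d → ∃ I : Ideal (MvPolynomial (Fin n) k), I.IsSmall k e ∧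
      ∀ a ∈ I, ∀ x : ModExt H M H q, a • x = 0 := by
  let _ := h.comm
  obtain ⟨c, hc, hc'⟩ := E.exists_ne_zero_smul_eq_zero hn ih h hM q hq
  have key := exists_connecting E hn ih h hc (hM c hc) q
  refine ⟨fun hd x => ?_, fun e hqe => ?_⟩
  · obtain ⟨y, hy⟩ := key.1 (Or.inr hd) x
    exact hy.symm.trans (hc' y)
  · obtain ⟨I, hI, hI'⟩ := key.2 e hqe
    refine ⟨I, hI, fun a ha x => ?_⟩
    obtain ⟨y, hy⟩ := hI' a ha x
    exact hy.symm.trans (hc' y)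

theorem extSmall_of_torsionFree (E : ExtBounds k H d) (hn : 0 < n)
    (ih : ∀ m < n, Controlled k H d m) (h : IsBifinite k H n M)
    (hM : ∀ c : MvPolynomial (Fin n) k, c ≠ 0 → ∀ m : M, c • m = 0 → m = 0) :
    let _ := h.comm
    ExtSmall k H d n M := by
  let _ := h.comm
  refine ⟨fun q hq => ?_, fun q e hqe => ?_⟩
  · have : Module.Finite (MvPolynomial (Fin n) k) (ModExt H M H q) := E.finite h q
    have hsurj := fun c (hc : c ≠ 0) =>
      (exists_connecting E hn ih h hc (hM c hc) q).1 (Or.inl (by lia))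
    let t : MvPolynomial (Fin n) k := MvPolynomial.X ⟨0, hn⟩
    obtain ⟨r, hr, hr'⟩ :=
      Submodule.exists_sub_one_mem_and_smul_eq_zero_of_fg_of_le_smul (Ideal.span {t})
      (⊤ : Submodule (MvPolynomial (Fin n) k) (ModExt H M H q)) Module.Finite.fg_top (fun x _ => by
        obtain ⟨y, rfl⟩ := hsurj t (MvPolynomial.X_ne_zero _) x
        exact Submodule.smul_mem_smul (Ideal.mem_span_singleton_self t)
          (Submodule.mem_top (x := y)))
    have hr0 : r ≠ 0 := by
      rintro rfl
      have hp := (Ideal.span_singleton_prime (MvPolynomial.X_ne_zero _)).2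
        (MvPolynomial.X_prime (R := k) (i := (⟨0, hn⟩ : Fin n)))
      refine hp.ne_top ((Ideal.eq_top_iff_one _).2 ?_)
      have := neg_mem hr
      rwa [zero_sub, neg_neg] at this
    refine subsingleton_of_forall_eq 0 fun x => ?_
    obtain ⟨y, rfl⟩ := hsurj r hr0 x
    exact hr' y Submodule.mem_top
  · rcases Nat.lt_or_ge d (n + q) with hlt | hge
    · have key := E.exists_isSmall_of_torsionFree hn ih h hM q hlt
      rcases Nat.eq_zero_or_pos e with rfl | he
      · exact ⟨⊤, Ideal.IsSmall.top, fun a _ x => key.1 (by lia) _⟩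
      · obtain ⟨I, hI, hI'⟩ := key.2 (e - 1) (by lia)
        exact ⟨I, hI.weaken (by lia), hI'⟩
    · refine ⟨⊥, Ideal.IsSmall.bot (by lia), fun a ha x => ?_⟩
      rw [(Ideal.mem_bot).1 ha, zero_smul]

end TorsionFree

theorem controlled (E : ExtBounds k H d) [IsNoetherianRing H] (n : ℕ) : Controlled k H d n := by
  induction n using Nat.strong_induction_on with
  | _ n ih =>
  intro M _ _ _ h
  let _ := h.comm
  rcases Nat.eq_zero_or_pos n with rfl | hn
  · exact E.extSmall_zero h
  have := h.finite_right
  let τ := Submodule.torsion (MvPolynomial (Fin n) k) M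
  obtain ⟨c, hcτ, hc⟩ := Submodule.annihilator_top_inter_nonZeroDivisors
    (Submodule.torsion_isTorsion (R := MvPolynomial (Fin n) k) (M := M))
  have hc0 := nonZeroDivisors.ne_zero hc
  have hτ : ∀ (a : MvPolynomial (Fin n) k), a ≠ 0 → ∀ m : M, a • m = 0 → c • m = 0 :=
    fun a ha m hm => by
      have hmem : m ∈ τ := ⟨⟨a, mem_nonZeroDivisors_of_ne_zero ha⟩, hm⟩
      exact Subtype.ext_iff.1 (Submodule.mem_annihilator.1 hcτ ⟨m, hmem⟩ Submodule.mem_top)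
  let N : Submodule H M := LinearMap.ker (Module.toModuleEnd H M c)
  have hN : ∀ (r : MvPolynomial (Fin n) k), ∀ m ∈ N, r • m ∈ N := fun r m hm => by
    refine (smul_comm c r m).trans ?_
    rw [show c • m = 0 from hm, smul_zero]
  let _ := N.stableModule hN
  let _ := N.stableQuotientModule hN
  have h₁ := h.submodule N hN
  have h₂ := h.quotient N hN
  let _ := h₁.comm
  let _ := h₂.comm
  have k₁ := (extSmall_of_killed hn ih h₁ hc0 fun m => Subtype.ext m.2).2
  have k₂ := E.extSmall_of_torsionFree hn ih h₂ fun a ha m hm => by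
    obtain ⟨m, rfl⟩ := N.mkQ_surjective m
    have : a • m ∈ N := (Submodule.Quotient.mk_eq_zero N).1 hm
    refine (Submodule.Quotient.mk_eq_zero N).2 (hτ (c * a) (mul_ne_zero hc0 ha) m ?_)
    rw [mul_smul]
    exact this
  have hex := IsShortExact.of_submodule N
  refine ⟨fun q hq => ?_, fun q e hqe => ?_⟩
  · have := k₁.vanish q hq
    have := k₂.vanish q hq
    refine subsingleton_of_forall_eq 0 fun x => ?_
    obtain ⟨y, rfl⟩ := ModExt.pre_exact₂ hex x (Subsingleton.elim _ _)
    rw [Subsingleton.elim y 0, map_zero]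
  · obtain ⟨I, hI, hI'⟩ := k₁.small q e hqe
    obtain ⟨J, hJ, hJ'⟩ := k₂.small q e hqe
    refine ⟨J * I, hJ.mul hI, fun a ha x => ?_⟩
    suffices J * I ≤ Module.annihilator _ (ModExt H M H q) from
      Module.mem_annihilator.1 (this ha) x
    refine Ideal.mul_le.2 fun b hb a ha => Module.mem_annihilator.2 fun x => ?_
    obtain ⟨y, hy⟩ := ModExt.pre_exact₂ hex (a • x)
      ((ModExt.pre_smul N.subtype (fun _ _ => rfl) a x).trans (hI' a ha _))
    rw [mul_smul, ← hy]
    exact (ModExt.pre_smul N.mkQ (fun _ _ => rfl) b y).symm.trans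
      ((congrArg _ (hJ' b hb y)).trans (map_zero _))

end ExtBounds

namespace ModExt

variable {H : Type u} [Ring H]

theorem exists_comp_eq_smul {R : Type*} [CommRing R] {M F : Type u} [AddCommGroup M] [Module H M]
    [Module R M] [SMulCommClass R H M] [AddCommGroup F] [Module H F] {p : F →ₗ[H] M}
    (hp : Function.Surjective p) {r : R}
    (hr : ∀ x : ModExt H M (LinearMap.ker p) 1, r • x = 0) :
    ∃ s : M →ₗ[H] F, ∀ m, p (s m) = r • m := by
  have hex := IsShortExact.of_surjective p hp
  obtain ⟨y, hy⟩ := post_exact₃ hex (r • homEquiv.symm (LinearMap.id : M →ₗ[H] M))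
    ((postδ_smul hex r _).trans (hr _))
  refine ⟨homEquiv y, fun m => ?_⟩
  have h1 := LinearMap.congr_fun (homEquiv_post p y) m
  rw [hy, homEquiv_smul_apply, AddEquiv.apply_symm_apply] at h1
  exact h1.symm

theorem exists_extension {M' M M'' B : Type u} [AddCommGroup M'] [Module H M'] [AddCommGroup M]
    [Module H M] [AddCommGroup M''] [Module H M''] [AddCommGroup B] [Module H B]
    {i : M' →ₗ[H] M} {p : M →ₗ[H] M''} (h : IsShortExact i p)
    (hs : Subsingleton (ModExt H M'' B 1)) (f : M' →ₗ[H] B) :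
    ∃ g : M →ₗ[H] B, ∀ m, g (i m) = f m := by
  obtain ⟨y, hy⟩ := pre_exact₁ h (homEquiv.symm f) (Subsingleton.elim _ _)
  refine ⟨homEquiv y, fun m => ?_⟩
  have h1 := LinearMap.congr_fun (homEquiv_pre i y) m
  rw [hy, AddEquiv.apply_symm_apply] at h1
  exact h1.symm

end ModExt

namespace Overring

variable {k : Type u'} [Field k] {H : Type u} [Ring H] [Algebra k H] {P : Ideal H} {g : ℕ}
  {T : Type u} [Ring T] [Algebra (MvPolynomial (Fin g) k) T] (O : Overring k H P g T)

theorem isBifinite [IsNoetherianRing H] :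
    let _ := O.leftModule
    IsBifinite k H g T :=
  let _ := O.leftModule
  { comm := ⟨fun r h t => (mul_smul_comm r (O.φ h) t).symm⟩
    finite_left := O.finite_leftModule
    finite_right := O.finite
    compat := fun x t => by
      rw [Algebra.smul_def]
      exact congrArg (· * t) (O.map_algebraMap x).symm }

variable {d : ℕ} (E : ExtBounds k H d)
include O E

/-- An overring of the quotient by a left associated prime has large dimension. -/
theorem le_of_mem_iff [IsNoetherianRing H] [Nontrivial T] {b : H}
    (hP : ∀ h, h ∈ P ↔ ∀ x, h * x * b = 0) : d ≤ g := by
  let _ := O.leftModule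
  let _ := O.isBifinite.comm
  have hb : ∀ {x y : H}, O.φ x = O.φ y → x * b = y * b := fun {x y} h => by
    have := (hP _).1 (O.sub_mem_of_eq h) 1
    rwa [mul_one, sub_mul, sub_eq_zero] at this
  let f : T →ₗ[H] H :=
    { toFun := fun t => O.σ t * b
      map_add' := fun s t => by
        rw [← add_mul]
        exact hb (by rw [map_add, O.map_σ, O.map_σ, O.map_σ, smul_add])
      map_smul' := fun h t => by
        rw [RingHom.id_apply, smul_eq_mul, ← mul_assoc]
        refine hb ?_
        rw [map_mul, O.map_σ, O.map_σ, mul_smul_comm]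
        rfl }
  by_contra! hlt
  have hs : Subsingleton (ModExt H T H 0) :=
    (E.controlled g O.isBifinite).vanish 0 (by lia)
  have hf : f = 0 := ModExt.homEquiv.symm.injective (Subsingleton.elim _ _)
  refine O.σ_one_notMem ((hP _).2 fun x => ?_)
  refine Eq.trans (hb ?_) (LinearMap.congr_fun hf (O.φ x))
  rw [map_mul, O.map_σ, O.map_σ, smul_one_mul]

/-- In large dimension, the right annihilator of the prime is not too small. -/
theorem exists_forall_exists_mul_eq_zero [IsNoetherianRing H] [Nontrivial T]
    (hd : d ≤ g) :
    g = d ∧ ∃ r : MvPolynomial (Fin g) k, r ≠ 0 ∧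
      ∀ t, ∃ a, (∀ p ∈ P, p * a = 0) ∧ O.φ a = r • t := by
  let _ := O.leftModule
  let _ := O.isBifinite.comm
  have htf : ∀ c : MvPolynomial (Fin g) k, c ≠ 0 → ∀ t : T, c • t = 0 → t = 0 :=
    fun c hc t h => (O.torsionFree c t h).resolve_left hc
  have hkill : ∀ q, d < g + q → ∃ r : MvPolynomial (Fin g) k, r ≠ 0 ∧
      ∀ x : ModExt H T H q, r • x = 0 := fun q hq => by
    rcases Nat.eq_zero_or_pos g with hg | hg
    · have := E.subsingleton_of_lt T H q (by lia)
      exact ⟨1, one_ne_zero, fun x => Subsingleton.elim _ _⟩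
    · exact E.exists_ne_zero_smul_eq_zero hg (fun m _ => E.controlled m) O.isBifinite htf q hq
  have hn : ∀ (M N : Type u) [AddCommGroup M] [Module H M] [AddCommGroup N] [Module H N],
      ∀ i : ℕ, d < i → Subsingleton (ModExt H M N i) := fun M N _ _ _ _ i hi =>
    E.subsingleton_of_lt M N i hi
  have key : ∀ j, d < g + j → ∀ (B : Type u) [AddCommGroup B] [Module H B] [Module.Finite H B],
      ∃ r : MvPolynomial (Fin g) k, r ≠ 0 ∧ ∀ x : ModExt H T B j, r • x = 0 :=
    fun j hj B _ _ _ => by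
    obtain ⟨r, hr, hr'⟩ := ModExt.exists_mem_smul_eq_zero hn (M := T)
      (nonZeroDivisors (MvPolynomial (Fin g) k)) (j := j) (fun q hq => by
        obtain ⟨r, hr, hr'⟩ := hkill q (by lia)
        exact ⟨r, mem_nonZeroDivisors_of_ne_zero hr, hr'⟩) B j le_rfl
    exact ⟨r, nonZeroDivisors.ne_zero hr, hr'⟩
  have : Module.Finite H T := O.finite_leftModule
  refine ⟨hd.antisymm' ?_, ?_⟩
  · by_contra! hlt
    obtain ⟨r, hr, hr'⟩ := key 0 (by lia) T
    have h1 := ModExt.homEquiv_smul_apply r (ModExt.homEquiv.symm (LinearMap.id : T →ₗ[H] T)) 1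
    rw [hr', map_zero, AddEquiv.apply_symm_apply] at h1
    exact one_ne_zero (htf r hr 1 h1.symm)
  · obtain ⟨m, p, hp⟩ := Module.Finite.exists_fin' H T
    obtain ⟨r, hr, hr'⟩ := key 1 (by lia) (LinearMap.ker p)
    obtain ⟨s, hs⟩ := ModExt.exists_comp_eq_smul hp hr'
    refine ⟨O.c * r, mul_ne_zero O.c_ne_zero hr, fun t => ?_⟩
    refine ⟨∑ i, s t i * O.σ (p (Pi.single i 1)), fun x hx => ?_, ?_⟩
    · have h1 : x • t = 0 := by
        refine (show O.φ x * t = 0 from ?_)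
        rw [(O.map_eq_zero x).2 hx, zero_mul]
      have h2 : ∀ i, x * s t i = 0 := fun i => by
        have := congrFun (s.map_smul x t) i
        rw [h1, map_zero] at this
        exact this.symm
      simp_rw [Finset.mul_sum, ← mul_assoc, h2, zero_mul, Finset.sum_const_zero]
    · have h1 : p (s t) = ∑ i, O.φ (s t i) * p (Pi.single i 1) := by
        conv_lhs => rw [← Finset.univ_sum_single (s t), map_sum]
        refine Finset.sum_congr rfl fun i _ => ?_
        rw [← mul_one (s t i), ← smul_eq_mul, Pi.single_smul, map_smul, smul_eq_mul, mul_one]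
        rfl
      rw [map_sum, mul_smul, ← hs, h1, Finset.smul_sum]
      refine Finset.sum_congr rfl fun i _ => ?_
      rw [map_mul, O.map_σ, mul_smul_comm]

end Overring

namespace Ideal

variable {H : Type u} [Ring H]

theorem IsTwoSided.of_span_range_mul (a : H) : (Ideal.span (Set.range (a * ·))).IsTwoSided :=
  ⟨fun {x} y hx => by
    induction hx using Submodule.span_induction with
    | mem x hx =>
      obtain ⟨z, rfl⟩ := hx
      exact Ideal.subset_span ⟨z * y, (mul_assoc _ _ _).symm⟩
    | zero => rw [zero_mul]; exact zero_mem _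
    | add _ _ _ _ h₁ h₂ => rw [add_mul]; exact add_mem h₁ h₂
    | smul b _ _ h => rw [smul_eq_mul, mul_assoc]; exact Ideal.mul_mem_left _ b h⟩

/-- In a noetherian ring there are finitely many primes such that each prime containing a given
ideal contains one of them. -/
theorem exists_finset_isPrimeTwoSided [IsNoetherianRing H] (I : Ideal H) (hI : I.IsTwoSided) :
    ∃ s : Finset (Ideal H), (∀ P ∈ s, P.IsPrimeTwoSided) ∧
      ∀ Q : Ideal H, Q.IsPrimeTwoSided → I ≤ Q → ∃ P ∈ s, P ≤ Q := by
  classical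
  induction I using WellFoundedGT.induction with
  | ind I ih =>
  by_cases hp : I.IsPrimeTwoSided
  · exact ⟨{I}, by simpa using hp, fun Q _ h => ⟨I, by simp, h⟩⟩
  by_cases htop : I = ⊤
  · exact ⟨∅, by simp, fun Q hQ h => absurd (top_le_iff.1 (htop ▸ h)) hQ.ne_top⟩
  obtain ⟨a, b, hab, ha, hb⟩ : ∃ a b, (∀ x, a * x * b ∈ I) ∧ a ∉ I ∧ b ∉ I := by
    by_contra! hc
    exact hp ⟨hI, htop, fun a b hab => or_iff_not_imp_left.2 (hc a b hab)⟩
  have key : ∀ c ∉ I, I < I ⊔ Ideal.span (Set.range (c * ·)) ∧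
      (I ⊔ Ideal.span (Set.range (c * ·))).IsTwoSided := fun c hc => by
    refine ⟨lt_of_le_of_ne le_sup_left fun h => hc ?_, ?_⟩
    · rw [h]
      exact Ideal.mem_sup_right (Ideal.subset_span ⟨1, mul_one c⟩)
    · have := IsTwoSided.of_span_range_mul c
      refine ⟨fun {x} y hx => ?_⟩
      obtain ⟨u, hu, v, hv, rfl⟩ := Submodule.mem_sup.1 hx
      rw [add_mul]
      exact Submodule.add_mem_sup (Ideal.mul_mem_right y _ hu) (Ideal.mul_mem_right y _ hv)
  have hle : ∀ c, ∀ Q : Ideal H, Q.IsPrimeTwoSided → I ≤ Q → c ∈ Q →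
      I ⊔ Ideal.span (Set.range (c * ·)) ≤ Q := fun c Q hQ hIQ hcQ => by
    refine sup_le hIQ (Ideal.span_le.2 ?_)
    rintro _ ⟨x, rfl⟩
    have := hQ.twoSided
    exact Ideal.mul_mem_right x Q hcQ
  obtain ⟨s, hs, hs'⟩ := ih _ (key a ha).1 (key a ha).2
  obtain ⟨t, ht, ht'⟩ := ih _ (key b hb).1 (key b hb).2
  refine ⟨s ∪ t, fun P hP => (Finset.mem_union.1 hP).elim (hs P) (ht P), fun Q hQ hIQ => ?_⟩
  rcases hQ.mem_or_mem a b (fun x => hIQ (hab x)) with h | h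
  · obtain ⟨P, hP, hPQ⟩ := hs' Q hQ (hle a Q hQ hIQ h)
    exact ⟨P, Finset.mem_union_left _ hP, hPQ⟩
  · obtain ⟨P, hP, hPQ⟩ := ht' Q hQ (hle b Q hQ hIQ h)
    exact ⟨P, Finset.mem_union_right _ hP, hPQ⟩

/-- The annihilator of the left ideal generated by an element. -/
def annihilatorOfSpan (b : H) : Ideal H where
  carrier := {h | ∀ x, h * x * b = 0}
  add_mem' hx hy z := by rw [add_mul, add_mul, hx, hy, add_zero]
  zero_mem' x := by rw [zero_mul, zero_mul]
  smul_mem' c h hh x := by rw [smul_eq_mul, mul_assoc c, mul_assoc c, hh, mul_zero]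

/-- A nonzero left ideal contains an element whose associated annihilator is prime. -/
theorem exists_isPrimeTwoSided_annihilatorOfSpan [IsNoetherianRing H] {N : Ideal H} (hN : N ≠ ⊥) :
    ∃ b ∈ N, (annihilatorOfSpan b).IsPrimeTwoSided := by
  obtain ⟨b₀, hb₀, hb₀'⟩ := Submodule.exists_mem_ne_zero_of_ne_bot hN
  obtain ⟨_, ⟨⟨b, hb, hb', rfl⟩, hmax⟩⟩ := set_has_maximal_iff_noetherian.2 ‹IsNoetherianRing H›
    {I : Ideal H | ∃ b ∈ N, b ≠ 0 ∧ annihilatorOfSpan b = I} ⟨_, b₀, hb₀, hb₀', rfl⟩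
  refine ⟨b, hb, ⟨fun {h} y hh x => ?_⟩, fun h => ?_, fun x y hxy => ?_⟩
  · rw [mul_assoc h]
    exact hh (y * x)
  · have := (Ideal.eq_top_iff_one _).1 h 1
    rw [one_mul, one_mul] at this
    exact hb' this
  · refine or_iff_not_imp_right.2 fun hy => ?_
    obtain ⟨h, hh⟩ : ∃ h, y * h * b ≠ 0 := by
      by_contra! hc
      exact hy hc
    have hle : annihilatorOfSpan b ≤ annihilatorOfSpan (y * h * b) := fun p hp z => by
      have := hp (z * (y * h))
      simpa only [mul_assoc] using this
    have heq : annihilatorOfSpan (y * h * b) ≤ annihilatorOfSpan b := by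
      by_contra hc
      exact hmax _ ⟨_, N.mul_mem_left _ hb, hh, rfl⟩ (lt_of_le_not_ge hle hc)
    refine heq fun z => ?_
    have := hxy z h
    simpa only [mul_assoc] using this

end Ideal

section

variable {k : Type u'} [Field k] {H : Type u} [Ring H] [Algebra k H]

/-- The opposite of an overring, viewed as an overring along an anti-automorphism. -/
def Overring.opposite {P : Ideal H} {g : ℕ} {T : Type u} [Ring T]
    [Algebra (MvPolynomial (Fin g) k) T] (O : Overring k H P g T) (hP : P.IsTwoSided)
    (S : H ≃ₐ[k] Hᵐᵒᵖ) :
    Overring k H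
      { carrier := {h | (S h).unop ∈ P}
        add_mem' := fun {a b} ha hb => by
          rw [Set.mem_ofPred, map_add]
          exact P.add_mem ha hb
        zero_mem' := by
          rw [Set.mem_ofPred, map_zero]
          exact P.zero_mem
        smul_mem' := fun a b hb => by
          rw [smul_eq_mul, Set.mem_ofPred, map_mul]
          exact Ideal.mul_mem_right _ P hb } g Tᵐᵒᵖ where
  φ := (RingHom.op O.φ).comp (S : H →+* Hᵐᵒᵖ)
  map_eq_zero h := (MulOpposite.op_eq_zero_iff _).trans (O.map_eq_zero _)
  map_algebraMap x := by
    refine congrArg MulOpposite.op ((congrArg (fun z => O.φ (MulOpposite.unop z))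
      (S.commutes x)).trans (O.map_algebraMap x))
  finite := have := O.finite; Module.Finite.equiv (MulOpposite.opLinearEquiv _)
  torsionFree r t h := (O.torsionFree r t.unop (congrArg MulOpposite.unop h)).imp_right
    (MulOpposite.unop_eq_zero_iff _).1
  c := O.c
  c_ne_zero := O.c_ne_zero
  σ t := S.symm (MulOpposite.op (O.σ t.unop))
  map_σ t := by
    refine congrArg MulOpposite.op ((congrArg (fun z => O.φ (MulOpposite.unop z))
      (S.apply_symm_apply _)).trans (O.map_σ _))

/-- Noetherian affine PI algebras with an anti-automorphism and well-behaved extension groups are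
semiprime. -/
theorem ExtBounds.eq_bot_of_forall_isPrimeTwoSided [IsNoetherianRing H] [Algebra.FiniteType k H]
    {D : ℕ} {α : Equiv.Perm (Fin D) → k} (hα : MultilinearIdentity k H α) (h1 : α 1 = 1)
    (S : H ≃ₐ[k] Hᵐᵒᵖ) {d : ℕ} (E : ExtBounds k H d) {N : Ideal H}
    (hN : ∀ P : Ideal H, P.IsPrimeTwoSided → N ≤ P) : N = ⊥ := by
  by_contra hne
  obtain ⟨b, hb, hP⟩ := Ideal.exists_isPrimeTwoSided_annihilatorOfSpan hne
  obtain ⟨g, T, _, _, ⟨O⟩⟩ := hP.exists_overring hα h1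
  have := O.nontrivial hP.ne_top
  have hg := O.le_of_mem_iff E (b := b) fun h => Iff.rfl
  let O' := O.opposite hP.twoSided S
  obtain ⟨-, r, hr, hr'⟩ := O'.exists_forall_exists_mul_eq_zero E hg
  obtain ⟨a, ha, ha'⟩ := hr' 1
  have h2 : (S a).unop ∈ Ideal.annihilatorOfSpan b := fun x => by
    have h3 := congrArg (fun z => (S z).unop) (ha (S.symm (MulOpposite.op (x * b))) (by
      have := hN _ hP (N.mul_mem_left x hb)
      change (S (S.symm (MulOpposite.op (x * b)))).unop ∈ Ideal.annihilatorOfSpan b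
      rwa [S.apply_symm_apply]))
    simpa [mul_assoc] using h3
  have h4 : r • (1 : Tᵐᵒᵖ) = 0 := ha'.symm.trans ((O'.map_eq_zero a).2 h2)
  exact (O'.torsionFree _ _ h4).elim hr one_ne_zero

end

/-- An ideal of polynomials all of whose bifinite torsion modules have no first extensions by the
base ring. -/
def Ideal.IsNegligible (k : Type u') [Field k] (H : Type u) [Ring H] [Algebra k H] {n : ℕ}
    (K : Ideal (MvPolynomial (Fin n) k)) : Prop :=
  ∀ (M : Type u) [AddCommGroup M] [Module H M] [Module (MvPolynomial (Fin n) k) M],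
    IsBifinite k H n M → (∀ a ∈ K, ∀ m : M, a • m = 0) → Subsingleton (ModExt H M H 1)

namespace Ideal.IsNegligible

variable {k : Type u'} [Field k] {H : Type u} [Ring H] [Algebra k H] {n : ℕ}
  {K L : Ideal (MvPolynomial (Fin n) k)}

protected theorem top : IsNegligible k H (⊤ : Ideal (MvPolynomial (Fin n) k)) := by
  intro M _ _ _ h hM
  have : Subsingleton M := subsingleton_of_forall_eq 0 fun m => by
    rw [← hM 1 trivial m, one_smul]
  refine subsingleton_of_forall_eq 0 fun x => (ModExt.pre_id x).symm.trans ?_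
  rw [Subsingleton.elim (LinearMap.id : M →ₗ[H] M) 0]
  exact ModExt.pre_zero x

theorem mono (hKL : K ≤ L) (hK : K.IsNegligible k H) : L.IsNegligible k H :=
  fun M _ _ _ h hM => hK M h fun a ha => hM a (hKL ha)

theorem mul [IsNoetherianRing H] (hK : K.IsNegligible k H) (hL : L.IsNegligible k H) :
    (K * L).IsNegligible k H := by
  intro M _ _ _ h hM
  let _ := h.comm
  let N : Submodule H M := ⨅ a ∈ L, LinearMap.ker (Module.toModuleEnd H M a)
  have hmem : ∀ {m : M}, m ∈ N ↔ ∀ a ∈ L, a • m = 0 := fun {m} => by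
    simp only [N, Submodule.mem_iInf]
    rfl
  have hN : ∀ (r : MvPolynomial (Fin n) k), ∀ m ∈ N, r • m ∈ N := fun r m hm =>
    hmem.2 fun a ha => by rw [smul_comm, hmem.1 hm a ha, smul_zero]
  let _ := N.stableModule hN
  let _ := N.stableQuotientModule hN
  have h₁ := hL _ (h.submodule N hN) fun a ha m => Subtype.ext (hmem.1 m.2 a ha)
  have h₂ := hK _ (h.quotient N hN) fun a ha m => by
    obtain ⟨m, rfl⟩ := N.mkQ_surjective m
    refine (Submodule.Quotient.mk_eq_zero N).2 (hmem.2 fun b hb => ?_)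
    refine (mul_smul b a m).symm.trans (hM _ ?_ m)
    exact mul_comm a b ▸ Ideal.mul_mem_mul ha hb
  refine subsingleton_of_forall_eq 0 fun x => ?_
  obtain ⟨y, rfl⟩ := ModExt.pre_exact₂ (IsShortExact.of_submodule N) x (Subsingleton.elim _ _)
  rw [Subsingleton.elim y 0, map_zero]

theorem pow [IsNoetherianRing H] (hK : K.IsNegligible k H) (m : ℕ) :
    (K ^ m).IsNegligible k H := by
  induction m with
  | zero => rw [pow_zero, Ideal.one_eq_top]; exact Ideal.IsNegligible.top
  | succ m ih => rw [pow_succ]; exact ih.mul hK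

theorem prod [IsNoetherianRing H] {ι : Type*} (s : Finset ι)
    (K : ι → Ideal (MvPolynomial (Fin n) k)) (hK : ∀ i ∈ s, (K i).IsNegligible k H) :
    (∏ i ∈ s, K i).IsNegligible k H :=
  Finset.prod_induction K (IsNegligible k H) (fun _ _ => mul)
    (by rw [Ideal.one_eq_top]; exact Ideal.IsNegligible.top) hK

theorem of_isSmall [IsNoetherianRing H] {d e : ℕ} (E : ExtBounds k H d) (he : e + 2 ≤ d)
    (hK : K.IsSmall k e) : K.IsNegligible k H := by
  induction hK with
  | @base e' he' I f hf =>
    intro M _ _ _ h hM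
    let _ : Module (MvPolynomial (Fin e') k) M :=
      Module.compHom M (f : MvPolynomial (Fin e') k →+* MvPolynomial (Fin n) k)
    have h' : IsBifinite k H e' M := h.compHom f hf hM
    let _ := h'.comm
    exact (E.controlled e' h').vanish 1 (by lia)
  | mul _ _ h₁ h₂ => exact h₁.mul h₂
  | mono h _ h' => exact h'.mono h

end Ideal.IsNegligible

namespace Overring

variable {k : Type u'} [Field k] {H : Type u} [Ring H] [Algebra k H] {P : Ideal H} {d : ℕ}
  {T : Type u} [Ring T] [Algebra (MvPolynomial (Fin d) k) T] (O : Overring k H P d T)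
  [IsNoetherianRing H] (E : ExtBounds k H d)

include E

theorem exists_isNegligible :
    let _ := O.leftModule
    let _ := O.isBifinite.comm
    ∃ K : Ideal (MvPolynomial (Fin d) k), K.IsNegligible k H ∧
      ∀ q, 1 ≤ q → ∀ a ∈ K, ∀ x : ModExt H T H q, a • x = 0 := by
  let _ := O.leftModule
  let _ := O.isBifinite.comm
  have htf : ∀ c : MvPolynomial (Fin d) k, c ≠ 0 → ∀ t : T, c • t = 0 → t = 0 :=
    fun c hc t h => (O.torsionFree c t h).resolve_left hc
  have key : ∀ q, ∃ K : Ideal (MvPolynomial (Fin d) k), 1 ≤ q → K.IsNegligible k H ∧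
      ∀ a ∈ K, ∀ x : ModExt H T H q, a • x = 0 := fun q => by
    rcases Nat.lt_or_ge d (q + 1) with hq | hq
    · refine ⟨⊤, fun hq1 => ⟨Ideal.IsNegligible.top, fun a _ x => ?_⟩⟩
      rcases Nat.eq_zero_or_pos d with h0 | h0
      · have := E.subsingleton_of_lt T H q (by lia)
        exact Subsingleton.elim _ _
      · exact (E.exists_isSmall_of_torsionFree h0 (fun m _ => E.controlled m) O.isBifinite htf q
          (by lia)).1 (by lia) _
    · by_cases hq1 : 1 ≤ q
      · obtain ⟨I, hI, hI'⟩ := (E.exists_isSmall_of_torsionFree (by lia)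
          (fun m _ => E.controlled m) O.isBifinite htf q (by lia)).2 (d - q - 1) (by lia)
        exact ⟨I, fun _ => ⟨Ideal.IsNegligible.of_isSmall E (by lia) hI, hI'⟩⟩
      · exact ⟨⊤, fun h => absurd h hq1⟩
  choose K hK using key
  refine ⟨∏ q ∈ Finset.Icc 1 d, K q,
    Ideal.IsNegligible.prod _ _ fun q hq => (hK q (Finset.mem_Icc.1 hq).1).1, fun q hq a ha x => ?_⟩
  rcases Nat.lt_or_ge d q with h | h
  · have := E.subsingleton_of_lt T H q h
    exact Subsingleton.elim _ _
  · exact (hK q hq).2 a (Ideal.prod_le_inf.trans (Finset.inf_le (Finset.mem_Icc.2 ⟨hq, h⟩)) ha) x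

/-- An overring of a base ring with well-behaved extension groups is equal to it. -/
theorem surjective_of_closure_eq_top (hP : P = ⊥)
    (hgen : Subring.closure (Set.range O.φ ∪ Set.center T) = ⊤) :
    Function.Surjective O.φ := by
  let _ := O.leftModule
  let _ := O.isBifinite.comm
  have hsmul : ∀ (h : H) (t : T), h • t = O.φ h * t := fun _ _ => rfl
  have hinj : Function.Injective O.φ := (injective_iff_map_eq_zero O.φ).2 fun h hh => by
    have := (O.map_eq_zero h).1 hh
    rwa [hP, Ideal.mem_bot] at this
  have hcancel : ∀ {s t : T}, O.c • s = O.c • t → s = t := O.noZeroSMul O.c O.c_ne_zero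
  let I : Submodule H T :=
    { carrier := {x | ∀ t, ∃ h, O.φ h = t * x}
      add_mem' := fun {x y} hx hy t => by
        obtain ⟨a, ha⟩ := hx t
        obtain ⟨b, hb⟩ := hy t
        exact ⟨a + b, by rw [map_add, ha, hb, mul_add]⟩
      zero_mem' := fun t => ⟨0, by rw [map_zero, mul_zero]⟩
      smul_mem' := fun h x hx t => by
        rw [hsmul, ← mul_assoc]
        exact hx _ }
  have hImem : ∀ {x : T}, x ∈ I ↔ ∀ t, ∃ h, O.φ h = t * x := Iff.rfl
  have hIR : ∀ (r : MvPolynomial (Fin d) k), ∀ x ∈ I, r • x ∈ I := fun r x hx t => by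
    rw [mul_smul_comm, ← smul_mul_assoc]
    exact hx _
  have hcI : ∀ t, O.c • t ∈ I := fun t s => ⟨O.σ (s * t), by rw [O.map_σ, mul_smul_comm]⟩
  have hright : ∀ t, ∀ x ∈ I, x * t ∈ I := by
    intro t
    induction (by rw [hgen]; trivial : t ∈ Subring.closure (Set.range O.φ ∪ Set.center T))
      using Subring.closure_induction with
    | mem t ht =>
      intro x hx s
      rcases ht with ⟨a, rfl⟩ | ht
      · obtain ⟨b, hb⟩ := hx s
        exact ⟨b * a, by rw [map_mul, hb, mul_assoc]⟩
      · rw [← (Set.mem_center_iff.1 ht).comm x, ← mul_assoc]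
        exact hx _
    | zero => intro x _; rw [mul_zero]; exact I.zero_mem
    | one => intro x hx; rwa [mul_one]
    | add a b _ _ ha hb => intro x hx; rw [mul_add]; exact I.add_mem (ha x hx) (hb x hx)
    | neg a _ ha => intro x hx; rw [mul_neg]; exact I.neg_mem (ha x hx)
    | mul a b _ _ ha hb => intro x hx; rw [← mul_assoc]; exact hb _ (ha x hx)
  let J : Ideal (MvPolynomial (Fin d) k) :=
    { carrier := {r | r • (1 : T) ∈ I}
      add_mem' := fun {a b} ha hb => by
        rw [Set.mem_ofPred, add_smul]
        exact I.add_mem ha hb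
      zero_mem' := by
        rw [Set.mem_ofPred, zero_smul]
        exact I.zero_mem
      smul_mem' := fun a b hb => by
        rw [smul_eq_mul, Set.mem_ofPred, mul_smul]
        exact hIR a _ hb }
  have hn : ∀ (M N : Type u) [AddCommGroup M] [Module H M] [AddCommGroup N] [Module H N],
      ∀ i : ℕ, d < i → Subsingleton (ModExt H M N i) := fun M N _ _ _ _ i hi =>
    E.subsingleton_of_lt M N i hi
  have : Module.Finite H T := O.finite_leftModule
  obtain ⟨K, hK, hKq⟩ := O.exists_isNegligible E
  have hJ : J.IsNegligible k H := by
    have hKJ : K ≤ J.radical := fun r hr => by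
      obtain ⟨m, p, hp⟩ := Module.Finite.exists_fin' H T
      obtain ⟨_, ⟨N, rfl⟩, hN⟩ := ModExt.exists_mem_smul_eq_zero hn (M := T)
        (Submonoid.powers r) (j := 1) (fun q hq => ⟨r, Submonoid.mem_powers r, hKq q hq r hr⟩)
        (LinearMap.ker p) 1 le_rfl
      obtain ⟨s, hs⟩ := ModExt.exists_comp_eq_smul hp hN
      refine ⟨N, (?_ : (r ^ N) • (1 : T) ∈ I)⟩
      have h1 : p (s 1) = ∑ i, O.φ (s 1 i) * p (Pi.single i 1) := by
        conv_lhs => rw [← Finset.univ_sum_single (s 1), map_sum]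
        refine Finset.sum_congr rfl fun i _ => ?_
        rw [← mul_one (s 1 i), ← smul_eq_mul, Pi.single_smul, map_smul, smul_eq_mul, mul_one]
        rfl
      refine (congrArg (· ∈ I) ((hs 1).symm.trans h1)).mpr ?_
      refine I.sum_mem fun i _ => hright _ _ fun t => ⟨s t i, hcancel ?_⟩
      have h2 : O.σ t • (1 : T) = O.σ 1 • t := by
        rw [hsmul, hsmul, O.map_σ, O.map_σ, mul_one, smul_one_mul]
      have h3 := congrArg O.φ (congrFun (((s.map_smul _ _).symm.trans
        (congrArg s h2)).trans (s.map_smul _ _)) i)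
      simp only [Pi.smul_apply, smul_eq_mul, map_mul, O.map_σ] at h3
      rw [← smul_mul_assoc, h3, smul_one_mul]
    obtain ⟨N, hN⟩ := Ideal.exists_pow_le_of_le_radical_of_fg hKJ (IsNoetherian.noetherian K)
    exact Ideal.IsNegligible.mono hN (Ideal.IsNegligible.pow hK N)
  let _ : Module (MvPolynomial (Fin d) k) (T ⧸ I) :=
    I.stableQuotientModule (R := MvPolynomial (Fin d) k) hIR
  have hs := hJ _ (O.isBifinite.quotient I hIR) fun a ha m => by
    obtain ⟨t, rfl⟩ := I.mkQ_surjective m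
    refine (Submodule.Quotient.mk_eq_zero I).2 ?_
    refine (?_ : a • t ∈ I)
    rw [← smul_one_mul]
    exact hright _ _ ha
  choose f hf using fun x : I => x.2 1
  simp only [one_mul] at hf
  obtain ⟨F, hF⟩ := ModExt.exists_extension (IsShortExact.of_submodule I) hs
    { toFun := f
      map_add' := fun x y => hinj (by rw [map_add, hf, hf, hf]; rfl)
      map_smul' := fun h x => hinj (by
        rw [RingHom.id_apply, smul_eq_mul, map_mul, hf, hf]; rfl) }
  refine fun t => ⟨F t, hcancel ?_⟩
  have h1 : F (O.σ 1 • t) = O.σ 1 * F t := F.map_smul _ _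
  have h2 : O.σ 1 • t = O.c • t := by rw [hsmul, O.map_σ, smul_one_mul]
  have h3 := (congrArg O.φ (hF ⟨_, hcI t⟩)).trans (hf ⟨_, hcI t⟩)
  refine Eq.trans ?_ h3
  refine Eq.trans ?_ (congrArg O.φ ((congrArg F h2).symm.trans h1)).symm
  rw [map_mul, O.map_σ, smul_one_mul]

end Overring

namespace Overring

section Adjoin

variable {k : Type u'} [Field k] {H : Type u} [Ring H] [Algebra k H] {P : Ideal H} {g : ℕ}
  {T : Type u} [Ring T] [Algebra (MvPolynomial (Fin g) k) T] (O : Overring k H P g T)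

/-- The overring generated by the image of the base ring. -/
noncomputable def adjoin :
    Overring k H P g (Algebra.adjoin (MvPolynomial (Fin g) k) (Set.range O.φ)) where
  φ := O.φ.codRestrict _ fun h => Algebra.subset_adjoin ⟨h, rfl⟩
  map_eq_zero h := by
    rw [← O.map_eq_zero]
    exact Subtype.ext_iff
  map_algebraMap x := Subtype.ext (O.map_algebraMap x)
  finite :=
    have := O.finite
    Module.Finite.of_injective
      (Algebra.adjoin (MvPolynomial (Fin g) k) (Set.range O.φ)).val.toLinearMap
      Subtype.val_injective
  torsionFree r t h := (O.torsionFree r t (congrArg Subtype.val h)).imp_right fun h => Subtype.ext h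
  c := O.c
  c_ne_zero := O.c_ne_zero
  σ t := O.σ t
  map_σ t := Subtype.ext (O.map_σ t)

theorem adjoin_range_adjoin :
    Algebra.adjoin (MvPolynomial (Fin g) k) (Set.range O.adjoin.φ) = ⊤ := by
  have h : Set.range O.adjoin.φ = ((↑) : Algebra.adjoin (MvPolynomial (Fin g) k)
      (Set.range O.φ) → T) ⁻¹' Set.range O.φ := by
    ext t
    exact exists_congr fun h => Subtype.ext_iff
  rw [h, Algebra.adjoin_adjoin_coe_preimage]

end Adjoin

section Pi

variable {k : Type u'} [Field k] {H : Type u} [Ring H] [Algebra k H] {d n : ℕ}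
  {P : Fin n → Ideal H} {T : Fin n → Type u} [∀ i, Ring (T i)]
  [∀ i, Algebra (MvPolynomial (Fin d) k) (T i)] (O : ∀ i, Overring k H (P i) d (T i))

theorem exists_pi (hP : ∀ i, (P i).IsPrimeTwoSided) (hbot : ∀ h, (∀ i, h ∈ P i) → h = 0)
    (hb : ∀ i, ∃ b, b ∉ P i ∧ ∀ j, j ≠ i → b ∈ P j)
    (hr : ∀ i, ∃ r : MvPolynomial (Fin d) k, r ≠ 0 ∧
      ∀ t, ∃ a, (∀ p ∈ P i, p * a = 0) ∧ (O i).φ a = r • t) :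
    ∃ O' : Overring k H ⊥ d (∀ i, T i), ∀ h i, O'.φ h i = (O i).φ h := by
  choose b hbi hbj using hb
  choose r hr0 a ha hφa using hr
  have hφ : ∀ {i j}, j ≠ i → ∀ t, (O j).φ (a i t) = 0 := fun {i j} hij t => by
    refine ((O j).map_eq_zero _).2 (((hP j).mem_or_mem (b j) _ fun x => ?_).resolve_left (hbi j))
    have := (hP i).twoSided
    rw [ha i t _ (Ideal.mul_mem_right x (P i) (hbj j i hij.symm))]
    exact (P j).zero_mem
  have hdvd : ∀ i, r i ∣ ∏ i, r i := fun i => Finset.dvd_prod_of_mem r (Finset.mem_univ i)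
  choose s hs using hdvd
  have hfin : ∀ i, Module.Finite (MvPolynomial (Fin d) k) (T i) := fun i => (O i).finite
  refine ⟨{
    φ := RingHom.pi fun i => (O i).φ
    map_eq_zero := fun h => ?_
    map_algebraMap := fun x => funext fun i => (O i).map_algebraMap x
    finite := Module.Finite.pi
    torsionFree := fun c t h => ?_
    c := ∏ i, r i
    c_ne_zero := Finset.prod_ne_zero_iff.2 fun i _ => hr0 i
    σ := fun t => ∑ i, a i (s i • t i)
    map_σ := fun t => funext fun j => ?_ }, fun _ _ => rfl⟩
  · rw [Ideal.mem_bot]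
    refine ⟨fun hh => hbot h fun i => ((O i).map_eq_zero h).1 (congrFun hh i), fun hh => ?_⟩
    rw [hh, map_zero]
  · refine or_iff_not_imp_left.2 fun hc => funext fun i => ?_
    exact ((O i).torsionFree c (t i) (congrFun h i)).resolve_left hc
  · refine (map_sum (O j).φ _ _).trans ?_
    rw [Finset.sum_eq_single j (fun i _ hij => hφ hij.symm _)
      (fun h => absurd (Finset.mem_univ j) h), hφa, smul_smul, ← hs]
    rfl

theorem closure_eq_top_of_adjoin_eq_top (O' : Overring k H ⊥ d (∀ i, T i))
    (hO' : ∀ h i, O'.φ h i = (O i).φ h)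
    (hT : ∀ i, Algebra.adjoin (MvPolynomial (Fin d) k) (Set.range (O i).φ) = ⊤) :
    Subring.closure (Set.range O'.φ ∪ Set.center (∀ i, T i)) = ⊤ := by
  classical
  have hc : ∀ i (r : MvPolynomial (Fin d) k), Pi.single i (algebraMap _ (T i) r) ∈
      Subring.closure (Set.range O'.φ ∪ Set.center (∀ i, T i)) := fun i r => by
    refine Subring.subset_closure (Or.inr (Semigroup.mem_center_iff.2 fun t => funext fun j => ?_))
    rcases eq_or_ne j i with rfl | h
    · simpa using (Algebra.commutes r (t j)).symm
    · simp [h]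
  refine eq_top_iff.2 fun t _ => ?_
  rw [← Finset.univ_sum_single t]
  refine Subring.sum_mem _ fun i _ => ?_
  generalize t i = t
  induction (by rw [hT i]; trivial : t ∈ Algebra.adjoin (MvPolynomial (Fin d) k)
    (Set.range (O i).φ)) using Algebra.adjoin_induction with
  | mem t ht =>
    obtain ⟨h, rfl⟩ := ht
    have h1 : Pi.single i ((O i).φ h) =
        Pi.single i (algebraMap (MvPolynomial (Fin d) k) (T i) 1) * O'.φ h := by
      rw [map_one, ← hO', ← Pi.single_mul_left, one_mul]
    rw [h1]
    exact mul_mem (hc i 1) (Subring.subset_closure (Or.inl ⟨h, rfl⟩))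
  | algebraMap r => exact hc i r
  | add a b _ _ ha hb => rw [Pi.single_add]; exact add_mem ha hb
  | mul a b _ _ ha hb => rw [Pi.single_mul]; exact mul_mem ha hb

end Pi

end Overring

namespace ExtBounds

variable {k : Type u'} [Field k] {H : Type u} [Ring H] [Algebra k H] [IsNoetherianRing H]
  [Algebra.FiniteType k H] {D : ℕ} {α : Equiv.Perm (Fin D) → k} {d : ℕ}

theorem exists_overring (hα : MultilinearIdentity k H α) (h1 : α 1 = 1) (E : ExtBounds k H d)
    {P : Ideal H} (hP : P.IsPrimeTwoSided) {b : H} (hb : b ∉ P)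
    (hPb : ∀ p ∈ P, ∀ x, p * x * b = 0) :
    ∃ (T : Type u) (_ : Ring T) (_ : Algebra (MvPolynomial (Fin d) k) T) (O : Overring k H P d T),
      Algebra.adjoin (MvPolynomial (Fin d) k) (Set.range O.φ) = ⊤ ∧
      ∃ r : MvPolynomial (Fin d) k, r ≠ 0 ∧ ∀ t, ∃ a, (∀ p ∈ P, p * a = 0) ∧ O.φ a = r • t := by
  obtain ⟨g, T, _, _, ⟨O⟩⟩ := hP.exists_overring hα h1
  have := O.adjoin.nontrivial hP.ne_top
  have hg := O.adjoin.le_of_mem_iff E (b := b) fun h => ⟨hPb h, fun hh =>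
    (hP.mem_or_mem h b fun x => by rw [hh x]; exact P.zero_mem).resolve_right hb⟩
  obtain ⟨rfl, hr⟩ := O.adjoin.exists_forall_exists_mul_eq_zero E hg
  exact ⟨_, _, _, O.adjoin, O.adjoin_range_adjoin, hr⟩

theorem exists_primes (hα : MultilinearIdentity k H α) (h1 : α 1 = 1) (S : H ≃ₐ[k] Hᵐᵒᵖ)
    (E : ExtBounds k H d) :
    ∃ (n : ℕ) (P : Fin n → Ideal H), (∀ i, (P i).IsPrimeTwoSided) ∧
      (∀ h, (∀ i, h ∈ P i) → h = 0) ∧ ∀ i, ∃ b, b ∉ P i ∧ ∀ j, j ≠ i → b ∈ P j := by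
  classical
  have hex : ∃ (n : ℕ) (P : Fin n → Ideal H), (∀ i, (P i).IsPrimeTwoSided) ∧
      ∀ h, (∀ i, h ∈ P i) → h = 0 := by
    obtain ⟨s, hs, hs'⟩ := Ideal.exists_finset_isPrimeTwoSided (⊥ : Ideal H) inferInstance
    refine ⟨s.card, fun i => s.equivFin.symm i, fun i => hs _ (s.equivFin.symm i).2,
      fun h hh => ?_⟩
    have hN : s.inf id = ⊥ := E.eq_bot_of_forall_isPrimeTwoSided hα h1 S fun Q hQ => by
      obtain ⟨P, hP, hPQ⟩ := hs' Q hQ bot_le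
      exact (Finset.inf_le hP).trans hPQ
    rw [← Ideal.mem_bot, ← hN, Submodule.mem_finsetInf]
    intro P hP
    simpa using hh (s.equivFin ⟨P, hP⟩)
  obtain ⟨P, hP, hbot⟩ := Nat.find_spec hex
  refine ⟨_, P, hP, hbot, fun i => ?_⟩
  by_contra! hc
  have hpos : 0 < Nat.find hex := i.pos
  obtain ⟨m, hm⟩ : ∃ m, Nat.find hex = m + 1 := ⟨Nat.find hex - 1, by lia⟩
  refine Nat.find_min hex (m := m) (by lia) ⟨fun j => P (Fin.cast hm.symm
    ((Fin.cast hm i).succAbove j)), fun j => hP _, fun h hh => hbot h ?_⟩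
  have hne : ∀ j, j ≠ i → h ∈ P j := fun j hj => by
    obtain ⟨l, hl⟩ := Fin.exists_succAbove_eq (x := Fin.cast hm j) (y := Fin.cast hm i)
      fun h => hj (Fin.cast_injective hm h)
    have := hh l
    simp only [hl] at this
    exact this
  intro j
  rcases eq_or_ne j i with rfl | hj
  · by_contra hcj
    obtain ⟨l, hl, hl'⟩ := hc h hcj
    exact hl' (hne l hl)
  · exact hne j hj

theorem finiteDirectSumOfPrimeRings (hα : MultilinearIdentity k H α) (h1 : α 1 = 1)
    (S : H ≃ₐ[k] Hᵐᵒᵖ) (E : ExtBounds k H d) :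
    Nonempty (FiniteDirectSumOfPrimeRings H) ∧ Module.Finite (Subring.center H) H := by
  obtain ⟨n, P, hP, hbot, hb⟩ := E.exists_primes hα h1 S
  have key : ∀ i, ∃ (T : Type u) (_ : Ring T) (_ : Algebra (MvPolynomial (Fin d) k) T)
      (O : Overring k H (P i) d T), Algebra.adjoin (MvPolynomial (Fin d) k) (Set.range O.φ) = ⊤ ∧
      ∃ r : MvPolynomial (Fin d) k, r ≠ 0 ∧
        ∀ t, ∃ a, (∀ p ∈ P i, p * a = 0) ∧ O.φ a = r • t := fun i => by
    obtain ⟨b, hb₁, hb₂⟩ := hb i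
    refine E.exists_overring hα h1 (hP i) hb₁ fun p hp x => hbot _ fun j => ?_
    have := (hP j).twoSided
    rcases eq_or_ne j i with rfl | hj
    · exact Ideal.mul_mem_right b (P j) (Ideal.mul_mem_right x (P j) hp)
    · exact (P j).mul_mem_left _ (hb₂ j hj)
  choose T _ _ O hT hr using key
  obtain ⟨O', hO'⟩ := Overring.exists_pi O hP hbot hb hr
  have hsurj : Function.Surjective O'.φ := O'.surjective_of_closure_eq_top E rfl
    (Overring.closure_eq_top_of_adjoin_eq_top O O' hO' hT)
  have hinj : Function.Injective O'.φ := (injective_iff_map_eq_zero O'.φ).2 fun h hh =>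
    (O'.map_eq_zero h).1 hh
  let e : H ≃+* ∀ i, T i := RingEquiv.ofBijective O'.φ ⟨hinj, hsurj⟩
  refine ⟨⟨{ n := n, factor := T, isPrime := fun i a b hab => ?_, equiv := e }⟩, ?_⟩
  · classical
    have hs : ∀ t, ∃ h, (O i).φ h = t := fun t => by
      obtain ⟨h, hh⟩ := hsurj (Pi.single i t)
      exact ⟨h, by rw [← hO', hh, Pi.single_eq_same]⟩
    obtain ⟨a, rfl⟩ := hs a
    obtain ⟨b, rfl⟩ := hs b
    rw [(O i).map_eq_zero, (O i).map_eq_zero]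
    refine (hP i).mem_or_mem a b fun x => ((O i).map_eq_zero _).1 ?_
    rw [map_mul, map_mul, hab]
  · obtain ⟨s, hs⟩ := O'.finite
    have hc : ∀ r : MvPolynomial (Fin d) k, e.symm (algebraMap _ _ r) ∈ Subring.center H :=
      fun r => Subring.mem_center_iff.2 fun h => e.injective (by
        rw [map_mul, map_mul, e.apply_symm_apply, Algebra.commutes])
    classical
    refine ⟨s.image e.symm, eq_top_iff.2 fun h _ => ?_⟩
    rw [← e.symm_apply_apply h]
    generalize e h = t
    induction (by rw [hs]; trivial : t ∈ Submodule.span (MvPolynomial (Fin d) k)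
      (s : Set (∀ i, T i))) using Submodule.span_induction with
    | mem t ht => exact Submodule.subset_span (Finset.mem_coe.2 (Finset.mem_image_of_mem _ ht))
    | zero => rw [map_zero]; exact Submodule.zero_mem _
    | add a b _ _ ha hb => rw [map_add]; exact Submodule.add_mem _ ha hb
    | smul r t _ ht =>
      rw [Algebra.smul_def, map_mul]
      exact Submodule.smul_mem _ (⟨_, hc r⟩ : Subring.center H) ht

end ExtBounds

theorem affine_noetherian_PI_hopf_of_finite_global_dimension
    (k : Type u') [Field k] (H : Type u) [Ring H] [HopfAlgebra k H]
    (hS : Function.Bijective (HopfAlgebra.antipode k : H →ₗ[k] H))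
    (haff : Algebra.FiniteType k H)
    (hnoeth : IsNoetherianRing H) (hnoeth' : IsNoetherianRing Hᵐᵒᵖ)
    (hPI : SatisfiesPolynomialIdentity k H)
    (hgl : HasFiniteGlobalDimension H) :
    Nonempty (FiniteDirectSumOfPrimeRings H) ∧ Module.Finite (Subring.center H) H := by
  obtain ⟨D, α, h1, hα⟩ := exists_multilinearIdentity hPI
  obtain ⟨d, htop, hd⟩ := exists_top_degree k H hgl
  refine ExtBounds.finiteDirectSumOfPrimeRings (d := d) hα h1
    (AlgEquiv.ofBijective (HopfAlgebra.antipodeAlgHomOp k H)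
      (MulOpposite.opEquiv.bijective.comp hS))
    { finite := fun {n M} _ _ _ h q => ?_
      subsingleton_of_lt := htop
      subsingleton_of_finite := ModExt.subsingleton_of_finiteDimensional hα h1 hS htop hd }
  let _ := h.comm
  have := h.finite_left
  have := h.finite_right
  exact ModExt.finite hα h1 h.compat H q
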